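/- If K is a cyclic cubic field (a number field of degree 3 over ℚ that is Galois over ℚ) whose discriminant is at least (2×10^20)² = 4×10^40, then K is not norm-Euclidean. -/

import Mathlib

/-- A number field `K` is norm-Euclidean if for every `α ∈ K` there exists an algebraic
integer `β` of `K` such that `|N_{K/ℚ}(α - β)| < 1`. -/
def IsNormEuclidean (K : Type*) [Field K] [NumberField K] : Prop :=
  ∀ α : K, ∃ β : NumberField.RingOfIntegers K, |Algebra.norm ℚ (α - (β : K))| < 1

namespace CCF
open Finset
open scoped ArithmeticFunction.vonMangoldt Nat

noncomputable def Lam (d : ℕ) : ℝ := ArithmeticFunction.vonMangoldt d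
noncomputable def psi (n : ℕ) : ℝ := ∑ d ∈ Icc 1 n, Lam d
noncomputable def MM (n : ℕ) : ℝ := ∑ d ∈ Icc 1 n, Lam d / d
/-- weight of the set `P` with the tent weight `N - n` -/
noncomputable def TT (N : ℕ) (P : ℕ → Prop) : ℝ := by
  classical exact ∑ n ∈ (Ico 1 N).filter P, ((N : ℝ) - n)

lemma Lam_nonneg (d : ℕ) : 0 ≤ Lam d := ArithmeticFunction.vonMangoldt_nonneg

lemma Lam_prime {q : ℕ} (hq : q.Prime) : Lam q = Real.log q :=
  ArithmeticFunction.vonMangoldt_apply_prime hq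

lemma log_eq_sum (n N : ℕ) (hn : 1 ≤ n) (hN : n ≤ N) :
    Real.log n = ∑ d ∈ Icc 1 N, if d ∣ n then Lam d else 0 := by
  rw [← ArithmeticFunction.vonMangoldt_sum, ← Finset.sum_filter]
  apply Finset.sum_congr
  · ext d
    simp only [Nat.mem_divisors, mem_filter, mem_Icc]
    constructor
    · rintro ⟨h, h0⟩
      exact ⟨⟨Nat.pos_of_dvd_of_pos h hn, (Nat.le_of_dvd hn h).trans hN⟩, h⟩
    · rintro ⟨_, h⟩
      exact ⟨h, by omega⟩
  · intros; rfl

lemma log_factorial_eq (n : ℕ) :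
    Real.log (n ! : ℕ) = ∑ d ∈ Icc 1 n, Lam d * (n / d : ℕ) := by
  have h1 : Real.log (n ! : ℕ) = ∑ m ∈ Icc 1 n, Real.log m := by
    induction n with
    | zero => simp
    | succ k ih =>
      rw [Nat.factorial_succ, Finset.sum_Icc_succ_top (by omega), ← ih]
      push_cast
      rw [Real.log_mul (by positivity) (by positivity)]
      ring
  rw [h1, Finset.sum_congr rfl (fun m hm => log_eq_sum m n (mem_Icc.1 hm).1 (mem_Icc.1 hm).2),
    Finset.sum_comm]
  apply Finset.sum_congr rfl
  intro d hd
  rw [← Finset.sum_filter, Finset.sum_const, nsmul_eq_mul, mul_comm]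
  congr 2
  rw [← Nat.Ioc_filter_dvd_card_eq_div]
  congr 1

lemma log_fact_lower (n : ℕ) : n * Real.log n - n ≤ Real.log (n ! : ℕ) := by
  rcases Nat.eq_zero_or_pos n with rfl | h
  · simp
  have := Stirling.le_log_factorial_stirling (n := n) (by omega)
  have h2 : 0 ≤ Real.log n := Real.log_natCast_nonneg n
  have h3 : 0 ≤ Real.log (2 * Real.pi) := by
    apply Real.log_nonneg
    have := Real.pi_gt_three
    linarith
  linarith

lemma log_fact_upper (n : ℕ) (hn : 1 ≤ n) :
    Real.log (n ! : ℕ) ≤ n * Real.log n - n + Real.log n + 1 := by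
  induction n, hn using Nat.le_induction with
  | base => simp
  | succ k hk ih =>
    rw [Nat.factorial_succ]
    push_cast
    rw [Real.log_mul (by positivity) (by positivity)]
    have hk' : (1 : ℝ) ≤ k := by exact_mod_cast hk
    have h1 : Real.log k ≤ Real.log (k + 1) - 1 / (k + 1) := by
      have := Real.log_le_sub_one_of_pos (x := (k : ℝ) / (k + 1)) (by positivity)
      rw [Real.log_div (by positivity) (by positivity)] at this
      have h : (k : ℝ) / (k + 1) - 1 = - (1 / (k + 1)) := by field_simp; ring
      linarith
    have h2 : (k + 1 : ℝ) * Real.log k ≤ (k + 1) * Real.log (k + 1) - 1 := by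
      have := mul_le_mul_of_nonneg_left h1 (by positivity : (0 : ℝ) ≤ k + 1)
      have h : (k + 1 : ℝ) * (Real.log (k + 1) - 1 / (k + 1)) = (k + 1) * Real.log (k + 1) - 1 := by
        field_simp
      linarith
    linarith

lemma xlogx_mono {x y : ℝ} (hx : 1 ≤ x) (hxy : x ≤ y) :
    x * Real.log x - x ≤ y * Real.log y - y := by
  have hx0 : 0 < x := by linarith
  have hy0 : 0 < y := by linarith
  have h1 : 0 ≤ Real.log x := Real.log_nonneg hx
  have h2 := Real.log_le_sub_one_of_pos (x := x / y) (by positivity)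
  rw [Real.log_div (by positivity) (by positivity)] at h2
  have h3 : y * (Real.log x - Real.log y) ≤ y * (x / y - 1) :=
    mul_le_mul_of_nonneg_left h2 (by linarith)
  have h4 : y * (x / y - 1) = x - y := by field_simp
  nlinarith

lemma log_fact_div_bounds (n k : ℕ) (hk : 1 ≤ k) (hkn : k ≤ n) :
    |Real.log (((n / k : ℕ)! : ℕ)) - ((n / k : ℝ) * Real.log (n / k) - n / k)|
      ≤ Real.log n + 1 := by
  set m := n / k with hm
  have hm1 : 1 ≤ m := (Nat.one_le_div_iff (by omega)).2 hkn
  have hkR : (1 : ℝ) ≤ k := by exact_mod_cast hk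
  have hmR : (1 : ℝ) ≤ m := by exact_mod_cast hm1
  set x : ℝ := (n : ℝ) / k with hx
  have hmx : (m : ℝ) ≤ x := Nat.cast_div_le
  have hxm : x ≤ m + 1 := by
    rw [hx, div_le_iff₀ (by linarith)]
    have : n < (m + 1) * k := by
      have := Nat.lt_succ_iff.2 (le_refl m)
      rw [hm] at this ⊢
      exact Nat.lt_mul_of_div_lt this (by omega) 
    exact_mod_cast this.le
  have hxn : x ≤ n := div_le_self (by positivity) hkR
  have hup := log_fact_upper m hm1
  have h1 := xlogx_mono hmR hmx
  have h2 : Real.log m ≤ Real.log n := Real.log_le_log (by linarith) (hmx.trans hxn)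
  have hlo := log_fact_lower (m + 1)
  rw [Nat.factorial_succ] at hlo
  push_cast at hlo
  rw [Real.log_mul (by positivity) (by positivity)] at hlo
  have h3 := xlogx_mono (hmR.trans hmx) hxm
  have hn0 : (0 : ℝ) < n := by linarith
  have h4 : Real.log (m + 1) ≤ Real.log n + 1 := by
    have h5 : Real.log (m + 1) ≤ Real.log (n * 2) :=
      Real.log_le_log (by positivity) (by linarith)
    rw [Real.log_mul (by positivity) (by positivity)] at h5
    have := Real.log_two_lt_d9
    linarith
  rw [abs_le]
  constructor <;> linarith

end CCF

namespace CCF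
open Finset
open scoped ArithmeticFunction.vonMangoldt Nat

lemma cheb_F (m : ℕ) : m / 2 + m / 3 + m / 5 ≤ m + m / 30 ∧ m + m / 30 ≤ m / 2 + m / 3 + m / 5 + 1 := by
  omega

lemma log_fact_div_eq (n k : ℕ) (hk : 1 ≤ k) :
    Real.log (((n / k : ℕ)! : ℕ)) = ∑ d ∈ Icc 1 n, Lam d * ((n / d) / k : ℕ) := by
  rw [log_factorial_eq]
  have hsub : Icc 1 (n / k) ⊆ Icc 1 n := Icc_subset_Icc le_rfl (Nat.div_le_self n k)
  rw [Finset.sum_congr rfl (g := fun d => Lam d * ((n / d) / k : ℕ))]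
  · apply Finset.sum_subset hsub
    intro d hd hd'
    simp only [mem_Icc, not_and, not_le] at hd hd'
    have h1 : n / d / k = 0 := by
      rw [Nat.div_div_eq_div_mul, mul_comm, ← Nat.div_div_eq_div_mul]
      exact Nat.div_eq_of_lt (hd' hd.1)
    simp [h1]
  · intro d hd
    rw [Nat.div_div_eq_div_mul, Nat.div_div_eq_div_mul, mul_comm k d]

noncomputable def cA : ℝ :=
  Real.log 2 / 2 + Real.log 3 / 3 + Real.log 5 / 5 - Real.log 30 / 30

lemma log30 : Real.log 30 = Real.log 2 + Real.log 3 + Real.log 5 := by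
  rw [← Real.log_mul (by norm_num) (by norm_num), ← Real.log_mul (by norm_num) (by norm_num)]
  norm_num

lemma log3_bounds : 1.09857 ≤ Real.log 3 ∧ Real.log 3 ≤ 1.0989 := by
  have h1 : Real.log ((2:ℝ) ^ 84) ≤ Real.log ((3:ℝ) ^ 53) :=
    Real.log_le_log (by norm_num) (by norm_num)
  have h2 : Real.log ((3:ℝ) ^ 41) ≤ Real.log ((2:ℝ) ^ 65) :=
    Real.log_le_log (by norm_num) (by norm_num)
  rw [Real.log_pow, Real.log_pow] at h1 h2
  have := Real.log_two_gt_d9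
  have := Real.log_two_lt_d9
  push_cast at h1 h2
  constructor <;> linarith

lemma log5_bounds : 1.6093 ≤ Real.log 5 ∧ Real.log 5 ≤ 1.60953 := by
  have h1 : Real.log ((5:ℝ) ^ 59) ≤ Real.log ((2:ℝ) ^ 137) :=
    Real.log_le_log (by norm_num) (by norm_num)
  have h2 : Real.log ((2:ℝ) ^ 202) ≤ Real.log ((5:ℝ) ^ 87) :=
    Real.log_le_log (by norm_num) (by norm_num)
  rw [Real.log_pow, Real.log_pow] at h1 h2
  have := Real.log_two_gt_d9
  have := Real.log_two_lt_d9
  push_cast at h1 h2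
  constructor <;> linarith

lemma cA_bounds : 0.9212 ≤ cA ∧ cA ≤ 0.9214 := by
  have := log3_bounds
  have := log5_bounds
  have := Real.log_two_gt_d9
  have := Real.log_two_lt_d9
  rw [cA, log30]
  constructor <;> linarith

/-- The Chebyshev combination. -/
lemma cheb_comb (n : ℕ) (hn : 30 ≤ n) :
    |∑ d ∈ Icc 1 n, Lam d * ((n / d : ℕ) - ((n / d) / 2 : ℕ) - ((n / d) / 3 : ℕ)
      - ((n / d) / 5 : ℕ) + ((n / d) / 30 : ℕ) : ℝ) - cA * n| ≤ 5 * (Real.log n + 1) := by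
  have hs : ∑ d ∈ Icc 1 n, Lam d * ((n / d : ℕ) - ((n / d) / 2 : ℕ) - ((n / d) / 3 : ℕ)
      - ((n / d) / 5 : ℕ) + ((n / d) / 30 : ℕ) : ℝ) =
      Real.log ((n / 1 : ℕ)! : ℕ) - Real.log ((n / 2 : ℕ)! : ℕ) - Real.log ((n / 3 : ℕ)! : ℕ)
      - Real.log ((n / 5 : ℕ)! : ℕ) + Real.log ((n / 30 : ℕ)! : ℕ) := by
    rw [log_fact_div_eq n 1 (by norm_num), log_fact_div_eq n 2 (by norm_num),
      log_fact_div_eq n 3 (by norm_num), log_fact_div_eq n 5 (by norm_num),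
      log_fact_div_eq n 30 (by norm_num), ← Finset.sum_sub_distrib, ← Finset.sum_sub_distrib,
      ← Finset.sum_sub_distrib, ← Finset.sum_add_distrib]
    apply Finset.sum_congr rfl
    intro d _
    rw [Nat.div_one]
    ring
  rw [hs]
  have hn0 : (0 : ℝ) < n := by exact_mod_cast (by omega : 0 < n)
  have e1 := abs_le.1 (log_fact_div_bounds n 1 (by norm_num) (by omega))
  have e2 := abs_le.1 (log_fact_div_bounds n 2 (by norm_num) (by omega))
  have e3 := abs_le.1 (log_fact_div_bounds n 3 (by norm_num) (by omega))
  have e5 := abs_le.1 (log_fact_div_bounds n 5 (by norm_num) (by omega))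
  have e30 := abs_le.1 (log_fact_div_bounds n 30 (by norm_num) (by omega))
  push_cast at e1 e2 e3 e5 e30
  rw [Real.log_div hn0.ne' (by norm_num)] at e1 e2 e3 e5 e30
  rw [Real.log_one] at e1
  rw [abs_le, cA]
  constructor <;> nlinarith

lemma psi_lower (n : ℕ) (hn : 30 ≤ n) : 0.9212 * n - 5 * (Real.log n + 1) ≤ psi n := by
  have h := (abs_le.1 (cheb_comb n hn)).1
  have h2 : ∑ d ∈ Icc 1 n, Lam d * ((n / d : ℕ) - ((n / d) / 2 : ℕ) - ((n / d) / 3 : ℕ)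
      - ((n / d) / 5 : ℕ) + ((n / d) / 30 : ℕ) : ℝ) ≤ psi n := by
    apply Finset.sum_le_sum
    intro d _
    apply mul_le_of_le_one_right (Lam_nonneg d)
    have : ((n / d + n / d / 30 : ℕ) : ℝ) ≤ (n / d / 2 + n / d / 3 + n / d / 5 + 1 : ℕ) := by
      exact_mod_cast (cheb_F (n / d)).2
    push_cast at this
    linarith
  have := mul_le_mul_of_nonneg_right cA_bounds.1 (Nat.cast_nonneg (α := ℝ) n)
  linarith

lemma psi_mono {m n : ℕ} (h : m ≤ n) : psi m ≤ psi n :=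
  Finset.sum_le_sum_of_subset_of_nonneg (Icc_subset_Icc le_rfl h) (fun d _ _ => Lam_nonneg d)

lemma psi_diff (n : ℕ) (hn : 30 ≤ n) :
    psi n - psi (n / 6) ≤ 0.9214 * n + 5 * (Real.log n + 1) := by
  have h := (abs_le.1 (cheb_comb n hn)).2
  have h2 : psi n - psi (n / 6) ≤
      ∑ d ∈ Icc 1 n, Lam d * ((n / d : ℕ) - ((n / d) / 2 : ℕ) - ((n / d) / 3 : ℕ)
      - ((n / d) / 5 : ℕ) + ((n / d) / 30 : ℕ) : ℝ) := by
    have hd : psi n - psi (n / 6) = ∑ d ∈ Icc 1 n \ Icc 1 (n / 6), Lam d := by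
      rw [psi, psi, ← Finset.sum_sdiff (Icc_subset_Icc le_rfl (Nat.div_le_self n 6) :
        Icc 1 (n / 6) ⊆ Icc 1 n)]
      ring
    rw [hd]
    refine le_trans (Finset.sum_le_sum ?_) (Finset.sum_le_sum_of_subset_of_nonneg
      Finset.sdiff_subset ?_)
    · intro d hd
      simp only [mem_sdiff, mem_Icc, not_and, not_le] at hd
      apply le_mul_of_one_le_right (Lam_nonneg d)
      have h6 : n / d < 6 := by
        rw [Nat.div_lt_iff_lt_mul (by omega)]
        have := hd.2 hd.1.1
        omega
      have h1 : 1 ≤ n / d := (Nat.one_le_div_iff (by omega)).2 hd.1.2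
      have : ((n / d / 2 + n / d / 3 + n / d / 5 + 1 : ℕ) : ℝ) ≤ (n / d + n / d / 30 : ℕ) := by
        have : n / d / 2 + n / d / 3 + n / d / 5 + 1 ≤ n / d + n / d / 30 := by
          generalize n / d = m at *
          omega
        exact_mod_cast this
      push_cast at this
      linarith
    · intro d _ _
      apply mul_nonneg (Lam_nonneg d)
      have : ((n / d / 2 + n / d / 3 + n / d / 5 : ℕ) : ℝ) ≤ (n / d + n / d / 30 : ℕ) := by
        exact_mod_cast (cheb_F (n / d)).1
      push_cast at this
      linarith
  have := mul_le_mul_of_nonneg_right cA_bounds.2 (Nat.cast_nonneg (α := ℝ) n)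
  linarith

lemma log_6 : 1.79 ≤ Real.log 6 := by
  have : Real.log 6 = Real.log 2 + Real.log 3 := by
    rw [← Real.log_mul (by norm_num) (by norm_num)]; norm_num
  have := log3_bounds
  have := Real.log_two_gt_d9
  linarith

lemma psi_trivial (n : ℕ) : psi n ≤ n * Real.log n := by
  rw [psi]
  calc ∑ d ∈ Icc 1 n, Lam d ≤ ∑ d ∈ Icc 1 n, Real.log n := by
        apply Finset.sum_le_sum
        intro d hd
        rw [mem_Icc] at hd
        exact (ArithmeticFunction.vonMangoldt_le_log).trans
          (Real.log_le_log (by exact_mod_cast hd.1) (by exact_mod_cast hd.2))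
    _ = _ := by simp

lemma psi_upper_aux (n : ℕ) (hn : 1 ≤ n) :
    psi n ≤ 1.10568 * n + 3 * (Real.log n + 1) ^ 2 + 70 := by
  induction n using Nat.strong_induction_on with
  | _ n ih =>
    have hn0 : (0 : ℝ) < n := by exact_mod_cast hn
    have hl : 0 ≤ Real.log n := Real.log_natCast_nonneg n
    rcases lt_or_ge n 30 with h | h
    · have h1 := psi_trivial n
      have h2 : (n : ℝ) ≤ 29 := by exact_mod_cast (by omega : n ≤ 29)
      have h3 : Real.log n ≤ 3.5 := by
        have : Real.log n ≤ Real.log 32 := Real.log_le_log hn0 (by linarith)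
        have e : Real.log 32 = 5 * Real.log 2 := by
          rw [← Real.log_rpow (by norm_num)]; norm_num
        have := Real.log_two_lt_d9
        linarith
      nlinarith
    · have h6 : 1 ≤ n / 6 := by omega
      have i := ih (n / 6) (by omega) h6
      have d := psi_diff n h
      have hc : ((n / 6 : ℕ) : ℝ) ≤ n / 6 := by exact_mod_cast (Nat.cast_div_le (α := ℝ) (m := n) (n := 6))
      have hl6 : Real.log ((n / 6 : ℕ) : ℝ) ≤ Real.log n - 1.79 := by
        have : Real.log ((n / 6 : ℕ) : ℝ) ≤ Real.log (n / 6) :=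
          Real.log_le_log (by exact_mod_cast h6) hc
        rw [Real.log_div (by positivity) (by norm_num)] at this
        linarith [log_6]
      have hl6' : 0 ≤ Real.log ((n / 6 : ℕ) : ℝ) := Real.log_natCast_nonneg _
      have hl30 : 3 ≤ Real.log n := by
        have : Real.log 30 ≤ Real.log n := Real.log_le_log (by norm_num) (by exact_mod_cast h)
        have := log30; have := log3_bounds; have := log5_bounds; have := Real.log_two_gt_d9
        linarith
      have hsq : (Real.log ((n / 6 : ℕ) : ℝ) + 1) ^ 2 ≤ (Real.log n - 0.79) ^ 2 := by
        apply pow_le_pow_left₀ (by linarith); linarith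
      nlinarith
end CCF

namespace CCF
open Finset
open scoped ArithmeticFunction.vonMangoldt Nat

lemma log_3e5 : Real.log 300000 ≤ 12.615 := by
  have : Real.log 300000 = Real.log 3 + 5 * Real.log 2 + 5 * Real.log 5 := by
    rw [show (300000 : ℝ) = 3 * 2 ^ 5 * 5 ^ 5 by norm_num, Real.log_mul (by norm_num) (by norm_num),
      Real.log_mul (by norm_num) (by norm_num), Real.log_pow, Real.log_pow]
    norm_num
  have := log3_bounds; have := log5_bounds; have := Real.log_two_lt_d9
  linarith

/-- bound of log by square root growth -/
lemma log_le_sqrt {a x : ℝ} (ha : 0 < a) (hx : a ≤ x) :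
    Real.log x ≤ Real.log a + 2 * (Real.sqrt (x / a) - 1) := by
  have hx0 : 0 < x := ha.trans_le hx
  have h1 : Real.log x = Real.log a + 2 * Real.log (Real.sqrt (x / a)) := by
    rw [Real.log_sqrt (by positivity), Real.log_div hx0.ne' ha.ne']; ring
  have h2 := Real.log_le_sub_one_of_pos (x := Real.sqrt (x / a)) (by positivity)
  linarith

lemma psi_upper (n : ℕ) (hn : 300000 ≤ n) : psi n ≤ 1.108 * n := by
  have h := psi_upper_aux n (by omega)
  have hR : (300000 : ℝ) ≤ n := by exact_mod_cast hn
  have h1 := log_le_sqrt (by norm_num) hR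
  set y := Real.sqrt ((n : ℝ) / 300000) with hy
  have hy2 : (n : ℝ) = 300000 * y ^ 2 := by
    rw [hy, Real.sq_sqrt (by positivity)]; field_simp
  have hy1 : 1 ≤ y := by
    rw [hy]; apply Real.one_le_sqrt.2; rw [le_div_iff₀ (by norm_num)]; linarith
  have hl0 : 0 ≤ Real.log n := Real.log_natCast_nonneg n
  have h2 : (Real.log n + 1) ^ 2 ≤ (11.615 + 2 * y) ^ 2 := by
    apply pow_le_pow_left₀ (by linarith); linarith [log_3e5]
  have h3 : 3 * (11.615 + 2 * y) ^ 2 + 70 ≤ 0.00232 * (300000 * y ^ 2) := by nlinarith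
  rw [← hy2] at h3
  linarith

lemma log_1e5 : Real.log 100000 ≤ 11.52 := by
  have : Real.log 100000 = 5 * Real.log 2 + 5 * Real.log 5 := by
    rw [show (100000 : ℝ) = 2 ^ 5 * 5 ^ 5 by norm_num, 
      Real.log_mul (by norm_num) (by norm_num), Real.log_pow, Real.log_pow]
    norm_num
  have := log5_bounds; have := Real.log_two_lt_d9
  linarith

lemma log_le_lin {a x : ℝ} (ha : 0 < a) (hx : 0 < x) :
    Real.log x ≤ Real.log a + (x / a - 1) := by
  have h2 := Real.log_le_sub_one_of_pos (x := x / a) (by positivity)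
  rw [Real.log_div hx.ne' ha.ne'] at h2
  linarith

lemma psi_lower' (n : ℕ) (hn : 100000 ≤ n) : 0.9205 * n ≤ psi n := by
  have h := psi_lower n (by omega)
  have hR : (100000 : ℝ) ≤ n := by exact_mod_cast hn
  have h1 := log_le_lin (a := 100000) (x := n) (by norm_num) (by linarith)
  have := log_1e5
  have h3 : (n : ℝ) / 100000 = n * 0.00001 := by ring
  rw [h3] at h1
  linarith

lemma sum_mult (N d : ℕ) (hd : 1 ≤ d) :
    TT N (d ∣ ·) = ∑ m ∈ Icc 1 (N / d), ((N : ℝ) - d * m) := by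
  classical
  rw [TT]
  symm
  have h1 : ∑ m ∈ Icc 1 (N / d), ((N : ℝ) - d * m)
      = ∑ n ∈ (Icc 1 N).filter (d ∣ ·), ((N : ℝ) - n) := by
    apply Finset.sum_bij (fun m _ => d * m)
    · intro m hm
      simp only [mem_Icc, mem_filter] at hm ⊢
      refine ⟨⟨Nat.mul_pos hd hm.1, ?_⟩, Dvd.intro m rfl⟩
      exact (Nat.mul_le_mul_left d hm.2).trans (Nat.mul_div_le N d)
    · intro a _ b _ h
      exact Nat.eq_of_mul_eq_mul_left hd h
    · intro n hn
      simp only [mem_Icc, mem_filter] at hn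
      obtain ⟨⟨h1, h2⟩, m, rfl⟩ := hn
      refine ⟨m, ?_, rfl⟩
      rw [mem_Icc]
      constructor
      · by_contra h
        have : m = 0 := by omega
        subst this
        simp at h1
      · rw [Nat.le_div_iff_mul_le hd]; linarith
    · intro m _
      push_cast; ring
  rw [h1]
  symm
  apply Finset.sum_subset
  · intro n hn
    simp only [mem_Ico, mem_Icc, mem_filter] at hn ⊢
    exact ⟨⟨hn.1.1, hn.1.2.le⟩, hn.2⟩
  · intro n hn hn'
    simp only [mem_Ico, mem_Icc, mem_filter, not_and] at hn hn'
    have : n = N := by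
      by_contra h
      exact hn' ⟨hn.1.1, by omega⟩ hn.2
    simp [this]

lemma sum_Icc_id (k : ℕ) : ∑ m ∈ Icc 1 k, (m : ℝ) = k * (k + 1) / 2 := by
  induction k with
  | zero => simp
  | succ k ih =>
    rw [Finset.sum_Icc_succ_top (by omega), ih]; push_cast; ring

lemma TT_dvd (N d : ℕ) (hd : 1 ≤ d) :
    TT N (d ∣ ·) = (N : ℝ) ^ 2 / (2 * d) - N / 2
      + ((N % d : ℕ) : ℝ) * (d - (N % d : ℕ)) / (2 * d) := by
  rw [sum_mult N d hd, Finset.sum_sub_distrib, ← Finset.mul_sum, sum_Icc_id]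
  have hN : (N : ℝ) = d * (N / d : ℕ) + (N % d : ℕ) := by
    exact_mod_cast (Nat.div_add_mod N d).symm
  have hd0 : (0 : ℝ) < d := by exact_mod_cast hd
  simp only [sum_const, Nat.card_Icc, nsmul_eq_mul, Nat.add_sub_cancel]
  rw [hN]
  field_simp
  ring

lemma TT_nonneg (N : ℕ) (P : ℕ → Prop) : 0 ≤ TT N P := by
  classical
  rw [TT]
  apply Finset.sum_nonneg
  intro n hn
  simp only [mem_Ico, mem_filter] at hn
  have : (n : ℝ) ≤ N := by exact_mod_cast hn.1.2.le
  linarith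

lemma TT_dvd_le (N d : ℕ) (hd : 1 ≤ d) : TT N (d ∣ ·) ≤ (N : ℝ) ^ 2 / (2 * d) := by
  rw [TT_dvd N d hd]
  have hd0 : (0 : ℝ) < d := by exact_mod_cast hd
  have h1 : ((N % d : ℕ) : ℝ) * (d - (N % d : ℕ)) / (2 * d) ≤ N / 2 := by
    rw [div_le_div_iff₀ (by positivity) (by norm_num)]
    have h2 : ((N % d : ℕ) : ℝ) ≤ N := by exact_mod_cast Nat.mod_le N d
    have h3 : (0 : ℝ) ≤ (N % d : ℕ) := by positivity
    nlinarith
  linarith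

lemma TT_dvd_ge (N d : ℕ) (hd : 1 ≤ d) : (N : ℝ) ^ 2 / (2 * d) - N / 2 ≤ TT N (d ∣ ·) := by
  rw [TT_dvd N d hd]
  have hd0 : (0 : ℝ) < d := by exact_mod_cast hd
  have h2 : ((N % d : ℕ) : ℝ) ≤ d := by exact_mod_cast (Nat.mod_lt N hd).le
  have h1 : 0 ≤ ((N % d : ℕ) : ℝ) * (d - (N % d : ℕ)) / (2 * d) := by
    apply div_nonneg _ (by positivity)
    apply mul_nonneg (by positivity); linarith
  linarith

lemma TT_dvd_le2 (N d : ℕ) (hd : 1 ≤ d) (hN : d ≤ N) :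
    TT N (d ∣ ·) ≤ (N : ℝ) ^ 2 / (2 * d) - N / 2 + 0.1716 * N / 2 := by
  rw [TT_dvd N d hd]
  have hd0 : (0 : ℝ) < d := by exact_mod_cast hd
  have hk : (1 : ℝ) ≤ (N / d : ℕ) := by exact_mod_cast (Nat.one_le_div_iff hd).2 hN
  have hN : (N : ℝ) = d * (N / d : ℕ) + (N % d : ℕ) := by
    exact_mod_cast (Nat.div_add_mod N d).symm
  have h1 : ((N % d : ℕ) : ℝ) * (d - (N % d : ℕ)) / (2 * d) ≤ 0.1716 * N / 2 := by
    rw [div_le_div_iff₀ (by positivity) (by norm_num)]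
    have h3 : (0 : ℝ) ≤ (N % d : ℕ) := by positivity
    have h4 : (d : ℝ) + (N % d : ℕ) ≤ N := by nlinarith
    generalize ((N % d : ℕ) : ℝ) = r at *
    nlinarith [sq_nonneg (r - 0.4142 * d), mul_le_mul_of_nonneg_left h4 hd0.le]
  linarith

lemma TT_dvd_le3 (N d : ℕ) (hd : 1 ≤ d) (hN : 3 * d ≤ N) :
    TT N (d ∣ ·) ≤ (N : ℝ) ^ 2 / (2 * d) - N / 2 + (1/12) * N / 2 := by
  rw [TT_dvd N d hd]
  have hd0 : (0 : ℝ) < d := by exact_mod_cast hd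
  have hN' : 3 * (d : ℝ) ≤ N := by exact_mod_cast hN
  have h1 : ((N % d : ℕ) : ℝ) * (d - (N % d : ℕ)) / (2 * d) ≤ (1/12) * N / 2 := by
    rw [div_le_div_iff₀ (by positivity) (by norm_num)]
    generalize ((N % d : ℕ) : ℝ) = r at *
    nlinarith [sq_nonneg (r - d / 2)]
  linarith

noncomputable def FF (N : ℕ) : ℝ := ∑ n ∈ Ico 1 N, ((N : ℝ) - n) * Real.log n

lemma FF_succ (N : ℕ) : FF (N + 1) = FF N + Real.log (N ! : ℕ) := by
  rcases Nat.eq_zero_or_pos N with rfl | h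
  · simp [FF]
  have h1 : ∀ N : ℕ, Real.log (N ! : ℕ) = ∑ m ∈ Ico 1 (N + 1), Real.log m := by
    intro n
    induction n with
    | zero => simp
    | succ k ih =>
      rw [Nat.factorial_succ, Finset.sum_Ico_succ_top (by omega), ← ih]
      push_cast
      rw [Real.log_mul (by positivity) (by positivity)]
      ring
  rw [h1, FF, FF, Finset.sum_Ico_succ_top h, Finset.sum_Ico_succ_top h,
    ← add_assoc, ← Finset.sum_add_distrib]
  congr 1
  · apply Finset.sum_congr rfl
    intro n _
    push_cast; ring
  · push_cast; ring

lemma FF_upper (N : ℕ) (hN : 2 ≤ N) :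
    FF N ≤ (N : ℝ) ^ 2 / 2 * Real.log N - 3 / 4 * N ^ 2 + N * (Real.log N + 2) := by
  induction N, hN using Nat.le_induction with
  | base =>
    have : FF 2 = 0 := by simp [FF]
    rw [this]
    push_cast
    have := Real.log_two_gt_d9
    nlinarith
  | succ k hk ih =>
    rw [FF_succ]
    have hkR : (2 : ℝ) ≤ k := by exact_mod_cast hk
    have hup := log_fact_upper k (by omega)
    have hl : 0.69 ≤ Real.log k := by
      have : Real.log 2 ≤ Real.log k := Real.log_le_log (by norm_num) hkR
      linarith [Real.log_two_gt_d9]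
    have h1 : Real.log k + 1 / (k + 1) ≤ Real.log (k + 1) := by
      have := Real.log_le_sub_one_of_pos (x := (k : ℝ) / (k + 1)) (by positivity)
      rw [Real.log_div (by positivity) (by positivity)] at this
      have h : (k : ℝ) / (k + 1) - 1 = - (1 / (k + 1)) := by field_simp; ring
      linarith
    have h2 : ((k + 1 : ℝ) ^ 2 / 2 + (k + 1)) * (Real.log k + 1 / (k + 1))
        ≤ ((k + 1 : ℝ) ^ 2 / 2 + (k + 1)) * Real.log (k + 1) :=
      mul_le_mul_of_nonneg_left h1 (by positivity)
    have h3 : ((k + 1 : ℝ) ^ 2 / 2 + (k + 1)) * (Real.log k + 1 / (k + 1))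
       = ((k + 1 : ℝ) ^ 2 / 2 + (k + 1)) * Real.log k + (k + 1) / 2 + 1 := by
      field_simp
      ring
    push_cast
    nlinarith

lemma FF_lower (N : ℕ) (hN : 2 ≤ N) :
    (N : ℝ) ^ 2 / 2 * Real.log N - 3 / 4 * N ^ 2 - N * (Real.log N + 2) ≤ FF N := by
  induction N, hN using Nat.le_induction with
  | base =>
    have : FF 2 = 0 := by simp [FF]
    rw [this]
    push_cast
    have := Real.log_two_lt_d9
    nlinarith
  | succ k hk ih =>
    rw [FF_succ]
    have hkR : (2 : ℝ) ≤ k := by exact_mod_cast hk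
    have hlo := log_fact_lower k
    have hl : 0.69 ≤ Real.log k := by
      have : Real.log 2 ≤ Real.log k := Real.log_le_log (by norm_num) hkR
      linarith [Real.log_two_gt_d9]
    have h1 : Real.log (k + 1) ≤ Real.log k + 1 / k := by
      have := Real.log_le_sub_one_of_pos (x := (k + 1 : ℝ) / k) (by positivity)
      rw [Real.log_div (by positivity) (by positivity)] at this
      have h : (k + 1 : ℝ) / k - 1 = (1 / k) := by field_simp; ring
      linarith
    have h2 : ((k + 1 : ℝ) ^ 2 / 2 - (k + 1)) * Real.log (k + 1)
        ≤ ((k + 1 : ℝ) ^ 2 / 2 - (k + 1)) * (Real.log k + 1 / k) := 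
      mul_le_mul_of_nonneg_left h1 (by nlinarith)
    have h3 : ((k + 1 : ℝ) ^ 2 / 2 - (k + 1)) * (Real.log k + 1 / k)
       ≤ ((k + 1 : ℝ) ^ 2 / 2 - (k + 1)) * Real.log k + k / 2 := by
      have : ((k + 1 : ℝ) ^ 2 / 2 - (k + 1)) * (1 / k) ≤ k / 2 := by
        rw [mul_one_div, div_le_iff₀ (by positivity)]
        nlinarith
      linarith
    push_cast
    nlinarith

lemma FF_eq (N : ℕ) : FF N = ∑ d ∈ Ico 1 N, Lam d * TT N (d ∣ ·) := by
  classical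
  have h : ∀ n ∈ Ico 1 N, ((N : ℝ) - n) * Real.log n
      = ∑ d ∈ Ico 1 N, if d ∣ n then Lam d * ((N : ℝ) - n) else 0 := by
    intro n hn
    rw [mem_Ico] at hn
    rw [log_eq_sum n (N - 1) hn.1 (by omega), Finset.mul_sum]
    apply Finset.sum_congr
    · ext d; simp only [mem_Icc, mem_Ico]; omega
    · intro d _
      split_ifs <;> ring
  rw [FF, Finset.sum_congr rfl h, Finset.sum_comm]
  apply Finset.sum_congr rfl
  intro d _
  rw [TT, Finset.mul_sum, Finset.sum_filter]
  exact Finset.sum_congr rfl (fun _ _ => by congr)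

end CCF

namespace CCF
open Finset
open scoped ArithmeticFunction.vonMangoldt Nat

lemma small_log (N : ℕ) (hN : 300000 ≤ N) : 2 * (Real.log N + 2) ≤ 0.0001 * N := by
  have hR : (300000 : ℝ) ≤ N := by exact_mod_cast hN
  have h1 := log_le_lin (a := 300000) (x := N) (by norm_num) (by linarith)
  have := log_3e5
  have h3 : (N : ℝ) / 300000 = N * (1 / 300000) := by ring
  rw [h3] at h1
  linarith

lemma FF_ge_MM (n : ℕ) (hn : 1 ≤ n) : (n : ℝ) ^ 2 / 2 * MM n - n / 2 * psi n ≤ FF n := by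
  have hn0 : (0 : ℝ) < n := by exact_mod_cast hn
  have h : (n : ℝ) ^ 2 / 2 * MM n - n / 2 * psi n
      = ∑ d ∈ Icc 1 n, Lam d * ((n : ℝ) ^ 2 / (2 * d) - n / 2) := by
    rw [MM, psi, Finset.mul_sum, Finset.mul_sum, ← Finset.sum_sub_distrib]
    apply Finset.sum_congr rfl
    intro d hd
    have : (0 : ℝ) < d := by exact_mod_cast (mem_Icc.1 hd).1
    field_simp
  rw [h, FF_eq]
  rw [← Finset.Ico_succ_right_eq_Icc, Order.succ_eq_add_one, Finset.sum_Ico_succ_top hn]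
  have h2 : Lam n * ((n : ℝ) ^ 2 / (2 * n) - n / 2) = 0 := by
    have : ((n : ℝ) ^ 2 / (2 * n) - n / 2) = 0 := by field_simp; ring
    rw [this, mul_zero]
  rw [h2, add_zero]
  apply Finset.sum_le_sum
  intro d hd
  exact mul_le_mul_of_nonneg_left (TT_dvd_ge n d (mem_Ico.1 hd).1) (Lam_nonneg d)

lemma MM_upper (n : ℕ) (hn : 300000 ≤ n) : MM n ≤ Real.log n - 0.3918 := by
  have hn0 : (300000 : ℝ) ≤ n := by exact_mod_cast hn
  have h1 := FF_ge_MM n (by omega)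
  have h2 := FF_upper n (by omega)
  have h3 := psi_upper n hn
  have h4 := small_log n hn
  have h5 : (n : ℝ) ^ 2 / 2 * MM n ≤ (n : ℝ) ^ 2 / 2 * (Real.log n - 0.3918) := by
    nlinarith
  exact le_of_mul_le_mul_left h5 (by positivity)

lemma FF_le_MM (n : ℕ) (hn : 1 ≤ n) : FF n ≤ (n : ℝ) ^ 2 / 2 * MM n
    - n / 2 * 0.8284 * psi n - (0.0858 - 1 / 24) * n * psi (n / 3) := by
  have hn0 : (0 : ℝ) < n := by exact_mod_cast hn
  have h3 : psi (n / 3) = ∑ d ∈ Icc 1 n, if d ≤ n / 3 then Lam d else 0 := by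
    rw [← Finset.sum_filter, psi]
    apply Finset.sum_congr _ (fun _ _ => rfl)
    ext d
    simp only [mem_Icc, mem_filter]
    omega
  have h : (n : ℝ) ^ 2 / 2 * MM n
    - n / 2 * 0.8284 * psi n - (0.0858 - 1 / 24) * n * psi (n / 3)
      = ∑ d ∈ Icc 1 n, Lam d * ((n : ℝ) ^ 2 / (2 * d) - n / 2 * 0.8284
        - (if d ≤ n / 3 then (0.0858 - 1 / 24 : ℝ) * (n : ℝ) else 0)) := by
    rw [h3, MM, psi, Finset.mul_sum, Finset.mul_sum, Finset.mul_sum, ← Finset.sum_sub_distrib,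
      ← Finset.sum_sub_distrib]
    apply Finset.sum_congr rfl
    intro d hd
    have : (0 : ℝ) < d := by exact_mod_cast (mem_Icc.1 hd).1
    split_ifs
    · field_simp
    · field_simp; ring
  rw [h, FF_eq]
  have hsub : Ico 1 n ⊆ Icc 1 n := Finset.Ico_subset_Icc_self
  have key : ∀ d ∈ Icc 1 n, TT n (d ∣ ·) ≤ ((n : ℝ) ^ 2 / (2 * d) - n / 2 * 0.8284
        - (if d ≤ n / 3 then (0.0858 - 1 / 24 : ℝ) * (n : ℝ) else 0)) := by
    intro d hd
    rw [mem_Icc] at hd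
    split_ifs with hif
    · have := TT_dvd_le3 n d hd.1 (by omega)
      linarith
    · have := TT_dvd_le2 n d hd.1 hd.2
      linarith
  refine le_trans (Finset.sum_le_sum_of_subset_of_nonneg hsub (fun d _ _ =>
    mul_nonneg (Lam_nonneg d) (TT_nonneg _ _))) (Finset.sum_le_sum fun d hd => ?_)
  exact mul_le_mul_of_nonneg_left (key d hd) (Lam_nonneg d)

lemma MM_lower (n : ℕ) (hn : 300000 ≤ n) : Real.log n - 0.711 ≤ MM n := by
  have hn0 : (300000 : ℝ) ≤ n := by exact_mod_cast hn
  have h1 := FF_le_MM n (by omega)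
  have h2 := FF_lower n (by omega)
  have h3 := psi_lower' n (by omega)
  have h3' := psi_lower' (n / 3) (by omega)
  have h6 : (n : ℝ) / 3 - 1 ≤ (n / 3 : ℕ) := by
    have : n ≤ 3 * (n / 3) + 3 := by omega
    have : (n : ℝ) ≤ 3 * (n / 3 : ℕ) + 3 := by exact_mod_cast this
    linarith
  have h4 := small_log n hn
  have h7 : 0.9205 * ((n : ℝ) / 3 - 1) ≤ psi (n / 3) := by linarith
  have h5 : (n : ℝ) ^ 2 / 2 * (Real.log n - 0.711) ≤ (n : ℝ) ^ 2 / 2 * MM n := by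
    nlinarith
  exact le_of_mul_le_mul_left h5 (by positivity)

lemma MM_lower_triv (n : ℕ) (hn : 1 ≤ n) : Real.log n - 1 ≤ MM n := by
  have hn0 : (0 : ℝ) < n := by exact_mod_cast hn
  have h1 := log_fact_lower n
  rw [log_factorial_eq] at h1
  have h2 : ∑ d ∈ Icc 1 n, Lam d * (n / d : ℕ) ≤ n * MM n := by
    rw [MM, Finset.mul_sum]
    apply Finset.sum_le_sum
    intro d _
    have : ((n / d : ℕ) : ℝ) ≤ n / d := Nat.cast_div_le
    have := mul_le_mul_of_nonneg_left this (Lam_nonneg d)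
    calc _ ≤ _ := this
      _ = _ := by ring
  have h5 : (n : ℝ) * (Real.log n - 1) ≤ n * MM n := by linarith
  exact le_of_mul_le_mul_left h5 hn0

/-- Abstract partial summation. -/
lemma abel_aux (a : ℕ → ℝ) (ha : ∀ d, 0 ≤ a d) (N : ℕ) (μ : ℝ)
    (k : ℕ) : ∀ z : ℕ, N - z = k → 2 ≤ z → Real.log z ≤ μ → μ < Real.log N →
    (∀ t, z ≤ t → t < N → μ - Real.log t ≤ ∑ d ∈ Ico (t + 1) N, a d) →
    ∑ d ∈ Ico z N, a d / Real.log d ≤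
      ((∑ d ∈ Ico z N, a d) - μ + Real.log z) / Real.log z + Real.log (μ / Real.log z) := by
  induction k with
  | zero =>
    intro z hk hz hzμ hμ _
    exfalso
    have : N ≤ z := by omega
    have hN : 0 < N := by
      by_contra h
      have : N = 0 := by omega
      subst this
      have : 0 ≤ Real.log z := Real.log_natCast_nonneg z
      simp at hμ
      linarith
    have := Real.log_le_log (by exact_mod_cast hN : (0 : ℝ) < N)
      (by exact_mod_cast this : (N : ℝ) ≤ z)
    linarith
  | succ k ih =>
    intro z hk hz hzμ hμ hG
    have hzN : z < N := by omega
    have hz1 : (2 : ℝ) ≤ z := by exact_mod_cast hz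
    have hv : 0 < Real.log z := Real.log_pos (by linarith)
    have hvv' : Real.log z ≤ Real.log ((z + 1 : ℕ) : ℝ) :=
      Real.log_le_log (by linarith) (by push_cast; linarith)
    have hg := hG z le_rfl hzN
    rw [Finset.sum_eq_sum_Ico_succ_bot hzN, Finset.sum_eq_sum_Ico_succ_bot hzN]
    set v := Real.log z with hv_def
    set v' := Real.log ((z + 1 : ℕ) : ℝ) with hv'_def
    set g := ∑ d ∈ Ico (z + 1) N, a d with hg_def
    have hv' : 0 < v' := lt_of_lt_of_le hv hvv'
    have hμ0 : 0 < μ := by linarith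
    by_cases hc : v' ≤ μ
    · have h := ih (z + 1) (by omega) (by omega) hc hμ (fun t ht htN => hG t (by omega) htN)
      rw [← hv'_def, ← hg_def] at h
      rw [Real.log_div hμ0.ne' hv'.ne'] at h
      rw [Real.log_div hμ0.ne' hv.ne']
      have hl := Real.log_le_sub_one_of_pos (x := v / v') (by positivity)
      rw [Real.log_div hv.ne' hv'.ne'] at hl
      have e1 : (g - μ + v') / v' = (g - μ) / v' + 1 := by field_simp
      have e2 : (a z + g - μ + v) / v = a z / v + (g - μ) / v + 1 := by field_simp; ring
      have e3 : (g - μ) / v' - (g - μ) / v = (μ - g) / v * (1 - v / v') := by field_simp; ring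
      have e4 : (μ - g) / v ≤ 1 := by rw [div_le_one hv]; linarith
      have e5 : 0 ≤ 1 - v / v' := by
        have : v / v' ≤ 1 := by rw [div_le_one hv']; exact hvv'
        linarith
      have e6 : (μ - g) / v * (1 - v / v') ≤ 1 - v / v' := mul_le_of_le_one_left e5 e4
      linarith
    · push Not at hc
      have h : ∑ d ∈ Ico (z + 1) N, a d / Real.log d ≤ g / v' := by
        rw [hg_def, Finset.sum_div]
        apply Finset.sum_le_sum
        intro d hd
        rw [mem_Ico] at hd
        apply div_le_div_of_nonneg_left (ha d) hv'
        exact Real.log_le_log (by positivity) (by exact_mod_cast hd.1)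
      have hg0 : 0 ≤ g := Finset.sum_nonneg (fun d _ => ha d)
      have h2 : g / v' ≤ g / μ := div_le_div_of_nonneg_left hg0 hμ0 hc.le
      rw [Real.log_div hμ0.ne' hv.ne']
      have hl := Real.log_le_sub_one_of_pos (x := v / μ) (by positivity)
      rw [Real.log_div hv.ne' hμ0.ne'] at hl
      have e2 : (a z + g - μ + v) / v = a z / v + (g - μ) / v + 1 := by field_simp; ring
      have e3 : g / μ - (g - μ) / v = 1 - (g - (μ - v)) * (μ - v) / (v * μ) + (1 - v / μ) := by
        field_simp; ring
      have e4 : 0 ≤ (g - (μ - v)) * (μ - v) / (v * μ) := by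
        apply div_nonneg _ (by positivity)
        apply mul_nonneg <;> linarith
      linarith

noncomputable def SS (N z : ℕ) : ℝ := ∑ d ∈ Ico z N, Lam d / Real.log d * TT N (d ∣ ·)

lemma SS_bound (N z : ℕ) (hz : 300000 ≤ z) (hN : 100000000 ≤ N) (hzN : z ≤ N)
    (hzμ : Real.log z ≤ Real.log N - 1.1085) :
    SS N z ≤ (N : ℝ) ^ 2 / 2 * (Real.log ((Real.log N - 1.1085) / Real.log z)
      + (0.3199 + 1.108 * z / N) / Real.log z) := by
  have hNR : (100000000 : ℝ) ≤ N := by exact_mod_cast hN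
  have hzR : (300000 : ℝ) ≤ z := by exact_mod_cast hz
  have hNR0 : (0 : ℝ) < N := by linarith
  have hv : 0 < Real.log z := Real.log_pos (by linarith)
  have hlN := small_log N (by omega)
  set a : ℕ → ℝ := fun d => 2 / (N : ℝ) ^ 2 * (Lam d * TT N (d ∣ ·)) with ha
  have ha0 : ∀ d, 0 ≤ a d := fun d =>
    mul_nonneg (by positivity) (mul_nonneg (Lam_nonneg d) (TT_nonneg _ _))
  have htot : ∑ d ∈ Ico 1 N, a d = 2 / (N : ℝ) ^ 2 * FF N := by
    rw [FF_eq, Finset.mul_sum]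
  have hfl := FF_lower N (by omega)
  have hfu := FF_upper N (by omega)
  have htl : Real.log N - 1.5001 ≤ 2 / (N : ℝ) ^ 2 * FF N := by
    rw [div_mul_eq_mul_div, le_div_iff₀ (by positivity)]
    nlinarith
  have htu : 2 / (N : ℝ) ^ 2 * FF N ≤ Real.log N - 1.4999 := by
    rw [div_mul_eq_mul_div, div_le_iff₀ (by positivity)]
    nlinarith
  have hsplit : ∀ t, 1 ≤ t → t ≤ N → ∑ d ∈ Ico t N, a d =
      2 / (N : ℝ) ^ 2 * FF N - ∑ d ∈ Ico 1 t, a d := by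
    intro t h1 h2
    rw [← htot, ← Finset.sum_Ico_consecutive a h1 h2]; ring
  have hle : ∀ d, 1 ≤ d → a d ≤ Lam d / d := by
    intro d hd
    have hd0 : (0 : ℝ) < d := by exact_mod_cast hd
    have h := mul_le_mul_of_nonneg_left (TT_dvd_le N d hd) (Lam_nonneg d)
    calc a d ≤ 2 / (N : ℝ) ^ 2 * (Lam d * ((N : ℝ) ^ 2 / (2 * d))) :=
          mul_le_mul_of_nonneg_left h (by positivity)
      _ = _ := by field_simp
  have hge : ∀ d, 1 ≤ d → Lam d / d - Lam d / N ≤ a d := by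
    intro d hd
    have hd0 : (0 : ℝ) < d := by exact_mod_cast hd
    have h := mul_le_mul_of_nonneg_left (TT_dvd_ge N d hd) (Lam_nonneg d)
    calc Lam d / d - Lam d / N = 2 / (N : ℝ) ^ 2 * (Lam d * ((N : ℝ) ^ 2 / (2 * d) - N / 2)) := by
          field_simp
      _ ≤ a d := mul_le_mul_of_nonneg_left h (by positivity)
  have hG : ∀ t, z ≤ t → t < N → (Real.log N - 1.1085) - Real.log t ≤ ∑ d ∈ Ico (t + 1) N, a d := by
    intro t hzt htN
    rw [hsplit (t + 1) (by omega) (by omega)]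
    have h1 : ∑ d ∈ Ico 1 (t + 1), a d ≤ MM t := by
      rw [MM, ← Finset.Ico_succ_right_eq_Icc, Order.succ_eq_add_one]
      exact Finset.sum_le_sum (fun d hd => hle d (mem_Ico.1 hd).1)
    have h2 := MM_upper t (by omega)
    linarith
  have hGz : ∑ d ∈ Ico z N, a d ≤ Real.log N - Real.log z - 0.7887 + 1.108 * z / N := by
    rw [hsplit z (by omega) hzN]
    have h1 : MM z - Lam z / z - psi z / N ≤ ∑ d ∈ Ico 1 z, a d := by
      have h2 : ∑ d ∈ Ico 1 z, (Lam d / d - Lam d / N) ≤ ∑ d ∈ Ico 1 z, a d :=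
        Finset.sum_le_sum (fun d hd => hge d (mem_Ico.1 hd).1)
      rw [Finset.sum_sub_distrib, ← Finset.sum_div] at h2
      have h3 : MM z = ∑ d ∈ Ico 1 z, Lam d / d + Lam z / z := by
        rw [MM, ← Finset.Ico_succ_right_eq_Icc, Order.succ_eq_add_one,
          Finset.sum_Ico_succ_top (by omega)]
      have h4 : psi z = ∑ d ∈ Ico 1 z, Lam d + Lam z := by
        rw [psi, ← Finset.Ico_succ_right_eq_Icc, Order.succ_eq_add_one,
          Finset.sum_Ico_succ_top (by omega)]
      have h5 : (∑ d ∈ Ico 1 z, Lam d) / N ≤ psi z / N := by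
        apply div_le_div_of_nonneg_right _ hNR0.le
        have := Lam_nonneg z
        linarith
      linarith
    have h2 := MM_lower z hz
    have h3 : Lam z / z ≤ 0.0001 := by
      rw [div_le_iff₀ (by linarith)]
      have h4 : Lam z ≤ Real.log z := ArithmeticFunction.vonMangoldt_le_log
      have := small_log z hz
      linarith
    have h5 : psi z / N ≤ 1.108 * z / N :=
      div_le_div_of_nonneg_right (psi_upper z hz) hNR0.le
    linarith
  have hab := abel_aux a ha0 N (Real.log N - 1.1085) (N - z) z rfl (by omega) hzμ (by linarith) hG
  have hSS : SS N z = (N : ℝ) ^ 2 / 2 * ∑ d ∈ Ico z N, a d / Real.log d := by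
    rw [SS, Finset.mul_sum]
    apply Finset.sum_congr rfl
    intro d _
    rw [ha]
    field_simp
  rw [hSS]
  apply mul_le_mul_of_nonneg_left _ (by positivity)
  have hfin : ((∑ d ∈ Ico z N, a d) - (Real.log N - 1.1085) + Real.log z) / Real.log z
      ≤ (0.3199 + 1.108 * z / N) / Real.log z := by
    apply div_le_div_of_nonneg_right _ hv.le
    linarith
  linarith

end CCF

namespace CCF
open Finset

section PV
variable {p : ℕ} [hp : Fact p.Prime] (χ : MulChar (ZMod p) ℂ)

lemma sum_corr (hχ : χ ≠ 1) (a b : ZMod p) :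
    ∑ i : ZMod p, χ (i - a) * (starRingEnd ℂ) (χ (i - b)) = if a = b then (p : ℂ) - 1 else -1 := by
  have hconj : ∀ x : ZMod p, (starRingEnd ℂ) (χ x) = χ x⁻¹ := fun x => by
    rw [← MulChar.inv_apply', ← MulChar.star_apply']; rfl
  have h1 : ∑ i : ZMod p, χ (i - a) * (starRingEnd ℂ) (χ (i - b))
      = ∑ i : ZMod p, χ ((i + (b - a)) * i⁻¹) := by
    rw [← (Equiv.subRight b).sum_comp (fun i => χ ((i + (b - a)) * i⁻¹))]
    apply Finset.sum_congr rfl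
    intro i _
    rw [hconj, ← map_mul]
    congr 2
    simp
  have h2 : ∑ i : ZMod p, χ ((i + (b - a)) * i⁻¹)
      = ∑ i : ZMod p, χ (1 + (b - a) * i⁻¹) - 1 := by
    rw [← Finset.add_sum_erase univ _ (Finset.mem_univ (0 : ZMod p)),
      ← Finset.add_sum_erase univ (fun i => χ (1 + (b - a) * i⁻¹)) (Finset.mem_univ (0 : ZMod p))]
    simp only [inv_zero, mul_zero, add_zero, map_one, add_sub_cancel_left]
    rw [MulChar.map_zero, zero_add]
    apply Finset.sum_congr rfl
    intro i hi
    rw [Finset.mem_erase] at hi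
    congr 1
    field_simp [hi.1]
  rw [h1, h2]
  split_ifs with h
  · subst h
    simp
  · have hba : b - a ≠ 0 := sub_ne_zero.2 (Ne.symm h)
    have h3 : ∑ i : ZMod p, χ (1 + (b - a) * i⁻¹) = ∑ i : ZMod p, χ i := by
      apply Function.Bijective.sum_comp (e := fun i : ZMod p => 1 + (b - a) * i⁻¹) ?_ (fun i => χ i)
      apply Finite.injective_iff_bijective.1
      intro x y hxy
      simpa [hba] using hxy
    rw [h3, MulChar.sum_eq_zero_of_ne_one hχ]
    simp

lemma cast_inj_of_lt {N : ℕ} (hN : N ≤ p) {i j : ℕ} (hi : i < N) (hj : j < N)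
    (h : (i : ZMod p) = j) : i = j := by
  rw [ZMod.natCast_eq_natCast_iff'] at h
  rwa [Nat.mod_eq_of_lt (by omega), Nat.mod_eq_of_lt (by omega)] at h

lemma second_moment (hχ : χ ≠ 1) (N : ℕ) (hN : N ≤ p) :
    ∑ i : ZMod p, ‖∑ j ∈ range N, χ (i - j)‖ ^ 2 = (N : ℝ) * p - N ^ 2 := by
  have h : ((∑ i : ZMod p, ‖∑ j ∈ range N, χ (i - j)‖ ^ 2 : ℝ) : ℂ) = (N : ℂ) * p - N ^ 2 := by
    push_cast
    have h1 : ∀ i : ZMod p, ((‖∑ j ∈ range N, χ (i - j)‖ : ℂ)) ^ 2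
        = ∑ j ∈ range N, ∑ k ∈ range N, χ (i - j) * (starRingEnd ℂ) (χ (i - k)) := by
      intro i
      rw [← Complex.mul_conj', map_sum, Finset.sum_mul_sum]
    rw [Finset.sum_congr rfl (fun i _ => h1 i), Finset.sum_comm]
    have h2 : ∀ j ∈ range N, ∑ i : ZMod p, ∑ k ∈ range N, χ (i - j) * (starRingEnd ℂ) (χ (i - k))
        = (p : ℂ) - N := by
      intro j hj
      rw [Finset.sum_comm]
      rw [Finset.sum_congr rfl (fun (k : ℕ) _ => sum_corr χ hχ (j : ZMod p) (k : ZMod p))]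
      have h3 : ∀ k ∈ range N, (if (j : ZMod p) = k then (p : ℂ) - 1 else -1)
          = (if j = k then (p : ℂ) else 0) - 1 := by
        intro k hk
        by_cases hjk : j = k
        · simp [hjk]
        · have : ¬ (j : ZMod p) = k := fun h =>
            hjk (cast_inj_of_lt hN (mem_range.1 hj) (mem_range.1 hk) h)
          simp [hjk, this]
      rw [Finset.sum_congr rfl h3, Finset.sum_sub_distrib, Finset.sum_ite_eq]
      simp [hj]
    rw [Finset.sum_congr rfl h2]
    simp
    ring
  exact_mod_cast h

lemma tent_double (f : ℤ → ℂ) (hf : ∀ n, f (-n) = f n) (hf0 : f 0 = 0) (N : ℕ) :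
    ∑ i ∈ range N, ∑ j ∈ range N, f (i - j) = 2 * ∑ n ∈ range N, ((N : ℂ) - n) * f n := by
  induction N with
  | zero => simp
  | succ N ih =>
    have h1 : ∑ j ∈ range N, f ((N : ℤ) - j) = ∑ n ∈ range (N + 1), f n := by
      rw [Finset.sum_range_succ', ← Finset.sum_range_reflect]
      simp only [Nat.cast_zero, hf0, add_zero]
      apply Finset.sum_congr rfl
      intro j hj
      rw [mem_range] at hj
      congr 1
      omega
    have h2 : ∑ i ∈ range N, f ((i : ℤ) - N) = ∑ n ∈ range (N + 1), f n := by
      rw [← h1]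
      apply Finset.sum_congr rfl
      intro j _
      rw [← hf]; congr 1; ring
    rw [Finset.sum_range_succ]
    rw [Finset.sum_congr rfl (fun i _ => Finset.sum_range_succ _ N), Finset.sum_add_distrib, ih,
      Finset.sum_range_succ (fun j : ℕ => f ((N : ℤ) - j)), h1, h2, sub_self, hf0]
    have h3 : ∑ n ∈ range (N + 1), (((N + 1 : ℕ) : ℂ) - n) * f n
        = ∑ n ∈ range (N + 1), ((N : ℂ) - n) * f n + ∑ n ∈ range (N + 1), f n := by
      rw [← Finset.sum_add_distrib]
      apply Finset.sum_congr rfl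
      intro n _
      push_cast; ring
    rw [h3, Finset.sum_range_succ (fun n : ℕ => ((N : ℂ) - n) * f n)]
    ring

lemma pv (hχ : χ ≠ 1) (heven : χ (-1) = 1) (N : ℕ) (hN : N ≤ p) :
    ‖∑ n ∈ range N, ((N : ℂ) - n) * χ n‖ ≤ N * Real.sqrt p / 2 := by
  have h1 : ∑ i ∈ range N, ∑ j ∈ range N, χ (((i : ℕ) : ZMod p) - (j : ℕ))
      = 2 * ∑ n ∈ range N, ((N : ℂ) - n) * χ n := by
    have := tent_double (fun n : ℤ => χ (n : ZMod p)) (fun n => by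
      have : ((-n : ℤ) : ZMod p) = (-1) * (n : ZMod p) := by push_cast; ring
      rw [this, map_mul, heven, one_mul]) (by simp [MulChar.map_zero]) N
    simpa using this
  have h2 : ∑ i ∈ range N, ‖∑ j ∈ range N, χ (((i : ℕ) : ZMod p) - (j : ℕ))‖ ^ 2
      ≤ (N : ℝ) * p := by
    have h3 : ∑ i ∈ range N, ‖∑ j ∈ range N, χ (((i : ℕ) : ZMod p) - (j : ℕ))‖ ^ 2
        = ∑ i ∈ (range N).image (fun i : ℕ => (i : ZMod p)),
          ‖∑ j ∈ range N, χ (i - (j : ℕ))‖ ^ 2 := by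
      rw [Finset.sum_image]
      intro i hi j hj h
      exact cast_inj_of_lt hN (mem_range.1 hi) (mem_range.1 hj) h
    rw [h3]
    refine (Finset.sum_le_sum_of_subset_of_nonneg (Finset.subset_univ _)
      (fun _ _ _ => by positivity)).trans ?_
    rw [second_moment χ hχ N hN]
    nlinarith
  have h4 : (∑ i ∈ range N, ‖∑ j ∈ range N, χ (((i : ℕ) : ZMod p) - (j : ℕ))‖) ^ 2
      ≤ (N * Real.sqrt p) ^ 2 := by
    refine (sq_sum_le_card_mul_sum_sq).trans ?_
    rw [card_range, mul_pow, Real.sq_sqrt (by positivity)]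
    nlinarith [mul_le_mul_of_nonneg_left h2 (Nat.cast_nonneg (α := ℝ) N)]
  have h5 := abs_le_of_sq_le_sq h4 (by positivity)
  have h6 : ‖2 * ∑ n ∈ range N, ((N : ℂ) - n) * χ n‖ ≤ N * Real.sqrt p := by
    rw [← h1]
    exact (norm_sum_le _ _).trans ((le_abs_self _).trans h5)
  rw [norm_mul] at h6
  simp only [Complex.norm_ofNat] at h6
  linarith

lemma cube_root_ind (z c : ℂ) (hz : z ^ 3 = 1) (hc : c ^ 3 = 1) :
    (if z = c then (1 : ℝ) else 0) = (1 + 2 * (z * (starRingEnd ℂ) c).re) / 3 := by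
  have nz : ‖z‖ = 1 := by
    have : ‖z‖ ^ 3 = 1 := by rw [← norm_pow, hz, norm_one]
    exact (pow_eq_one_iff_of_nonneg (norm_nonneg z) (by norm_num)).1 this
  have nc : ‖c‖ = 1 := by
    have : ‖c‖ ^ 3 = 1 := by rw [← norm_pow, hc, norm_one]
    exact (pow_eq_one_iff_of_nonneg (norm_nonneg c) (by norm_num)).1 this
  have hcc : c * (starRingEnd ℂ) c = 1 := by
    rw [Complex.mul_conj', nc]; norm_num
  split_ifs with h
  · rw [h, hcc]; norm_num
  · set w := z * (starRingEnd ℂ) c with hw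
    have hw3 : w ^ 3 = 1 := by
      rw [hw, mul_pow, hz, ← map_pow, hc, map_one, one_mul]
    have hw1 : w ≠ 1 := by
      intro h1
      apply h
      calc z = z * (c * (starRingEnd ℂ) c) := by rw [hcc, mul_one]
        _ = w * c := by rw [hw]; ring
        _ = c := by rw [h1, one_mul]
    have h0 : 1 + w + w ^ 2 = 0 := by
      have : (w - 1) * (1 + w + w ^ 2) = 0 := by ring_nf; rw [hw3]; ring
      rcases mul_eq_zero.1 this with h | h
      · exact absurd (sub_eq_zero.1 h) hw1
      · exact h
    have nw : ‖w‖ = 1 := by rw [hw, norm_mul, nz, RCLike.norm_conj, nc, one_mul]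
    have hww : w * (starRingEnd ℂ) w = 1 := by
      rw [Complex.mul_conj', nw]; norm_num
    have hconj : (starRingEnd ℂ) w = w ^ 2 := by
      calc (starRingEnd ℂ) w = w ^ 3 * (starRingEnd ℂ) w := by rw [hw3, one_mul]
        _ = w ^ 2 * (w * (starRingEnd ℂ) w) := by ring
        _ = w ^ 2 := by rw [hww, mul_one]
    have h2 : w + (starRingEnd ℂ) w = -1 := by rw [hconj]; linear_combination h0
    have h3 := congrArg Complex.re h2
    simp only [Complex.add_re, Complex.conj_re, Complex.neg_re, Complex.one_re] at h3
    linarith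

lemma chi_cube (h3 : χ ^ 3 = 1) {a : ZMod p} (ha : a ≠ 0) : χ a ^ 3 = 1 := by
  rw [← MulChar.pow_apply' χ (by norm_num) a, h3, MulChar.one_apply (Ne.isUnit ha)]

lemma chi_even (h3 : χ ^ 3 = 1) : χ (-1) = 1 := by
  have h1 := chi_cube χ h3 (a := -1) (by simp)
  have h2 : χ (-1) ^ 2 = 1 := by rw [← map_pow]; simp
  calc χ (-1) = χ (-1) ^ 3 * (χ (-1) ^ 2)⁻¹ := by
        rw [h1, h2]
        have : χ (-1) = χ (-1) ^ 3 := by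
          rw [pow_succ, h2, one_mul]
        rw [this, h1]; norm_num
    _ = 1 := by rw [h1, h2]; norm_num

lemma natCast_ne_zero {n : ℕ} (h1 : 1 ≤ n) (h2 : n < p) : (n : ZMod p) ≠ 0 := by
  intro h
  rw [ZMod.natCast_eq_zero_iff] at h
  exact absurd (Nat.le_of_dvd h1 h) (by omega)

lemma sum_tent (N : ℕ) : ∑ n ∈ Ico 1 N, ((N : ℝ) - n) = N * (N - 1) / 2 := by
  induction N with
  | zero => simp
  | succ k ih =>
    rcases Nat.eq_zero_or_pos k with rfl | h
    · simp
    rw [Finset.sum_Ico_succ_top h]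
    have : ∑ n ∈ Ico 1 k, (((k + 1 : ℕ) : ℝ) - n) = ∑ n ∈ Ico 1 k, (((k : ℝ) - n) + 1) := by
      apply Finset.sum_congr rfl
      intro n _
      push_cast; ring
    rw [this, Finset.sum_add_distrib, ih]
    simp [Nat.cast_sub h]
    ring

lemma class_mass (h3 : χ ^ 3 = 1) (hχ : χ ≠ 1) (c : ℂ) (hc : c ^ 3 = 1) (N : ℕ) (hN : N ≤ p) :
    |TT N (fun n => χ (n : ZMod p) = c) - N * (N - 1) / 6| ≤ N * Real.sqrt p / 3 := by
  classical
  have nc : ‖c‖ = 1 := by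
    have : ‖c‖ ^ 3 = 1 := by rw [← norm_pow, hc, norm_one]
    exact (pow_eq_one_iff_of_nonneg (norm_nonneg c) (by norm_num)).1 this
  have h1 : TT N (fun n => χ (n : ZMod p) = c)
      = N * (N - 1) / 6 + 2 / 3 * ((∑ n ∈ range N, ((N : ℂ) - n) * χ n) * (starRingEnd ℂ) c).re := by
    have e1 : TT N (fun n => χ (n : ZMod p) = c) = ∑ n ∈ Ico 1 N, (((N : ℝ) - n) / 3
        + 2 / 3 * ((((N : ℂ) - n) * χ n) * (starRingEnd ℂ) c).re) := by
      rw [TT, Finset.sum_filter]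
      apply Finset.sum_congr rfl
      intro n hn
      rw [mem_Ico] at hn
      have := cube_root_ind (χ (n : ZMod p)) c
        (chi_cube χ h3 (natCast_ne_zero hn.1 (by omega))) hc
      have e2 : ((((N : ℂ) - n) * χ n) * (starRingEnd ℂ) c).re
          = ((N : ℝ) - n) * ((χ n) * (starRingEnd ℂ) c).re := by
        rw [mul_assoc, show ((N : ℂ) - n) = (((N : ℝ) - n : ℝ) : ℂ) by push_cast; rfl,
          Complex.re_ofReal_mul]
      rw [e2]
      have e3 : (if χ (n : ZMod p) = c then ((N : ℝ) - n) else 0)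
          = ((N : ℝ) - n) * (if χ (n : ZMod p) = c then (1 : ℝ) else 0) := by
        split_ifs <;> ring
      rw [e3, this]
      ring
    rw [e1, Finset.sum_add_distrib, ← Finset.sum_div, sum_tent, ← Finset.mul_sum,
      ← Complex.re_sum, ← Finset.sum_mul]
    have e4 : ∑ n ∈ range N, ((N : ℂ) - n) * χ n = ∑ n ∈ Ico 1 N, ((N : ℂ) - n) * χ n := by
      rcases Nat.eq_zero_or_pos N with rfl | h
      · simp
      rw [Finset.range_eq_Ico, Finset.sum_eq_sum_Ico_succ_bot h]
      simp [MulChar.map_zero]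
    rw [e4]
    ring
  rw [h1]
  have h2 := pv χ hχ (chi_even χ h3) N hN
  have h4 := Complex.abs_re_le_norm ((∑ n ∈ range N, ((N : ℂ) - n) * χ n) * (starRingEnd ℂ) c)
  rw [norm_mul, RCLike.norm_conj, nc, mul_one] at h4
  rw [add_sub_cancel_left, abs_mul, abs_of_pos (by norm_num : (0 : ℝ) < 2 / 3)]
  linarith

end PV
end CCF

namespace CCF
open Finset

lemma TT_mono {N : ℕ} {P Q : ℕ → Prop} (h : ∀ n, 1 ≤ n → n < N → P n → Q n) :
    TT N P ≤ TT N Q := by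
  classical
  rw [TT, TT]
  apply Finset.sum_le_sum_of_subset_of_nonneg
  · intro n hn
    simp only [mem_filter, mem_Ico] at hn ⊢
    exact ⟨hn.1, h n hn.1.1 hn.1.2 hn.2⟩
  · intro n hn _
    simp only [mem_Ico, mem_filter] at hn
    have : (n : ℝ) ≤ N := by exact_mod_cast hn.1.2.le
    linarith

lemma TT_congr {N : ℕ} {P Q : ℕ → Prop} (h : ∀ n, 1 ≤ n → n < N → (P n ↔ Q n)) :
    TT N P = TT N Q :=
  le_antisymm (TT_mono fun n h1 h2 => (h n h1 h2).1) (TT_mono fun n h1 h2 => (h n h1 h2).2)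

lemma TT_split (N : ℕ) (P Q : ℕ → Prop) :
    TT N P = TT N (fun n => Q n ∧ P n) + TT N (fun n => ¬ Q n ∧ P n) := by
  classical
  rw [TT, TT, TT, ← Finset.sum_filter_add_sum_filter_not _ Q, Finset.filter_filter,
    Finset.filter_filter]
  congr 1 <;> apply Finset.sum_congr _ (fun _ _ => rfl) <;> ext n <;> simp <;> tauto

lemma TT_or (N : ℕ) (P Q : ℕ → Prop) :
    TT N (fun n => P n ∨ Q n) ≤ TT N P + TT N Q := by
  rw [TT_split N (fun n => P n ∨ Q n) P]
  apply add_le_add <;> apply TT_mono <;> intro n _ _ <;> tauto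

lemma TT_bUnion {ι : Type*} (s : Finset ι) (N : ℕ) (Q : ι → ℕ → Prop) :
    TT N (fun n => ∃ i ∈ s, Q i n) ≤ ∑ i ∈ s, TT N (Q i) := by
  classical
  induction s using Finset.induction_on with
  | empty => simp [TT]
  | insert a s ha ih =>
    rw [Finset.sum_insert ha]
    refine le_trans (TT_mono (Q := fun n => Q a n ∨ ∃ i ∈ s, Q i n) ?_)
      ((TT_or _ _ _).trans (by linarith))
    intro n _ _ ⟨i, hi, h⟩
    rw [Finset.mem_insert] at hi
    rcases hi with rfl | hi
    · exact Or.inl h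
    · exact Or.inr ⟨i, hi, h⟩

lemma TT_compl (N : ℕ) (P : ℕ → Prop) :
    TT N P + TT N (fun n => ¬ P n) = N * (N - 1) / 2 := by
  classical
  rw [← sum_tent, TT, TT, Finset.sum_filter_add_sum_filter_not]

lemma TT_scale (d M : ℕ) (hd : 1 ≤ d) (P : ℕ → Prop) :
    TT (d * M) (fun n => d ∣ n ∧ P n) = d * TT M (fun m => P (d * m)) := by
  classical
  rw [TT, TT, Finset.mul_sum]
  symm
  apply Finset.sum_bij (fun m _ => d * m)
  · intro m hm
    simp only [mem_filter, mem_Ico] at hm ⊢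
    exact ⟨⟨Nat.mul_pos hd hm.1.1, Nat.mul_lt_mul_of_pos_left hm.1.2 hd⟩, Dvd.intro m rfl, hm.2⟩
  · intro a _ b _ h
    exact Nat.eq_of_mul_eq_mul_left hd h
  · intro n hn
    simp only [mem_filter, mem_Ico] at hn
    obtain ⟨⟨h1, h2⟩, ⟨m, rfl⟩, h3⟩ := hn
    refine ⟨m, ?_, rfl⟩
    simp only [mem_filter, mem_Ico]
    refine ⟨⟨?_, Nat.lt_of_mul_lt_mul_left h2⟩, h3⟩
    by_contra h
    have : m = 0 := by omega
    subst this
    simp at h1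
  · intro m _
    push_cast; ring

lemma TT_modclass (N m r : ℕ) (hm : 1 ≤ m) :
    TT N (fun n => n % m = r) ≤ N + (N : ℝ) ^ 2 / (2 * m) := by
  classical
  have hR : ∑ j ∈ Icc 0 (N / m), ((N : ℝ) - m * j) = N + TT N (m ∣ ·) := by
    rw [sum_mult N m hm, ← Finset.insert_Icc_add_one_left_eq_Icc (Nat.zero_le (N / m)),
      Finset.sum_insert (by simp)]
    simp
  have h1 : TT N (fun n => n % m = r) ≤ ∑ j ∈ Icc 0 (N / m), ((N : ℝ) - m * j) := by
    have h0 : TT N (fun n => n % m = r) = ∑ n ∈ (Ico 1 N).filter (fun n => n % m = r), ((N : ℝ) - n) := by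
      rw [TT]
      exact Finset.sum_congr (by ext; simp) (fun _ _ => rfl)
    rw [h0]
    calc ∑ n ∈ (Ico 1 N).filter (fun n => n % m = r), ((N : ℝ) - n)
        ≤ ∑ n ∈ (Ico 1 N).filter (fun n => n % m = r), ((N : ℝ) - m * (n / m : ℕ)) := by
          apply Finset.sum_le_sum
          intro n _
          have : ((m * (n / m) : ℕ) : ℝ) ≤ n := by exact_mod_cast Nat.mul_div_le n m
          push_cast at this
          linarith
      _ = ∑ j ∈ ((Ico 1 N).filter (fun n => n % m = r)).image (fun n => n / m),
            ((N : ℝ) - m * j) := by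
          rw [Finset.sum_image]
          intro a ha b hb hab
          simp only [coe_filter, mem_Ico, Set.mem_ofPred_eq] at ha hb
          simp only at hab
          rw [← Nat.div_add_mod a m, ← Nat.div_add_mod b m, hab, ha.2, hb.2]
      _ ≤ _ := by
          apply Finset.sum_le_sum_of_subset_of_nonneg
          · intro j hj
            simp only [mem_image, mem_filter, mem_Ico, mem_Icc] at hj ⊢
            obtain ⟨n, ⟨⟨h1, h2⟩, _⟩, rfl⟩ := hj
            exact ⟨Nat.zero_le _, Nat.div_le_div_right h2.le⟩
          · intro j hj _
            rw [mem_Icc] at hj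
            have : m * j ≤ N := (Nat.mul_le_mul_left m hj.2).trans (Nat.mul_div_le N m)
            have : (m : ℝ) * j ≤ N := by exact_mod_cast this
            linarith
  have := TT_dvd_le N m hm
  linarith

lemma TT_odd (N q : ℕ) (hq : 1 ≤ q) (hodd : ¬ 2 ∣ q) :
    TT N (fun n => ¬ 2 ∣ n ∧ q ∣ n) ≤ (N : ℝ) ^ 2 / (4 * q) := by
  have h1 := TT_split N (q ∣ ·) (2 ∣ ·)
  have h2 : TT N (fun n => 2 ∣ n ∧ q ∣ n) = TT N ((q * 2) ∣ ·) := by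
    apply TT_congr
    intro n _ _
    constructor
    · rintro ⟨ha, hb⟩
      exact Nat.Coprime.mul_dvd_of_dvd_of_dvd
        ((Nat.Prime.coprime_iff_not_dvd Nat.prime_two).2 hodd).symm hb ha
    · intro h
      exact ⟨(Dvd.intro_left q rfl).trans h, (Dvd.intro 2 rfl).trans h⟩
  rw [h2, TT_dvd N q hq, TT_dvd N (q * 2) (by omega)] at h1
  have hq0 : (0 : ℝ) < q := by exact_mod_cast hq
  have hmod := Nat.mod_mul (x := N) (a := q) (b := 2)
  have hr : N % q < q := Nat.mod_lt N hq
  have key : ((N % q : ℕ) : ℝ) * (q - (N % q : ℕ)) / (2 * q)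
      ≤ ((N % (q * 2) : ℕ) : ℝ) * ((q * 2 : ℕ) - (N % (q * 2) : ℕ)) / (2 * (q * 2 : ℕ)) := by
    rw [div_le_div_iff₀ (by positivity) (by push_cast; positivity)]
    rcases Nat.mod_two_eq_zero_or_one (N / q) with h | h
    · rw [h] at hmod
      rw [hmod]
      push_cast
      nlinarith [mul_nonneg hq0.le (sq_nonneg ((N % q : ℕ) : ℝ))]
    · rw [h] at hmod
      rw [hmod]
      push_cast
      nlinarith [mul_nonneg hq0.le (sq_nonneg ((q : ℝ) - (N % q : ℕ)))]
  have e : (N : ℝ) ^ 2 / (2 * q) - (N : ℝ) ^ 2 / (2 * (q * 2 : ℕ)) = (N : ℝ) ^ 2 / (4 * q) := by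
    push_cast; field_simp; norm_num
  linarith

lemma prime_sum_le_SS (N z : ℕ) (hz : 2 ≤ z) (s : Finset ℕ) (hs : ∀ q ∈ s, q.Prime ∧ z ≤ q ∧ q < N) :
    ∑ q ∈ s, TT N (q ∣ ·) ≤ SS N z := by
  rw [SS]
  have h1 : ∑ q ∈ s, TT N (q ∣ ·) = ∑ q ∈ s, Lam q / Real.log q * TT N (q ∣ ·) := by
    apply Finset.sum_congr rfl
    intro q hq
    rw [Lam_prime (hs q hq).1, div_self, one_mul]
    exact (Real.log_pos (by exact_mod_cast (hs q hq).1.one_lt)).ne'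
  rw [h1]
  apply Finset.sum_le_sum_of_subset_of_nonneg
  · intro q hq
    rw [mem_Ico]
    exact (hs q hq).2
  · intro d _ _
    exact mul_nonneg (div_nonneg (Lam_nonneg d) (Real.log_natCast_nonneg d)) (TT_nonneg _ _)

lemma SS_anti (N : ℕ) {z z' : ℕ} (h : z ≤ z') : SS N z' ≤ SS N z := by
  rw [SS, SS]
  apply Finset.sum_le_sum_of_subset_of_nonneg (Ico_subset_Ico_left h)
  intro d _ _
  exact mul_nonneg (div_nonneg (Lam_nonneg d) (Real.log_natCast_nonneg d)) (TT_nonneg _ _)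

lemma prime_sum_odd (N z : ℕ) (hz : 3 ≤ z) (hN : 300000 ≤ N) (s : Finset ℕ)
    (hs : ∀ q ∈ s, q.Prime ∧ z ≤ q ∧ q < N) :
    ∑ q ∈ s, TT N (fun n => ¬ 2 ∣ n ∧ q ∣ n) ≤
      SS N z / 2 + (N : ℝ) ^ 2 / 2 * (0.554 / Real.log z) := by
  have hv : 0 < Real.log z := Real.log_pos (by exact_mod_cast (by omega : 1 < z))
  have h1 : ∀ q ∈ s, TT N (fun n => ¬ 2 ∣ n ∧ q ∣ n) ≤ TT N (q ∣ ·) / 2 + N / 4 := by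
    intro q hq
    obtain ⟨hp, hzq, _⟩ := hs q hq
    have hodd : ¬ 2 ∣ q := by
      intro h
      have := (Nat.prime_dvd_prime_iff_eq Nat.prime_two hp).1 h
      omega
    have a := TT_odd N q (by omega) hodd
    have b := TT_dvd_ge N q (by omega)
    have : (N : ℝ) ^ 2 / (4 * q) = (N : ℝ) ^ 2 / (2 * q) / 2 := by
      have : (0 : ℝ) < q := by exact_mod_cast (by omega : 0 < q)
      field_simp; norm_num
    linarith
  refine (Finset.sum_le_sum h1).trans ?_
  rw [Finset.sum_add_distrib, ← Finset.sum_div]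
  have h2 := prime_sum_le_SS N z (by omega) s hs
  have h3 : (s.card : ℝ) ≤ psi N / Real.log z := by
    rw [le_div_iff₀ hv, ← nsmul_eq_mul, ← Finset.sum_const]
    calc ∑ q ∈ s, Real.log z ≤ ∑ q ∈ s, Lam q := by
          apply Finset.sum_le_sum
          intro q hq
          rw [Lam_prime (hs q hq).1]
          exact Real.log_le_log (by exact_mod_cast (by omega : 0 < z))
            (by exact_mod_cast (hs q hq).2.1)
      _ ≤ psi N := by
          rw [psi]
          apply Finset.sum_le_sum_of_subset_of_nonneg
          · intro q hq
            have := hs q hq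
            rw [mem_Icc]; omega
          · intro d _ _; exact Lam_nonneg d
  have h4 : psi N / Real.log z ≤ 1.108 * N / Real.log z :=
    div_le_div_of_nonneg_right (psi_upper N hN) hv.le
  rw [Finset.sum_const, nsmul_eq_mul]
  have h5 : (s.card : ℝ) * (N / 4) ≤ 1.108 * N / Real.log z * (N / 4) :=
    mul_le_mul_of_nonneg_right (h3.trans h4) (by positivity)
  have h6 : 1.108 * N / Real.log z * (N / 4) = (N : ℝ) ^ 2 / 2 * (0.554 / Real.log z) := by
    field_simp; norm_num
  linarith

end CCF

namespace CCF
open Finset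

/-- The hypothesis extracted from norm-Euclideanity. -/
def Hno {p : ℕ} [Fact p.Prime] (χ : MulChar (ZMod p) ℂ) : Prop :=
  ∀ x : ℕ, 0 < x → x < p → χ (x : ZMod p) = 1 →
    (∀ q : ℕ, q.Prime → q < p → χ (q : ZMod p) ≠ 1 → 3 ∣ padicValNat q x) ∨
    (∀ q : ℕ, q.Prime → q < p → χ (q : ZMod p) ≠ 1 → 3 ∣ padicValNat q (p - x))

section
variable {p : ℕ} [hp : Fact p.Prime] (χ : MulChar (ZMod p) ℂ)

lemma nonres (n : ℕ) (hn : 1 ≤ n) (h : χ (n : ZMod p) ≠ 1) :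
    ∃ q, q.Prime ∧ q ∣ n ∧ χ (q : ZMod p) ≠ 1 := by
  by_contra hcon
  push Not at hcon
  apply h
  clear h
  induction n using Nat.strong_induction_on with
  | _ n ih =>
    rcases Nat.eq_or_lt_of_le hn with h1 | h1
    · rw [← h1]; simp
    · obtain ⟨q, hq, m, rfl⟩ := Nat.exists_prime_and_dvd (by omega : n ≠ 1)
      have hm : 1 ≤ m := by
        rcases Nat.eq_zero_or_pos m with rfl | h
        · simp at h1
        · exact h
      have h2 := ih m (by nlinarith [hq.two_le]) hm
        (fun q' hq' hd => hcon q' hq' (hd.mul_left q))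
      push_cast
      rw [map_mul, h2, hcon q hq (Dvd.intro m rfl), mul_one]

/-- pair of the two smallest noncube primes -/
structure Two (χ : MulChar (ZMod p) ℂ) (q1 q2 : ℕ) : Prop where
  pr1 : q1.Prime
  pr2 : q2.Prime
  lt : q1 < q2
  ltp : q2 < p
  c1 : χ (q1 : ZMod p) ≠ 1
  c2 : χ (q2 : ZMod p) ≠ 1
  min : ∀ q : ℕ, q.Prime → χ (q : ZMod p) ≠ 1 → q = q1 ∨ q2 ≤ q

variable {χ} {q1 q2 : ℕ}

lemma Two.small (T : Two χ q1 q2) (k : ℕ) (hk : 1 ≤ k) (hk2 : k < q1) : χ (k : ZMod p) = 1 := by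
  by_contra h
  obtain ⟨q, hq, hd, hc⟩ := nonres χ k hk h
  have := Nat.le_of_dvd hk hd
  have := T.lt
  rcases T.min q hq hc with h | h <;> omega

lemma Two.good (T : Two χ q1 q2) (H : Hno χ) (n : ℕ) (hn : 1 ≤ n) (h1 : ¬ q1 ∣ n)
    (h2 : ¬ q2 ^ 2 ∣ n) (hc : χ (n : ZMod p) * χ (q2 : ZMod p) = 1) (hle : q1 * q2 * n ≤ p) :
    ∃ k, 1 ≤ k ∧ k < q1 ∧ (q1 : ℤ) ^ 3 ∣ (p : ℤ) - k * q2 * n := by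
  have hpr1 := T.pr1
  have hpr2 := T.pr2
  have hlt := T.lt
  haveI : Fact q1.Prime := ⟨T.pr1⟩
  haveI : Fact q2.Prime := ⟨T.pr2⟩
  have hq12 : ¬ q1 ∣ q2 := fun h => by
    have := (Nat.prime_dvd_prime_iff_eq hpr1 hpr2).1 h; omega
  have hq1p : ¬ q1 ∣ p := fun h => by
    have := (Nat.prime_dvd_prime_iff_eq hpr1 hp.out).1 h
    have := T.ltp; omega
  have hu : ((q2 * n : ℕ) : ZMod q1) ≠ 0 := by
    rw [Ne, ZMod.natCast_eq_zero_iff]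
    intro h
    rcases (Nat.Prime.dvd_mul hpr1).1 h with h | h
    · exact hq12 h
    · exact h1 h
  set kk : ZMod q1 := (p : ZMod q1) * ((q2 * n : ℕ) : ZMod q1)⁻¹ with hkk
  have hkk0 : kk ≠ 0 := by
    apply mul_ne_zero
    · rwa [Ne, ZMod.natCast_eq_zero_iff]
    · exact inv_ne_zero hu
  set k := kk.val with hk
  have hkq : k < q1 := ZMod.val_lt kk
  have hk1 : 1 ≤ k := by
    rw [Nat.one_le_iff_ne_zero, hk, Ne, ZMod.val_eq_zero]; exact hkk0
  have hcast : ((k * (q2 * n) : ℕ) : ZMod q1) = (p : ZMod q1) := by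
    rw [Nat.cast_mul, hk, ZMod.natCast_zmod_val, hkk, mul_assoc, inv_mul_cancel₀ hu, mul_one]
  have hx0 : 0 < k * (q2 * n) := Nat.mul_pos hk1 (Nat.mul_pos hpr2.pos hn)
  have hxp : k * (q2 * n) < p := by
    have : k * (q2 * n) < q1 * (q2 * n) := Nat.mul_lt_mul_of_pos_right hkq (Nat.mul_pos hpr2.pos hn)
    have h3 : q1 * (q2 * n) = q1 * q2 * n := by ring
    omega
  have hχx : χ ((k * (q2 * n) : ℕ) : ZMod p) = 1 := by
    push_cast
    rw [map_mul, map_mul, T.small k hk1 hkq, one_mul, mul_comm]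
    exact hc
  have hdv : q1 ∣ p - k * (q2 * n) := by
    rw [← ZMod.natCast_eq_zero_iff, Nat.cast_sub hxp.le, hcast, sub_self]
  refine ⟨k, hk1, hkq, ?_⟩
  rcases H _ hx0 hxp hχx with h | h
  · exfalso
    have h3 := h q2 hpr2 T.ltp T.c2
    rw [padicValNat.mul (by omega) (Nat.mul_pos hpr2.pos hn).ne',
      padicValNat.mul hpr2.pos.ne' (by omega), padicValNat_self,
      padicValNat.eq_zero_of_not_dvd (fun hd => by
        have := Nat.le_of_dvd hk1 hd; omega)] at h3
    have h4 : padicValNat q2 n < 2 := by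
      by_contra h5
      push Not at h5
      exact h2 ((padicValNat_dvd_iff_le (by omega)).2 h5)
    omega
  · have h3 := h q1 hpr1 (hlt.trans T.ltp) T.c1
    have hne : p - k * (q2 * n) ≠ 0 := by omega
    have h4 : 1 ≤ padicValNat q1 (p - k * (q2 * n)) := one_le_padicValNat_of_dvd hne hdv
    have h5 : 3 ≤ padicValNat q1 (p - k * (q2 * n)) := Nat.le_of_dvd h4 h3
    have h6 := (padicValNat_dvd_iff_le hne).2 h5
    have h7 : ((q1 ^ 3 : ℕ) : ℤ) ∣ ((p - k * (q2 * n) : ℕ) : ℤ) := Int.natCast_dvd_natCast.2 h6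
    rw [Nat.cast_sub hxp.le] at h7
    push_cast at h7
    rw [← mul_assoc] at h7
    exact h7

end

lemma TT_class (N m : ℕ) (hm : 1 ≤ m) (P : ℕ → Prop)
    (hP : ∀ a b, P a → P b → a % m = b % m) : TT N P ≤ N + (N : ℝ) ^ 2 / (2 * m) := by
  by_cases h : ∃ a, P a
  · obtain ⟨a, ha⟩ := h
    exact (TT_mono (fun n _ _ hn => hP n a hn ha)).trans (TT_modclass N m (a % m) hm)
  · push Not at h
    have : TT N P ≤ 0 := by
      rw [TT]
      apply le_of_eq
      apply Finset.sum_eq_zero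
      intro n hn
      simp only [mem_filter] at hn
      exact absurd hn.2 (h n)
    have : (0 : ℝ) ≤ N + (N : ℝ) ^ 2 / (2 * m) := by positivity
    linarith

lemma mod_unique {p q1 c : ℕ} (hpr : q1.Prime) (hc : ¬ q1 ∣ c) (a b : ℕ)
    (ha : (q1 : ℤ) ^ 3 ∣ (p : ℤ) - c * a) (hb : (q1 : ℤ) ^ 3 ∣ (p : ℤ) - c * b) :
    a % q1 ^ 3 = b % q1 ^ 3 := by
  have h := dvd_sub hb ha
  have h1 : (p : ℤ) - c * b - (p - c * a) = c * ((a : ℤ) - b) := by ring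
  rw [h1] at h
  have hco : IsCoprime ((q1 : ℤ) ^ 3) (c : ℤ) := by
    apply IsCoprime.pow_left
    rw [Nat.isCoprime_iff_coprime]
    exact (Nat.Prime.coprime_iff_not_dvd hpr).2 hc
  have h2 := hco.dvd_of_dvd_mul_left h
  have h3 : (b : ℤ) ≡ a [ZMOD ((q1 ^ 3 : ℕ) : ℤ)] := by
    rw [Int.modEq_iff_dvd]; push_cast; exact h2
  exact ((Int.natCast_modEq_iff).1 h3).symm

lemma TT_bad {p q1 q2 : ℕ} (h1 : q1.Prime) (h2 : q2.Prime) (hlt : q1 < q2) (M : ℕ) :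
    TT M (fun n => ∃ k, 1 ≤ k ∧ k < q1 ∧ (q1 : ℤ) ^ 3 ∣ (p : ℤ) - k * q2 * n)
      ≤ (q1 - 1) * (M + (M : ℝ) ^ 2 / (2 * (q1 : ℝ) ^ 3)) := by
  have e1 : TT M (fun n => ∃ k, 1 ≤ k ∧ k < q1 ∧ (q1 : ℤ) ^ 3 ∣ (p : ℤ) - k * q2 * n)
      = TT M (fun n => ∃ k ∈ Ico 1 q1, (q1 : ℤ) ^ 3 ∣ (p : ℤ) - k * q2 * n) := by
    apply TT_congr
    intro n _ _
    simp [and_assoc]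
  rw [e1]
  refine (TT_bUnion _ _ _).trans ?_
  have hb : ∀ k ∈ Ico 1 q1, TT M (fun n => (q1 : ℤ) ^ 3 ∣ (p : ℤ) - k * q2 * n)
      ≤ M + (M : ℝ) ^ 2 / (2 * (q1 : ℝ) ^ 3) := by
    intro k hk
    rw [mem_Ico] at hk
    have := TT_class M (q1 ^ 3) (Nat.pos_of_ne_zero (pow_ne_zero 3 h1.ne_zero))
      (fun n => (q1 : ℤ) ^ 3 ∣ (p : ℤ) - k * q2 * n) (by
        intro a b ha hb
        apply mod_unique (p := p) (c := k * q2) h1 _ a b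
        · push_cast; exact ha
        · push_cast; exact hb
        · intro h
          rcases (Nat.Prime.dvd_mul h1).1 h with h | h
          · have := Nat.le_of_dvd hk.1 h; omega
          · have := (Nat.prime_dvd_prime_iff_eq h1 h2).1 h; omega)
    push_cast at this
    exact this
  refine (Finset.sum_le_sum hb).trans ?_
  rw [Finset.sum_const, Nat.card_Ico, nsmul_eq_mul, Nat.cast_sub h1.one_lt.le, Nat.cast_one]

end CCF

namespace CCF
open Finset

section
variable {p : ℕ} [hp : Fact p.Prime] {χ : MulChar (ZMod p) ℂ}

lemma coprime_mass (h3 : χ ^ 3 = 1) (hχ : χ ≠ 1) (c : ℂ) (hc : c ^ 3 = 1) (d M : ℕ) (hd : 1 ≤ d)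
    (hdp : d < p) (hM : d * M ≤ p) :
    |TT (d * M) (fun n => ¬ d ∣ n ∧ χ (n : ZMod p) = c)
      - ((d * M : ℕ) : ℝ) ^ 2 / 6 * (1 - 1 / d)| ≤ 2 * ((d * M : ℕ) : ℝ) * √p / 3 := by
  have hd0 : (0 : ℝ) < d := by exact_mod_cast hd
  have hχd : χ (d : ZMod p) ^ 3 = 1 := chi_cube χ h3 (natCast_ne_zero hd hdp)
  have h1 := TT_split (d * M) (fun n => χ (n : ZMod p) = c) (d ∣ ·)
  have h2 := TT_scale d M hd (fun n => χ (n : ZMod p) = c)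
  have h4 : TT M (fun m => χ ((d * m : ℕ) : ZMod p) = c)
      = TT M (fun m => χ (m : ZMod p) = c * χ (d : ZMod p) ^ 2) := by
    apply TT_congr
    intro n _ _
    push_cast
    rw [map_mul]
    constructor
    · intro h
      rw [← h]
      linear_combination (-χ (n : ZMod p)) * hχd
    · intro h
      rw [h]
      linear_combination c * hχd
  rw [h4] at h2
  have h5 := class_mass χ h3 hχ c hc (d * M) hM
  have hMM : M ≤ d * M := Nat.le_mul_of_pos_left M hd
  have h6 := class_mass χ h3 hχ (c * χ (d : ZMod p) ^ 2) (by
    rw [mul_pow, hc, ← pow_mul, mul_comm 2 3, pow_mul, hχd]; norm_num) M (hMM.trans hM)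
  rw [abs_le] at h5 h6 ⊢
  have e : ((d * M : ℕ) : ℝ) ^ 2 / 6 * (1 - 1 / d)
      = ((d * M : ℕ) : ℝ) * (((d * M : ℕ) : ℝ) - 1) / 6 - d * (M * (M - 1) / 6) := by
    push_cast; field_simp; ring
  have h7 := mul_le_mul_of_nonneg_left h6.1 hd0.le
  have h8 := mul_le_mul_of_nonneg_left h6.2 hd0.le
  have e2 : (d : ℝ) * (M * √p / 3) = ((d * M : ℕ) : ℝ) * √p / 3 := by push_cast; ring
  have e3 : (d : ℝ) * -(M * √p / 3) = -(((d * M : ℕ) : ℝ) * √p / 3) := by push_cast; ring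
  rw [e2] at h8
  rw [e3] at h7
  rw [e]
  constructor <;> nlinarith [h5.1, h5.2]

/-- the length of the sums -/
noncomputable def NN (p : ℕ) : ℕ := 16 * (Nat.sqrt p + 1)

lemma NN_facts (hbig : 2 * 10 ^ 20 ≤ p) :
    (14142000000 : ℝ) ≤ √p ∧ √p * √p = p ∧ (NN p : ℝ) ≤ 16 * √p + 16 ∧ 16 * √p ≤ NN p ∧
      (226272000000 : ℝ) ≤ NN p ∧ NN p ≤ p ∧ 2 ∣ NN p := by
  have hR : (2 * 10 ^ 20 : ℝ) ≤ p := by exact_mod_cast hbig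
  have h0 : (14142000000 : ℝ) ≤ √p := by
    apply Real.le_sqrt_of_sq_le
    norm_num at hR ⊢
    linarith
  have h1 : √(p : ℝ) * √p = p := Real.mul_self_sqrt (by positivity)
  have h2 : (NN p : ℝ) ≤ 16 * √p + 16 := by
    rw [NN]; push_cast
    have : (Nat.sqrt p : ℝ) ≤ √p := Real.nat_sqrt_le_real_sqrt
    linarith
  have h3 : 16 * √(p : ℝ) ≤ NN p := by
    rw [NN]; push_cast
    have : √(p : ℝ) ≤ Nat.sqrt p + 1 := Real.real_sqrt_le_nat_sqrt_succ
    linarith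
  refine ⟨h0, h1, h2, h3, by linarith, ?_, ⟨8 * (Nat.sqrt p + 1), by rw [NN]; ring⟩⟩
  have : (NN p : ℝ) ≤ p := by nlinarith
  exact_mod_cast this

lemma NR_mass (hbig : 2 * 10 ^ 20 ≤ p) (h3 : χ ^ 3 = 1) (hχ : χ ≠ 1) :
    ((NN p : ℕ) : ℝ) ^ 2 / 2 * 0.62499 ≤ TT (NN p) (fun n => ¬ χ (n : ZMod p) = 1) := by
  obtain ⟨f1, f2, f3, f4, f5, f6, f7⟩ := NN_facts hbig
  have h := class_mass χ h3 hχ 1 (by norm_num) (NN p) f6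
  have h2 := TT_compl (NN p) (fun n => χ (n : ZMod p) = 1)
  rw [abs_le] at h
  have h4 : (NN p : ℝ) * √p / 3 ≤ NN p * NN p / 48 := by nlinarith
  nlinarith

lemma NR_odd_mass (hbig : 2 * 10 ^ 20 ≤ p) (h3 : χ ^ 3 = 1) (hχ : χ ≠ 1) :
    ((NN p : ℕ) : ℝ) ^ 2 / 2 * 0.24999 ≤ TT (NN p) (fun n => ¬ 2 ∣ n ∧ ¬ χ (n : ZMod p) = 1) := by
  obtain ⟨f1, f2, f3, f4, f5, f6, M, hM⟩ := NN_facts hbig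
  have h := coprime_mass h3 hχ 1 (by norm_num) 2 M (by norm_num) (by omega) (by omega)
  rw [← hM, abs_le] at h
  have h2 := TT_compl (NN p) (2 ∣ ·)
  have h5 := TT_dvd_le (NN p) 2 (by norm_num)
  have h6 := TT_split (NN p) (fun n => ¬ 2 ∣ n) (fun n => χ (n : ZMod p) = 1)
  have h7 : TT (NN p) (fun n => χ (n : ZMod p) = 1 ∧ ¬ 2 ∣ n)
      = TT (NN p) (fun n => ¬ 2 ∣ n ∧ χ (n : ZMod p) = 1) := TT_congr (fun _ _ _ => and_comm)
  have h8 : TT (NN p) (fun n => ¬ χ (n : ZMod p) = 1 ∧ ¬ 2 ∣ n)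
      = TT (NN p) (fun n => ¬ 2 ∣ n ∧ ¬ χ (n : ZMod p) = 1) := TT_congr (fun _ _ _ => and_comm)
  rw [h7, h8] at h6
  have h4 : 2 * (NN p : ℝ) * √p / 3 ≤ NN p * NN p / 24 := by nlinarith
  push_cast at h h5
  nlinarith

lemma exists_two (hbig : 2 * 10 ^ 20 ≤ p) (h3 : χ ^ 3 = 1) (hχ : χ ≠ 1) :
    ∃ q1 q2, Two χ q1 q2 := by
  classical
  obtain ⟨f1, f2, f3, f4, f5, f6, f7⟩ := NN_facts hbig
  have hm := NR_mass hbig h3 hχ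
  have key : ∀ r, 2 ≤ r → ∃ q, q.Prime ∧ q < p ∧ q ≠ r ∧ χ (q : ZMod p) ≠ 1 := by
    intro r hr
    by_contra hcon
    push Not at hcon
    have : TT (NN p) (fun n => ¬ χ (n : ZMod p) = 1) ≤ TT (NN p) (r ∣ ·) := by
      apply TT_mono
      intro n h1 h2 h
      obtain ⟨q, hq, hd, hc⟩ := nonres χ n h1 h
      have : q < p := by have := Nat.le_of_dvd h1 hd; omega
      by_cases hqr : q = r
      · exact hqr ▸ hd
      · exact absurd (hcon q hq this hqr) hc
    have h5 := TT_dvd_le (NN p) r (by omega)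
    have h6 : (NN p : ℝ) ^ 2 / (2 * r) ≤ (NN p : ℝ) ^ 2 / (2 * 2) := by
      gcongr
      exact_mod_cast hr
    nlinarith
  have e1 : ∃ q, q.Prime ∧ q < p ∧ χ (q : ZMod p) ≠ 1 := by
    obtain ⟨q, a, b, _, c⟩ := key 4 (by norm_num)
    exact ⟨q, a, b, c⟩
  obtain ⟨a1, a2, a3⟩ := Nat.find_spec e1
  set q1 := Nat.find e1 with hq1
  have e2 := key q1 a1.two_le
  obtain ⟨b1, b2, b3, b4⟩ := Nat.find_spec e2
  have hmin2 : ∀ q : ℕ, q.Prime → q < p → q ≠ q1 → χ (q : ZMod p) ≠ 1 → Nat.find e2 ≤ q :=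
    fun q h1 h2 h3 h4 => Nat.find_min' e2 ⟨h1, h2, h3, h4⟩
  have hmin1 : q1 ≤ Nat.find e2 := Nat.find_min' e1 ⟨b1, b2, b4⟩
  refine ⟨q1, Nat.find e2, a1, b1, lt_of_le_of_ne hmin1 (Ne.symm b3), b2, a3, b4, ?_⟩
  intro q hq hc
  by_cases hqq : q = q1
  · exact Or.inl hqq
  · right
    by_cases hqp : q < p
    · exact hmin2 q hq hqp hqq hc
    · exact b2.le.trans (by omega)

variable {q1 q2 : ℕ}

lemma Two.nr (T : Two χ q1 q2) (N n : ℕ) (h1 : 1 ≤ n) (hn : n < N) (h : ¬ χ (n : ZMod p) = 1) :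
    q1 ∣ n ∨ ∃ q ∈ (Ico q2 N).filter Nat.Prime, q ∣ n := by
  obtain ⟨q, hq, hd, hc⟩ := nonres χ n h1 h
  rcases T.min q hq hc with rfl | h
  · exact Or.inl hd
  · refine Or.inr ⟨q, ?_, hd⟩
    rw [mem_filter, mem_Ico]
    exact ⟨⟨h, (Nat.le_of_dvd h1 hd).trans_lt hn⟩, hq⟩

lemma Two.nr_le (T : Two χ q1 q2) (N : ℕ) :
    TT N (fun n => ¬ χ (n : ZMod p) = 1) ≤ (N : ℝ) ^ 2 / (2 * q1) + SS N q2 := by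
  refine (TT_mono (fun n a b h => T.nr N n a b h)).trans ((TT_or _ _ _).trans ?_)
  apply add_le_add (TT_dvd_le N q1 T.pr1.one_lt.le)
  refine (TT_bUnion _ _ (fun q n => q ∣ n)).trans ?_
  apply prime_sum_le_SS N q2 T.pr2.two_le
  intro q hq
  rw [mem_filter, mem_Ico] at hq
  exact ⟨hq.2, hq.1⟩

lemma Two.nr_odd_le (T : Two χ 2 q2) (N : ℕ) (hN : 300000 ≤ N) :
    TT N (fun n => ¬ 2 ∣ n ∧ ¬ χ (n : ZMod p) = 1)
      ≤ SS N q2 / 2 + (N : ℝ) ^ 2 / 2 * (0.554 / Real.log q2) := by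
  refine (TT_mono (Q := fun n => ∃ q ∈ (Ico q2 N).filter Nat.Prime, ¬ 2 ∣ n ∧ q ∣ n)
    (fun n a b h => ?_)).trans ?_
  · rcases T.nr N n a b h.2 with h' | ⟨q, hq, hd⟩
    · exact absurd h' h.1
    · exact ⟨q, hq, h.1, hd⟩
  refine (TT_bUnion _ _ (fun q n => ¬ 2 ∣ n ∧ q ∣ n)).trans ?_
  apply prime_sum_odd N q2 (by have := T.lt; omega) hN
  intro q hq
  rw [mem_filter, mem_Ico] at hq
  exact ⟨hq.2, hq.1⟩

end
end CCF

namespace CCF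
open Finset

section
variable {p : ℕ} [hp : Fact p.Prime] {χ : MulChar (ZMod p) ℂ} {q1 q2 : ℕ}

lemma Two.b3 (T : Two χ q1 q2) (h3 : χ ^ 3 = 1) : χ (q2 : ZMod p) ^ 3 = 1 :=
  chi_cube χ h3 (natCast_ne_zero T.pr2.one_lt.le T.ltp)

lemma Two.regI (T : Two χ q1 q2) (H : Hno χ) (h3 : χ ^ 3 = 1) (M : ℕ) (hM : q1 * q2 * M ≤ p) :
    TT M (fun n => ¬ q1 ∣ n ∧ χ (n : ZMod p) = χ (q2 : ZMod p) ^ 2) ≤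
      TT M (fun n => ¬ q1 ∣ n ∧ q2 ^ 2 ∣ n ∧ χ (n : ZMod p) = χ (q2 : ZMod p) ^ 2)
      + (q1 - 1) * (M + (M : ℝ) ^ 2 / (2 * (q1 : ℝ) ^ 3)) := by
  refine le_trans (TT_mono (fun n h1 h2 h => ?_)) ((TT_or _ _ _).trans
    (add_le_add_right (TT_bad (p := p) T.pr1 T.pr2 T.lt M) _))
  by_cases hd : q2 ^ 2 ∣ n
  · exact Or.inl ⟨h.1, hd, h.2⟩
  · right
    apply T.good H n h1 h.1 hd
    · rw [h.2, ← pow_succ]; exact T.b3 h3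
    · exact (Nat.mul_le_mul_left _ h2.le).trans hM

lemma Two.regI_a (T : Two χ 2 3) (H : Hno χ) (h3 : χ ^ 3 = 1) (hχ : χ ≠ 1)
    (hbig : 2 * 10 ^ 20 ≤ p) : False := by
  obtain ⟨f1, f2, -, -, -, -, -⟩ := NN_facts hbig
  set M' := p / 108 with hM'
  have hb : (χ ((3 : ℕ) : ZMod p) ^ 2) ^ 3 = 1 := by
    rw [← pow_mul, mul_comm, pow_mul, T.b3 h3, one_pow]
  have h9 : (χ ((9 : ℕ) : ZMod p)) ^ 3 = 1 :=
    chi_cube χ h3 (natCast_ne_zero (by norm_num) (by omega))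
  have hle : 108 * M' ≤ p := Nat.mul_div_le p 108
  have h1 := T.regI H h3 (2 * (9 * M')) (by omega)
  have h2 := coprime_mass h3 hχ (χ ((3 : ℕ) : ZMod p) ^ 2) hb 2 (9 * M') (by norm_num) (by omega)
    (by omega)
  have h4 : TT (2 * (9 * M')) (fun n => ¬ 2 ∣ n ∧ 3 ^ 2 ∣ n ∧
      χ (n : ZMod p) = χ ((3 : ℕ) : ZMod p) ^ 2) =
      TT (9 * (2 * M')) (fun n => 9 ∣ n ∧ (¬ 2 ∣ n ∧
        χ (n : ZMod p) = χ ((3 : ℕ) : ZMod p) ^ 2)) := by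
    rw [show 2 * (9 * M') = 9 * (2 * M') by ring]
    apply TT_congr
    intro n _ _
    norm_num
    tauto
  rw [h4, TT_scale 9 (2 * M') (by norm_num)] at h1
  have h5 : TT (2 * M') (fun m => ¬ 2 ∣ 9 * m ∧
      χ ((9 * m : ℕ) : ZMod p) = χ ((3 : ℕ) : ZMod p) ^ 2) =
      TT (2 * M') (fun m => ¬ 2 ∣ m ∧
      χ (m : ZMod p) = χ ((3 : ℕ) : ZMod p) ^ 2 * χ ((9 : ℕ) : ZMod p) ^ 2) := by
    apply TT_congr
    intro n _ _
    rw [Nat.cast_mul, map_mul]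
    apply and_congr
    · omega
    constructor
    · intro h
      rw [← h]
      linear_combination (-χ (n : ZMod p)) * h9
    · intro h
      rw [h]
      linear_combination χ ((3 : ℕ) : ZMod p) ^ 2 * h9
  rw [h5] at h1
  have h6 := coprime_mass h3 hχ (χ ((3 : ℕ) : ZMod p) ^ 2 * χ ((9 : ℕ) : ZMod p) ^ 2) (by
    rw [mul_pow, hb, ← pow_mul, mul_comm 2 3, pow_mul, h9]; norm_num) 2 M' (by norm_num) (by omega)
    (by omega)
  rw [abs_le] at h2 h6
  have h7 : (p : ℝ) ≤ 108 * M' + 108 := by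
    have : p ≤ 108 * M' + 108 := by omega
    exact_mod_cast this
  push_cast at h1 h2 h6
  have hm : 10000000 * √(p : ℝ) ≤ M' := by nlinarith
  nlinarith [h2.1, h6.2]

lemma Two.regI_b (T : Two χ 2 q2) (H : Hno χ) (h3 : χ ^ 3 = 1) (hχ : χ ≠ 1)
    (hbig : 2 * 10 ^ 20 ≤ p) (h5 : 5 ≤ q2) : √(p : ℝ) < 132 * q2 := by
  obtain ⟨f1, f2, -, -, -, -, -⟩ := NN_facts hbig
  by_contra hcon
  push Not at hcon
  set M' := p / (4 * q2) with hM'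
  have hb : (χ (q2 : ZMod p) ^ 2) ^ 3 = 1 := by
    rw [← pow_mul, mul_comm, pow_mul, T.b3 h3, one_pow]
  have hle : 4 * q2 * M' ≤ p := Nat.mul_div_le p _
  have hlt : p < 4 * q2 * (M' + 1) := Nat.lt_mul_div_succ p (by omega)
  have h1 := T.regI H h3 (2 * M') (by linarith)
  have h2 := coprime_mass h3 hχ (χ (q2 : ZMod p) ^ 2) hb 2 M' (by norm_num) (by omega)
    (by nlinarith)
  have h4 : TT (2 * M') (fun n => ¬ 2 ∣ n ∧ q2 ^ 2 ∣ n ∧ χ (n : ZMod p) = χ (q2 : ZMod p) ^ 2)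
      ≤ TT (2 * M') (fun n => ¬ 2 ∣ n ∧ q2 ^ 2 ∣ n) := TT_mono (fun n _ _ h => ⟨h.1, h.2.1⟩)
  have h6 := TT_odd (2 * M') (q2 ^ 2) (Nat.pos_of_ne_zero (by positivity)) (fun h => by
    have := (Nat.prime_dvd_prime_iff_eq Nat.prime_two T.pr2).1 (Nat.prime_two.dvd_of_dvd_pow h)
    omega)
  have hq : (25 : ℝ) ≤ ((q2 ^ 2 : ℕ) : ℝ) := by
    exact_mod_cast (by nlinarith : 25 ≤ q2 ^ 2)
  have h7 : ((2 * M' : ℕ) : ℝ) ^ 2 / (4 * ((q2 ^ 2 : ℕ) : ℝ)) ≤ ((2 * M' : ℕ) : ℝ) ^ 2 / (4 * 25) := by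
    gcongr
  rw [abs_le] at h2
  have hltR : (p : ℝ) < 4 * q2 * (M' + 1) := by exact_mod_cast hlt
  set m : ℝ := ((2 * M' : ℕ) : ℝ) with hm
  have hm2 : m = 2 * M' := by rw [hm]; push_cast; ring
  have hm3 : 66 * √(p : ℝ) - 2 ≤ m := by
    by_contra hc
    push Not at hc
    have : (M' : ℝ) + 1 < 33 * √p := by linarith
    have h8 : 4 * (q2 : ℝ) * (M' + 1) ≤ 4 * q2 * (33 * √p) := by gcongr
    nlinarith
  push_cast at h1 h2
  nlinarith [h2.1]

lemma Two.regI_c (T : Two χ 3 q2) (H : Hno χ) (h3 : χ ^ 3 = 1) (hχ : χ ≠ 1)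
    (hbig : 2 * 10 ^ 20 ≤ p) : √(p : ℝ) < 39 * q2 := by
  obtain ⟨f1, f2, -, -, -, -, -⟩ := NN_facts hbig
  have h5 : 5 ≤ q2 := by
    have := T.lt
    by_contra h
    have h4 : q2 = 4 := by omega
    have := T.pr2
    rw [h4] at this
    norm_num at this
  by_contra hcon
  push Not at hcon
  set M' := p / (9 * q2) with hM'
  have hb : (χ (q2 : ZMod p) ^ 2) ^ 3 = 1 := by
    rw [← pow_mul, mul_comm, pow_mul, T.b3 h3, one_pow]
  have hle : 9 * q2 * M' ≤ p := Nat.mul_div_le p _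
  have hlt : p < 9 * q2 * (M' + 1) := Nat.lt_mul_div_succ p (by omega)
  have h1 := T.regI H h3 (3 * M') (by linarith)
  have h2 := coprime_mass h3 hχ (χ (q2 : ZMod p) ^ 2) hb 3 M' (by norm_num) (by omega)
    (by nlinarith)
  have h4 : TT (3 * M') (fun n => ¬ 3 ∣ n ∧ q2 ^ 2 ∣ n ∧ χ (n : ZMod p) = χ (q2 : ZMod p) ^ 2)
      ≤ TT (3 * M') (fun n => q2 ^ 2 ∣ n) := TT_mono (fun n _ _ h => h.2.1)
  have h6 := TT_dvd_le (3 * M') (q2 ^ 2) (Nat.pos_of_ne_zero (by positivity))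
  have hq : (25 : ℝ) ≤ ((q2 ^ 2 : ℕ) : ℝ) := by
    exact_mod_cast (by nlinarith : 25 ≤ q2 ^ 2)
  have h7 : ((3 * M' : ℕ) : ℝ) ^ 2 / (2 * ((q2 ^ 2 : ℕ) : ℝ)) ≤ ((3 * M' : ℕ) : ℝ) ^ 2 / (2 * 25) := by
    gcongr
  rw [abs_le] at h2
  have hltR : (p : ℝ) < 9 * q2 * (M' + 1) := by exact_mod_cast hlt
  set m : ℝ := ((3 * M' : ℕ) : ℝ) with hm
  have hm2 : m = 3 * M' := by rw [hm]; push_cast; ring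
  have hm3 : 13 * √(p : ℝ) - 3 ≤ m := by
    by_contra hc
    push Not at hc
    have : (M' : ℝ) + 1 < 13 / 3 * √p := by linarith
    have h8 : 9 * (q2 : ℝ) * (M' + 1) ≤ 9 * q2 * (13 / 3 * √p) := by gcongr
    nlinarith
  push_cast at h1 h2
  nlinarith [h2.1]

lemma Two.regI_gen (T : Two χ q1 q2) (H : Hno χ) (h3 : χ ^ 3 = 1) (hχ : χ ≠ 1)
    (hbig : 2 * 10 ^ 20 ≤ p) (a c : ℝ) (ha : 5 ≤ a) (haq : a ≤ q1) (hc2 : 2 ≤ c)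
    (hac : 1 / a + 2 / a ^ 2 + 2 / 3 / c + 0.001 ≤ 1 / 3) :
    √(p : ℝ) < c * (q1 * q2) := by
  obtain ⟨f1, f2, -, -, -, -, -⟩ := NN_facts hbig
  by_contra hcon
  push Not at hcon
  have q1pos := T.pr1.pos
  have q2pos := T.pr2.pos
  have hqq : (q1 : ℝ) < q2 := by exact_mod_cast T.lt
  have hq1R : (0 : ℝ) < q1 := by exact_mod_cast q1pos
  set M := p / (q1 * q2) with hM'
  have hb : (χ (q2 : ZMod p) ^ 2) ^ 3 = 1 := by
    rw [← pow_mul, mul_comm, pow_mul, T.b3 h3, one_pow]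
  have hle : q1 * q2 * M ≤ p := Nat.mul_div_le p _
  have hlt : p < q1 * q2 * (M + 1) := Nat.lt_mul_div_succ p (Nat.mul_pos q1pos q2pos)
  have hMp : M ≤ p := Nat.div_le_self _ _
  have h1 := T.regI H h3 M hle
  have h2 := class_mass χ h3 hχ (χ (q2 : ZMod p) ^ 2) hb M hMp
  have h0 := TT_split M (fun n => χ (n : ZMod p) = χ (q2 : ZMod p) ^ 2) (q1 ∣ ·)
  have h4 : TT M (fun n => ¬ q1 ∣ n ∧ q2 ^ 2 ∣ n ∧ χ (n : ZMod p) = χ (q2 : ZMod p) ^ 2)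
      ≤ TT M (fun n => q2 ^ 2 ∣ n) := TT_mono (fun n _ _ h => h.2.1)
  have h4' : TT M (fun n => q1 ∣ n ∧ χ (n : ZMod p) = χ (q2 : ZMod p) ^ 2)
      ≤ TT M (fun n => q1 ∣ n) := TT_mono (fun n _ _ h => h.1)
  have h6 := TT_dvd_le M (q2 ^ 2) (Nat.pos_of_ne_zero (by positivity))
  have h6' := TT_dvd_le M q1 q1pos
  have hq : a ^ 2 ≤ ((q2 ^ 2 : ℕ) : ℝ) := by
    push_cast
    gcongr
    linarith
  have h7 : (M : ℝ) ^ 2 / (2 * ((q2 ^ 2 : ℕ) : ℝ)) ≤ (M : ℝ) ^ 2 / (2 * a ^ 2) := by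
    gcongr
  have h7' : (M : ℝ) ^ 2 / (2 * q1) ≤ (M : ℝ) ^ 2 / (2 * a) := by
    gcongr
  have h8 : ((q1 : ℝ) - 1) * (M + (M : ℝ) ^ 2 / (2 * (q1 : ℝ) ^ 3))
      ≤ q1 * M + (M : ℝ) ^ 2 / (2 * a ^ 2) := by
    have : (q1 : ℝ) * ((M : ℝ) ^ 2 / (2 * (q1 : ℝ) ^ 3)) = (M : ℝ) ^ 2 / (2 * (q1 : ℝ) ^ 2) := by
      field_simp
    have h9 : (M : ℝ) ^ 2 / (2 * (q1 : ℝ) ^ 2) ≤ (M : ℝ) ^ 2 / (2 * a ^ 2) := by gcongr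
    have h10 : (0 : ℝ) ≤ M + (M : ℝ) ^ 2 / (2 * (q1 : ℝ) ^ 3) := by positivity
    nlinarith
  rw [abs_le] at h2
  have hltR : (p : ℝ) < q1 * q2 * (M + 1) := by exact_mod_cast hlt
  have hm3 : c * √(p : ℝ) - 1 ≤ M := by
    by_contra hc
    push Not at hc
    have : (M : ℝ) + 1 < c * √p := by linarith
    have h8 : (q1 * q2 : ℝ) * (M + 1) ≤ (q1 * q2) * (c * √p) := by gcongr
    have h9 : c * (q1 * q2) * √(p : ℝ) ≤ √p * √p := by gcongr
    have h10 : (q1 * q2 : ℝ) * (c * √p) = c * (q1 * q2) * √(p : ℝ) := by ring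
    linarith
  have hcs : 2 * √(p : ℝ) ≤ c * √p := by gcongr
  have hM0 : (0 : ℝ) < M := by linarith
  have hq1s : (q1 : ℝ) ≤ √p / 100000 := by
    by_contra hh
    push Not at hh
    have h12 : (q1 : ℝ) * q1 ≤ q1 * q2 := by gcongr
    have h13 : (√(p : ℝ) / 100000) * (√p / 100000) ≤ q1 * q1 := by gcongr
    have h14 : 2 * (q1 * q2 : ℝ) ≤ c * (q1 * q2) := by gcongr
    have h15 : √(p : ℝ) * 14142000000 ≤ √p * √p := by gcongr
    linarith
  -- divide by M
  have e1 : (M : ℝ) ^ 2 / (2 * a) = M * (M / 2 * (1 / a)) := by field_simp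
  have e2 : (M : ℝ) ^ 2 / (2 * a ^ 2) = M * (M / 4 * (2 / a ^ 2)) := by field_simp; norm_num
  have hfin : (M : ℝ) * ((M - 1) / 6 - √p / 3) ≤
      M * (M / 2 * (1 / a) + M / 4 * (2 / a ^ 2) + M / 4 * (2 / a ^ 2) + q1) := by
    rw [e1] at h7'
    rw [e2] at h7 h8
    have h21 := h2.1
    clear_value M
    clear h2 e1 e2 hac
    generalize (M / 2 * (1 / a) : ℝ) = A at *
    generalize (M / 4 * (2 / a ^ 2) : ℝ) = B at *
    have e3 : (M : ℝ) * ((M - 1) / 6 - √p / 3) = M * (M - 1) / 6 - M * √p / 3 := by ring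
    have e4 : (M : ℝ) * (A + B + B + q1) = M * A + M * B + M * B + q1 * M := by ring
    rw [e3, e4]
    linarith
  have hfin2 := le_of_mul_le_mul_left hfin hM0
  have h11 : (M : ℝ) / 2 * (1 / a + 2 / a ^ 2 + 2 / 3 / c + 0.001) ≤ M / 2 * (1 / 3) := by gcongr
  have h12 : √(p : ℝ) / 3 - 1 ≤ (M : ℝ) / 2 * (2 / 3 / c) := by
    have : (M : ℝ) / 2 * (2 / 3 / c) = M / c / 3 := by field_simp
    rw [this]
    have h13 : √(p : ℝ) - 1 / c ≤ M / c := by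
      rw [le_div_iff₀ (by linarith)]
      have : (√(p : ℝ) - 1 / c) * c = c * √p - 1 := by field_simp
      linarith
    have h14 : 1 / c ≤ 1 := by rw [div_le_one (by linarith)]; linarith
    linarith
  clear_value M
  clear h1 h2 h0 h4 h4' h6 h6' h7 h7' h8 e1 e2 hfin hac
  rw [mul_add, mul_add, mul_add] at h11
  linarith

end
end CCF

namespace CCF
open Finset

lemma log_le_tay {x c : ℝ} (hx : 0 < x) (hc : 0 ≤ c)
    (h : x ≤ 1 + c + c ^ 2 / 2 + c ^ 3 / 6 + c ^ 4 / 24) : Real.log x ≤ c := by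
  rw [Real.log_le_iff_le_exp hx]
  refine h.trans ?_
  have := Real.sum_le_exp_of_nonneg hc 5
  norm_num [Finset.sum_range_succ, Nat.factorial] at this
  linarith

lemma SS_num (N z : ℕ) (w0 R δ : ℝ) (hN : 100000000 ≤ N) (hz : 300000 ≤ z) (hzδ : (z : ℝ) ≤ δ * N)
    (hδ : δ ≤ 0.33) (hw0 : 0 < w0) (hw : w0 ≤ Real.log z) (hR : Real.log N - 1.1085 ≤ R * Real.log z) :
    SS N z ≤ (N : ℝ) ^ 2 / 2 * (Real.log R + (0.3199 + 1.108 * δ) / w0) := by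
  have hNR : (100000000 : ℝ) ≤ N := by exact_mod_cast hN
  have hzR : (300000 : ℝ) ≤ z := by exact_mod_cast hz
  have hz33 : (z : ℝ) ≤ 0.33 * N := hzδ.trans (by gcongr)
  have hzN : z ≤ N := by
    have : (z : ℝ) ≤ N := by linarith
    exact_mod_cast this
  have hlog : Real.log z ≤ Real.log N - 1.1085 := by
    have h1 : Real.log z ≤ Real.log (0.33 * N) := Real.log_le_log (by linarith) hz33
    rw [Real.log_mul (by norm_num) (by linarith)] at h1
    have h2 : Real.log (0.33 : ℝ) ≤ -1.1085 := by
      have h3 : Real.log (0.33 : ℝ) = Real.log 0.99 - Real.log 3 := by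
        rw [← Real.log_div (by norm_num) (by norm_num)]; norm_num
      have h4 := Real.log_le_sub_one_of_pos (show (0 : ℝ) < 0.99 by norm_num)
      have := log3_bounds.1
      rw [h3]; linarith
    linarith
  refine (SS_bound N z hz hN hzN hlog).trans ?_
  have hlz : 0 < Real.log z := by linarith
  have hμ : 0 < Real.log N - 1.1085 := by linarith
  have hzN2 : (z : ℝ) / N ≤ δ := by
    rw [div_le_iff₀ (by linarith)]; exact hzδ
  have hδ0 : 0 ≤ δ := le_trans (by positivity) hzN2
  have h1 : (Real.log N - 1.1085) / Real.log z ≤ R := by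
    rw [div_le_iff₀ hlz]; exact hR
  rw [mul_div_assoc]
  gcongr

lemma logN_ge {p : ℕ} [hp : Fact p.Prime] (hbig : 2 * 10 ^ 20 ≤ p) : 26.144 ≤ Real.log (NN p) := by
  obtain ⟨f1, f2, f3, f4, f5, f6, f7⟩ := NN_facts hbig
  have h1 := log_le_lin (a := (NN p : ℝ)) (x := 3 ^ 3 * 2 ^ 33) (by linarith) (by norm_num)
  rw [Real.log_mul (by norm_num) (by norm_num), Real.log_pow, Real.log_pow] at h1
  have := log3_bounds.1
  have := Real.log_two_gt_d9
  have h5 : (3 ^ 3 * 2 ^ 33 : ℝ) / NN p ≤ 3 ^ 3 * 2 ^ 33 / 226272000000 := by gcongr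
  norm_num at h1 h5 ⊢
  linarith

lemma excl {p : ℕ} [hp : Fact p.Prime] (hbig : 2 * 10 ^ 20 ≤ p) (q2 : ℕ) (A D R w0 : ℝ) (hA : 39 ≤ A) (hA2 : A ≤ 1000)
    (hs : √(p : ℝ) < A * q2) (hD : Real.log (16.0001 * A) ≤ D) (hw0 : 0 < w0) (hw : w0 ≤ 26.144 - D)
    (hR1 : 1 ≤ R) (hR : D - 1.1085 ≤ (R - 1) * w0) :
    SS (NN p) q2 ≤ (NN p : ℝ) ^ 2 / 2 * (Real.log R + 0.3219 / w0) ∧ w0 ≤ Real.log q2 := by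
  obtain ⟨f1, f2, f3, f4, f5, f6, f7⟩ := NN_facts hbig
  have hlN := logN_ge hbig
  have hA0 : (0 : ℝ) < A := by linarith
  set z := ⌈√(p : ℝ) / A⌉₊ with hz
  have hz1 : √(p : ℝ) / A ≤ z := Nat.le_ceil _
  have hz2 : (z : ℝ) < √(p : ℝ) / A + 1 := Nat.ceil_lt_add_one (by positivity)
  have hzq : z ≤ q2 := by
    apply Nat.ceil_le.2
    rw [div_le_iff₀ hA0]
    linarith
  have hsA : √(p : ℝ) / 1000 ≤ √(p : ℝ) / A := by gcongr
  have hsA2 : √(p : ℝ) / A ≤ √(p : ℝ) / 39 := by gcongr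
  have hz3 : 300000 ≤ z := by
    have : (300000 : ℝ) ≤ z := by linarith
    exact_mod_cast this
  have hlz : Real.log (NN p) - D ≤ Real.log z := by
    have h1 : Real.log (NN p) - Real.log (16.0001 * A) ≤ Real.log z := by
      rw [← Real.log_div (by linarith) (by positivity)]
      apply Real.log_le_log (by apply div_pos <;> linarith)
      refine le_trans ?_ hz1
      rw [div_le_div_iff₀ (by positivity) hA0]
      nlinarith
    linarith
  have hlz2 : w0 ≤ Real.log z := by linarith
  constructor
  · refine (SS_anti _ hzq).trans ?_
    have := SS_num (NN p) z w0 R 0.0018 (by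
      have : (100000000 : ℝ) ≤ NN p := by linarith
      exact_mod_cast this) hz3 (by linarith) (by norm_num) hw0 hlz2 (by nlinarith)
    refine this.trans ?_
    gcongr
    norm_num
  · refine hlz2.trans (Real.log_le_log (by linarith) (by exact_mod_cast hzq))

lemma log_num_a : Real.log (16.0001 * 650) ≤ 9.251 := by
  have h := log_le_lin (a := 2 ^ 7 * 3 ^ 4) (x := 16.0001 * 650) (by norm_num) (by norm_num)
  rw [Real.log_mul (x := 2 ^ 7) (by norm_num) (by norm_num), Real.log_pow, Real.log_pow] at h
  have := log3_bounds.2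
  have := Real.log_two_lt_d9
  norm_num at h ⊢
  linarith

lemma log_num_b : Real.log (16.0001 * 132) ≤ 7.68 := by
  have h := log_le_lin (a := 2 ^ 11) (x := 16.0001 * 132) (by norm_num) (by norm_num)
  rw [Real.log_pow] at h
  have := Real.log_two_lt_d9
  norm_num at h ⊢
  linarith

lemma log_num_c : Real.log (16.0001 * 39) ≤ 6.442 := by
  have h := log_le_lin (a := 2 ^ 3 * 3 ^ 4) (x := 16.0001 * 39) (by norm_num) (by norm_num)
  rw [Real.log_mul (x := 2 ^ 3) (by norm_num) (by norm_num), Real.log_pow, Real.log_pow] at h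
  have := log3_bounds.2
  have := Real.log_two_lt_d9
  norm_num at h ⊢
  linarith

section
variable {p : ℕ} [hp : Fact p.Prime] {χ : MulChar (ZMod p) ℂ} {q1 q2 : ℕ}

lemma Two.q1_ge (T : Two χ q1 q2) (H : Hno χ) (h3 : χ ^ 3 = 1) (hχ : χ ≠ 1)
    (hbig : 2 * 10 ^ 20 ≤ p) : 50 ≤ q1 := by
  obtain ⟨f1, f2, f3, f4, f5, f6, f7⟩ := NN_facts hbig
  have hNpos : (0 : ℝ) < (NN p : ℝ) ^ 2 / 2 := by
    have : (0 : ℝ) < NN p := by linarith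
    positivity
  by_contra hcon
  push Not at hcon
  have h2le := T.pr1.two_le
  rcases (by omega : q1 = 2 ∨ q1 = 3 ∨ q1 = 4 ∨ 5 ≤ q1) with rfl | rfl | rfl | h5
  · have hlt := T.lt
    rcases (by omega : q2 = 3 ∨ q2 = 4 ∨ 5 ≤ q2) with rfl | rfl | h
    · exact T.regI_a H h3 hχ hbig
    · exact absurd T.pr2 (by norm_num)
    · have hs := T.regI_b H h3 hχ hbig h
      obtain ⟨e1, e2⟩ := excl hbig q2 132 7.68 1.3561 18.46 (by norm_num) (by norm_num) hs log_num_b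
        (by norm_num) (by norm_num) (by norm_num) (by norm_num)
      have h1 := NR_odd_mass hbig h3 hχ
      have h2 := T.nr_odd_le (NN p) (by
        have : (300000 : ℝ) ≤ NN p := by linarith
        exact_mod_cast this)
      have h4 : (0.554 : ℝ) / Real.log q2 ≤ 0.554 / 18.46 := by gcongr
      have h6 : (NN p : ℝ) ^ 2 / 2 * (0.554 / Real.log q2) ≤ (NN p : ℝ) ^ 2 / 2 * (0.554 / 18.46) := by
        gcongr
      have h7 : Real.log 1.3561 ≤ 0.31 := log_le_tay (by norm_num) (by norm_num) (by norm_num)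
      have h8 : (NN p : ℝ) ^ 2 / 2 * (Real.log 1.3561 + 0.3219 / 18.46)
        ≤ (NN p : ℝ) ^ 2 / 2 * (0.31 + 0.3219 / 18.46) := by gcongr
      have h10 := e1.trans h8
      have h11 := h1.trans h2
      linarith
  · have hs := T.regI_c H h3 hχ hbig
    obtain ⟨e1, e2⟩ := excl hbig q2 39 6.442 1.2708 19.7 (by norm_num) (by norm_num) hs log_num_c
        (by norm_num) (by norm_num) (by norm_num) (by norm_num)
    have h1 := NR_mass hbig h3 hχ
    have h2 := T.nr_le (NN p)
    have h7 : Real.log 1.2708 ≤ 0.24 := log_le_tay (by norm_num) (by norm_num) (by norm_num)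
    have h8 : (NN p : ℝ) ^ 2 / 2 * (Real.log 1.2708 + 0.3219 / 19.7)
        ≤ (NN p : ℝ) ^ 2 / 2 * (0.24 + 0.3219 / 19.7) := by gcongr
    have h9 : (NN p : ℝ) ^ 2 / (2 * (3 : ℕ)) = (NN p : ℝ) ^ 2 / 2 * (1 / 3) := by push_cast; ring
    rw [h9] at h2
    have h10 := e1.trans h8
    linarith
  · exact absurd T.pr1 (by norm_num)
  · have hs := T.regI_gen H h3 hχ hbig 5 13 le_rfl (by exact_mod_cast h5) (by norm_num) (by norm_num)
    have hq1R : (q1 : ℝ) ≤ 50 := by exact_mod_cast hcon.le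
    have hq1R' : (5 : ℝ) ≤ q1 := by exact_mod_cast h5
    have hs' : √(p : ℝ) < 650 * q2 := by
      have : (13 : ℝ) * (q1 * q2) ≤ 13 * (50 * q2) := by gcongr
      linarith
    obtain ⟨e1, e2⟩ := excl hbig q2 650 9.251 1.4822 16.893 (by norm_num) (by norm_num) hs' log_num_a
        (by norm_num) (by norm_num) (by norm_num) (by norm_num)
    have h1 := NR_mass hbig h3 hχ
    have h2 := T.nr_le (NN p)
    have h7 : Real.log 1.4822 ≤ 0.395 := log_le_tay (by norm_num) (by norm_num) (by norm_num)
    have h8 : (NN p : ℝ) ^ 2 / 2 * (Real.log 1.4822 + 0.3219 / 16.893)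
        ≤ (NN p : ℝ) ^ 2 / 2 * (0.395 + 0.3219 / 16.893) := by gcongr
    have h9 : (NN p : ℝ) ^ 2 / (2 * q1) ≤ (NN p : ℝ) ^ 2 / (2 * 5) := by gcongr
    have h10 : (NN p : ℝ) ^ 2 / (2 * 5) = (NN p : ℝ) ^ 2 / 2 * (1 / 5) := by ring
    rw [h10] at h9
    have h11 := e1.trans h8
    linarith

lemma Two.regI_e (T : Two χ q1 q2) (H : Hno χ) (h3 : χ ^ 3 = 1) (hχ : χ ≠ 1)
    (hbig : 2 * 10 ^ 20 ≤ p) : √(p : ℝ) < 2.4 * (q1 * q2) :=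
  T.regI_gen H h3 hχ hbig 50 2.4 (by norm_num) (by exact_mod_cast T.q1_ge H h3 hχ hbig) (by norm_num)
    (by norm_num)

end
end CCF

namespace CCF
open Finset

section
variable {p : ℕ} [hp : Fact p.Prime] {χ : MulChar (ZMod p) ℂ} {q1 q2 : ℕ}

lemma Two.log_q2_lt (T : Two χ q1 q2) (h3 : χ ^ 3 = 1) (hχ : χ ≠ 1)
    (hbig : 2 * 10 ^ 20 ≤ p) (θ ε L : ℝ) (hθ : 0.55 ≤ θ) (hθ2 : θ ≤ 0.57) (hε : 1 / (q1 : ℝ) ≤ ε)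
    (hL : Real.log (1 / θ) ≤ L) (hsum : L + 0.3212 / 13.76 + ε < 0.62499) :
    Real.log q2 ≤ θ * (Real.log (NN p) - 1.1085) := by
  obtain ⟨f1, f2, f3, f4, f5, f6, f7⟩ := NN_facts hbig
  have hlN := logN_ge hbig
  have hN0 : (0 : ℝ) < NN p := by linarith
  have hNpos : (0 : ℝ) < (NN p : ℝ) ^ 2 / 2 := by positivity
  by_contra hcon
  push Not at hcon
  set X := θ * (Real.log (NN p) - 1.1085) with hX
  have hX1 : 13.76 ≤ X := by nlinarith
  have hq2 : (0 : ℝ) < q2 := by exact_mod_cast T.pr2.pos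
  set z := ⌈Real.exp X⌉₊ with hz
  have hz1 : Real.exp X ≤ z := Nat.le_ceil _
  have hz2 : (z : ℝ) < Real.exp X + 1 := Nat.ceil_lt_add_one (Real.exp_pos X).le
  have hzq : z ≤ q2 := by
    apply Nat.ceil_le.2
    rw [← Real.exp_log hq2]
    exact Real.exp_le_exp.2 hcon.le
  have hz3 : (300000 : ℝ) ≤ z := by
    refine le_trans ?_ hz1
    rw [← Real.log_le_iff_le_exp (by norm_num)]
    have := log_3e5
    linarith
  have hlz : X ≤ Real.log z := by
    rw [Real.le_log_iff_exp_le (by linarith)]; exact hz1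
  have hex : Real.exp X ≤ 0.001 * NN p := by
    rw [← Real.le_log_iff_exp_le (by positivity), Real.log_mul (by norm_num) hN0.ne']
    have h1 : Real.log (0.001 : ℝ) = - Real.log 1000 := by
      rw [← Real.log_inv]; norm_num
    have h2 : Real.log (1000 : ℝ) ≤ Real.log (2 ^ 10) := Real.log_le_log (by norm_num) (by norm_num)
    rw [Real.log_pow] at h2
    have := Real.log_two_lt_d9
    norm_num at h2
    rw [h1]
    nlinarith
  have h1 := SS_num (NN p) z 13.76 (1 / θ) 0.0011 (by
      have : (100000000 : ℝ) ≤ NN p := by linarith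
      exact_mod_cast this) (by exact_mod_cast hz3) (by linarith) (by norm_num) (by norm_num)
      (by linarith) (by
        rw [div_mul_eq_mul_div, one_mul, le_div_iff₀ (by linarith)]
        linarith)
  have h2 := NR_mass hbig h3 hχ
  have h4 := T.nr_le (NN p)
  have h5 := SS_anti (NN p) hzq
  have h6 : (NN p : ℝ) ^ 2 / (2 * q1) = (NN p : ℝ) ^ 2 / 2 * (1 / q1) := by
    rw [div_mul_div_comm, mul_one]
  rw [h6] at h4
  have h7 : (NN p : ℝ) ^ 2 / 2 * (1 / q1) ≤ (NN p : ℝ) ^ 2 / 2 * ε := by gcongr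
  have h8 : (NN p : ℝ) ^ 2 / 2 * (Real.log (1 / θ) + (0.3199 + 1.108 * 0.0011) / 13.76)
      ≤ (NN p : ℝ) ^ 2 / 2 * (L + 0.3212 / 13.76) := by
    gcongr
    norm_num
  have h9 := mul_lt_mul_of_pos_left hsum hNpos
  rw [mul_add] at h9
  linarith

lemma log_num_d : Real.log (16.0001 * 2.4) ≤ 3.649 := by
  have h : Real.log (16.0001 * 2.4) ≤ Real.log (2 ^ 6 * 3 * 1.0001 / 5) :=
    Real.log_le_log (by norm_num) (by norm_num)
  rw [Real.log_div (by norm_num) (by norm_num), Real.log_mul (x := 2 ^ 6 * 3) (by norm_num) (by norm_num),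
    Real.log_mul (x := 2 ^ 6) (by norm_num) (by norm_num), Real.log_pow] at h
  have := log3_bounds.2
  have := log5_bounds.1
  have := Real.log_two_lt_d9
  have := Real.log_le_sub_one_of_pos (show (0 : ℝ) < 1.0001 by norm_num)
  norm_num at h this ⊢
  linarith

lemma log_num_e : Real.log 6000 ≤ 8.702 := by
  have h := log_le_lin (a := 2 ^ 3 * 3 ^ 6) (x := 6000) (by norm_num) (by norm_num)
  rw [Real.log_mul (x := 2 ^ 3) (by norm_num) (by norm_num), Real.log_pow, Real.log_pow] at h
  have := log3_bounds.2
  have := Real.log_two_lt_d9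
  norm_num at h ⊢
  linarith

lemma log_num_f : Real.log 16.0001 ≤ 2.77264 := by
  have h := log_le_lin (a := 2 ^ 4) (x := 16.0001) (by norm_num) (by norm_num)
  rw [Real.log_pow] at h
  have := Real.log_two_lt_d9
  norm_num at h ⊢
  linarith

lemma Two.log_q1 (T : Two χ q1 q2) (hbig : 2 * 10 ^ 20 ≤ p)
    (hs : √(p : ℝ) < 2.4 * (q1 * q2)) :
    Real.log (NN p) - 3.649 ≤ Real.log q1 + Real.log q2 := by
  obtain ⟨f1, f2, f3, f4, f5, f6, f7⟩ := NN_facts hbig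
  have hq2 : (0 : ℝ) < q2 := by exact_mod_cast T.pr2.pos
  have hq1 : (0 : ℝ) < q1 := by exact_mod_cast T.pr1.pos
  have h : Real.log (NN p) ≤ Real.log (16.0001 * 2.4 * (q1 * q2)) :=
    Real.log_le_log (by linarith) (by linarith)
  rw [Real.log_mul (by norm_num) (by positivity), Real.log_mul hq1.ne' hq2.ne'] at h
  have := log_num_d
  linarith

lemma Two.stage2 (T : Two χ q1 q2) (H : Hno χ) (h3 : χ ^ 3 = 1) (hχ : χ ≠ 1)
    (hbig : 2 * 10 ^ 20 ≤ p) :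
    √(p : ℝ) < 2.4 * (q1 * q2) ∧ (6000 : ℝ) ≤ q1 ∧ (76000 : ℝ) ≤ q2 ∧
      Real.log q2 ≤ 0.55 * (Real.log (NN p) - 1.1085) ∧
      Real.log (NN p) - 3.649 ≤ 2 * Real.log q2 := by
  obtain ⟨f1, f2, f3, f4, f5, f6, f7⟩ := NN_facts hbig
  have hlN := logN_ge hbig
  have hs := T.regI_e H h3 hχ hbig
  have h50 : (50 : ℝ) ≤ q1 := by exact_mod_cast T.q1_ge H h3 hχ hbig
  have hlog := T.log_q1 hbig hs
  have hlt : (q1 : ℝ) < q2 := by exact_mod_cast T.lt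
  have hl12 : Real.log q1 ≤ Real.log q2 := Real.log_le_log (by linarith) hlt.le
  have s1 := T.log_q2_lt h3 hχ hbig 0.561 0.02 0.579 (by norm_num) (by norm_num)
    (by rw [div_le_iff₀ (by linarith)]; linarith)
    (log_le_tay (by norm_num) (by norm_num) (by norm_num)) (by norm_num)
  have hge : ∀ y : ℝ, 0 < y → Real.log y ≤ Real.log q1 → y ≤ q1 := fun y hy h =>
    (Real.log_le_log_iff hy (by linarith)).1 h
  have h4000 : (4000 : ℝ) ≤ q1 := by
    apply hge _ (by norm_num)
    have : Real.log (4000 : ℝ) ≤ Real.log (2 ^ 12) := Real.log_le_log (by norm_num) (by norm_num)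
    rw [Real.log_pow] at this
    have := Real.log_two_lt_d9
    norm_num at *
    linarith
  have s2 := T.log_q2_lt h3 hχ hbig 0.55 0.0003 0.599 (by norm_num) (by norm_num)
    (by rw [div_le_iff₀ (by linarith)]; linarith)
    (log_le_tay (by norm_num) (by norm_num) (by norm_num)) (by norm_num)
  refine ⟨hs, ?_, ?_, s2, by linarith⟩
  · apply hge _ (by norm_num)
    have := log_num_e
    linarith
  · by_contra hc
    push Not at hc
    have : (q1 : ℝ) * q2 ≤ 76000 * 76000 := by
      apply mul_le_mul <;> linarith
    linarith

end
end CCF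

namespace CCF
open Finset

section
variable {p : ℕ} [hp : Fact p.Prime] {χ : MulChar (ZMod p) ℂ} {q1 q2 : ℕ}

lemma Two.b_ne (T : Two χ q1 q2) (h3 : χ ^ 3 = 1) : χ (q2 : ZMod p) ^ 2 ≠ 1 := by
  intro h
  apply T.c2
  have h1 := T.b3 h3
  rw [pow_succ, h, one_mul] at h1
  exact h1

lemma Two.cover (T : Two χ q1 q2) (h3 : χ ^ 3 = 1) (N n : ℕ) (hn : 1 ≤ n) (hnN : n < N)
    (hc : χ (n : ZMod p) = χ (q2 : ZMod p) ^ 2) :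
    q1 ∣ n ∨ (∃ q, q.Prime ∧ q2 ≤ q ∧ q ^ 2 < N ∧ q ∣ n) ∨
      (∃ q, q.Prime ∧ q2 ≤ q ∧ q < N ∧ χ (q : ZMod p) = χ (q2 : ZMod p) ^ 2 ∧ q ∣ n) := by
  by_cases ha : q1 ∣ n
  · exact Or.inl ha
  right
  by_cases hb : ∃ q, q.Prime ∧ q2 ≤ q ∧ q ^ 2 < N ∧ q ∣ n
  · exact Or.inl hb
  right
  push Not at hb
  obtain ⟨q, hq, ⟨m, rfl⟩, hqc⟩ := nonres χ n hn (by rw [hc]; exact T.b_ne h3)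
  have hq2 : q2 ≤ q := by
    rcases T.min q hq hqc with rfl | h
    · exact absurd (Dvd.intro m rfl) ha
    · exact h
  have hm : 1 ≤ m := by
    rcases Nat.eq_zero_or_pos m with rfl | h
    · simp at hn
    · exact h
  have hqN : q < N := lt_of_le_of_lt (Nat.le_mul_of_pos_right q hm) hnN
  refine ⟨q, hq, hq2, hqN, ?_, Dvd.intro m rfl⟩
  have hχm : χ (m : ZMod p) = 1 := by
    by_contra hmc
    obtain ⟨r, hr, hrd, hrc⟩ := nonres χ m hm hmc
    have hr2 : q2 ≤ r := by
      rcases T.min r hr hrc with rfl | h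
      · exact absurd (hrd.mul_left q) ha
      · exact h
    have h1 : N ≤ q ^ 2 := by
      by_contra h
      exact hb q hq hq2 (by omega) (Dvd.intro m rfl)
    have h2 : N ≤ r ^ 2 := by
      by_contra h
      exact hb r hr hr2 (by omega) (hrd.mul_left q)
    have h4 : r ≤ m := Nat.le_of_dvd hm hrd
    have h5 : q * r ≤ q * m := Nat.mul_le_mul_left q h4
    have h6 : N ≤ q * r := by
      by_contra h
      push Not at h
      rcases le_total q r with h7 | h7 <;> nlinarith
    omega
  rw [← hc, Nat.cast_mul, map_mul, hχm, mul_one]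

lemma card_class (s : Finset ℕ) (X m : ℕ) (hX : ∀ a ∈ s, a ≤ X)
    (hs : ∀ a ∈ s, ∀ b ∈ s, a % m = b % m) : s.card ≤ X / m + 1 := by
  rw [← Finset.card_range (X / m + 1)]
  apply Finset.card_le_card_of_injOn (fun a => a / m)
  · intro a ha
    simp only [coe_range, Set.mem_Iio]
    exact Nat.lt_succ_of_le (Nat.div_le_div_right (hX a ha))
  · intro a ha b hb hab
    simp only at hab
    rw [← Nat.div_add_mod a m, ← Nat.div_add_mod b m, hab, hs a ha b hb]

lemma Two.bad_card (T : Two χ q1 q2) (H : Hno χ) (h3 : χ ^ 3 = 1) (hq : p < q2 ^ 5) (B : Finset ℕ)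
    (hB : ∀ π ∈ B, π.Prime ∧ q2 ≤ π ∧ q1 * q2 * π ≤ p ∧ χ (π : ZMod p) = χ (q2 : ZMod p) ^ 2) :
    B.card ≤ 3 * (p / q2 / q1 ^ 3 + 1) := by
  classical
  have hgood : ∀ π ∈ B, ∃ k, 1 ≤ k ∧ k < q1 ∧ (q1 : ℤ) ^ 3 ∣ (p : ℤ) - k * q2 * π := by
    intro π hπ
    obtain ⟨h1, h2, h4, h5⟩ := hB π hπ
    apply T.good H π h1.one_lt.le
    · intro h
      have := (Nat.prime_dvd_prime_iff_eq T.pr1 h1).1 h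
      have := T.lt; omega
    · intro h
      have h6 : q2 ∣ π := (Dvd.intro_left _ (pow_succ q2 1).symm).trans h
      have h7 := (Nat.prime_dvd_prime_iff_eq T.pr2 h1).1 h6
      subst h7
      have := Nat.le_of_dvd h1.pos h
      have := T.pr2.two_le
      nlinarith
    · rw [h5, ← pow_succ]; exact T.b3 h3
    · exact h4
  choose! k hk using hgood
  have hbound : ∀ π ∈ B, k π * π ≤ p / q2 := by
    intro π hπ
    obtain ⟨h1, h2, h4, h5⟩ := hB π hπ
    rw [Nat.le_div_iff_mul_le T.pr2.pos]
    refine le_trans ?_ h4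
    calc k π * π * q2 ≤ q1 * π * q2 := by gcongr; exact (hk π hπ).2.1.le
      _ = q1 * q2 * π := by ring
  have h1 := Finset.card_le_mul_card_image (f := fun π => k π * π) B 3 (by
    intro s hs
    rw [Finset.mem_image] at hs
    obtain ⟨π0, hπ0, rfl⟩ := hs
    by_contra hcon
    push Not at hcon
    set F := B.filter (fun π => k π * π = k π0 * π0) with hF
    have hFB : ∀ π ∈ F, π ∈ B ∧ k π * π = k π0 * π0 := fun π h => by
      rw [hF, mem_filter] at h; exact h
    have hdvd : ∏ π ∈ F, π ∣ k π0 * π0 := by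
      apply Finset.prod_primes_dvd
      · intro π hπ
        exact (hB π (hFB π hπ).1).1.prime
      · intro π hπ
        rw [← (hFB π hπ).2]
        exact Dvd.intro_left _ rfl
    have hpos : 0 < k π0 * π0 := Nat.mul_pos (hk π0 hπ0).1 (hB π0 hπ0).1.pos
    have hle := Nat.le_of_dvd hpos hdvd
    have hpow : q2 ^ F.card ≤ ∏ π ∈ F, π :=
      Finset.pow_card_le_prod _ _ _ (fun π hπ => (hB π (hFB π hπ).1).2.1)
    have h4 : q2 ^ 4 ≤ q2 ^ F.card := Nat.pow_le_pow_right T.pr2.pos hcon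
    have h5 := hbound π0 hπ0
    have h6 : q2 ^ 4 ≤ p / q2 := by omega
    rw [Nat.le_div_iff_mul_le T.pr2.pos, ← pow_succ] at h6
    exact absurd hq (not_lt.2 h6))
  refine h1.trans (Nat.mul_le_mul_left 3 ?_)
  apply card_class
  · intro a ha
    rw [Finset.mem_image] at ha
    obtain ⟨π, hπ, rfl⟩ := ha
    exact hbound π hπ
  · intro a ha b hb
    rw [Finset.mem_image] at ha hb
    obtain ⟨π, hπ, rfl⟩ := ha
    obtain ⟨π', hπ', rfl⟩ := hb
    apply mod_unique (p := p) (c := q2) T.pr1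
    · intro h
      have := (Nat.prime_dvd_prime_iff_eq T.pr1 T.pr2).1 h
      have := T.lt; omega
    · have := (hk π hπ).2.2
      push_cast
      rwa [show (q2 : ℤ) * (k π * π) = k π * q2 * π by ring]
    · have := (hk π' hπ').2.2
      push_cast
      rwa [show (q2 : ℤ) * (k π' * π') = k π' * q2 * π' by ring]

lemma sum_A (N : ℕ) (hN : 100000000000 ≤ N) (q2 : ℕ) (hq : 76000 ≤ q2) (hqN : q2 ^ 2 < N)
    (A : Finset ℕ) (hA : ∀ q ∈ A, q.Prime ∧ q2 ≤ q ∧ q ^ 2 < N) :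
    ∑ q ∈ A, TT N (q ∣ ·) ≤ (N : ℝ) ^ 2 / 2 *
      ((Real.log N / 2 - Real.log q2 + 0.6083) / Real.log q2) := by
  have hqR : (76000 : ℝ) ≤ q2 := by exact_mod_cast hq
  have hv : 0 < Real.log q2 := Real.log_pos (by linarith)
  set R := Nat.sqrt N with hR
  have hqR2 : q2 ≤ R := by
    rw [hR, Nat.le_sqrt']; exact hqN.le
  have hR3 : 300000 ≤ R := by
    rw [hR, Nat.le_sqrt']; omega
  have hsub : A ⊆ Icc q2 R := by
    intro q hq
    obtain ⟨-, h1, h2⟩ := hA q hq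
    rw [mem_Icc]
    exact ⟨h1, by rw [hR, Nat.le_sqrt']; exact h2.le⟩
  have h1 : ∀ q ∈ A, TT N (q ∣ ·) ≤ (N : ℝ) ^ 2 / 2 / Real.log q2 * (Lam q / q) := by
    intro q hq
    obtain ⟨h0, h1, h2⟩ := hA q hq
    have hqpos : (0 : ℝ) < q := by exact_mod_cast h0.pos
    refine (TT_dvd_le N q h0.one_lt.le).trans ?_
    rw [Lam_prime h0]
    have hlog : Real.log q2 ≤ Real.log q := Real.log_le_log (by linarith) (by exact_mod_cast h1)
    have : (N : ℝ) ^ 2 / 2 / Real.log q2 * (Real.log q / q)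
        = (N : ℝ) ^ 2 / (2 * q) * (Real.log q / Real.log q2) := by field_simp
    rw [this]
    have h4 : 1 ≤ Real.log q / Real.log q2 := by rw [one_le_div hv]; exact hlog
    exact le_mul_of_one_le_right (by positivity) h4
  refine (Finset.sum_le_sum h1).trans ?_
  rw [← Finset.mul_sum]
  have h2 : ∑ q ∈ A, Lam q / q ≤ ∑ q ∈ Icc q2 R, Lam q / q := by
    apply Finset.sum_le_sum_of_subset_of_nonneg hsub
    intro q _ _
    exact div_nonneg (Lam_nonneg q) (by positivity)
  have h4 : MM R = MM (q2 - 1) + ∑ q ∈ Icc q2 R, Lam q / q := by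
    rw [MM, MM]
    have e1 : Icc 1 R = Ico 1 (R + 1) := by ext; rw [mem_Icc, mem_Ico]; omega
    have e2 : Icc 1 (q2 - 1) = Ico 1 q2 := by ext; rw [mem_Icc, mem_Ico]; omega
    have e3 : Icc q2 R = Ico q2 (R + 1) := by ext; rw [mem_Icc, mem_Ico]; omega
    rw [e1, e2, e3, Finset.sum_Ico_consecutive _ (by omega) (by omega)]
  have h5 := MM_upper R hR3
  have h6 := MM_lower_triv (q2 - 1) (by omega)
  have hc : ((q2 - 1 : ℕ) : ℝ) = q2 - 1 := by rw [Nat.cast_sub (by omega)]; simp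
  rw [hc] at h6
  have h7 := log_le_lin (a := (q2 : ℝ) - 1) (x := q2) (by linarith) (by linarith)
  have h8 : (q2 : ℝ) / (q2 - 1) ≤ 1.0001 := by
    rw [div_le_iff₀ (by linarith)]; linarith
  have h9 : Real.log R ≤ Real.log N / 2 := by
    have hRpos : (0 : ℝ) < R := by
      have : 0 < R := by omega
      exact_mod_cast this
    have : Real.log ((R : ℝ) ^ 2) ≤ Real.log N := by
      apply Real.log_le_log (by positivity)
      exact_mod_cast Nat.sqrt_le' N
    rw [Real.log_pow] at this
    push_cast at this
    linarith
  have h10 : ∑ q ∈ A, Lam q / q ≤ Real.log N / 2 - Real.log q2 + 0.6083 := by linarith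
  calc (N : ℝ) ^ 2 / 2 / Real.log q2 * ∑ q ∈ A, Lam q / q
      ≤ (N : ℝ) ^ 2 / 2 / Real.log q2 * (Real.log N / 2 - Real.log q2 + 0.6083) := by gcongr
    _ = _ := by ring

end
end CCF

namespace CCF
open Finset

section
variable {p : ℕ} [hp : Fact p.Prime] {χ : MulChar (ZMod p) ℂ} {q1 q2 : ℕ}

lemma Two.total (T : Two χ q1 q2) (H : Hno χ) (h3 : χ ^ 3 = 1) (hχ : χ ≠ 1)
    (hbig : 2 * 10 ^ 20 ≤ p) (a : ℝ)
    (ha : ∀ A : Finset ℕ, (∀ q ∈ A, q.Prime ∧ q2 ≤ q ∧ q ^ 2 < NN p) →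
      ∑ q ∈ A, TT (NN p) (q ∣ ·) ≤ (NN p : ℝ) ^ 2 / 2 * a) :
    (NN p : ℝ) ^ 2 / 2 * (0.28857 - a) ≤ SS (NN p) (p / q2 ^ 2 + 1) := by
  classical
  obtain ⟨f1, f2, f3, f4, f5, f6, f7⟩ := NN_facts hbig
  obtain ⟨s1, s2, s3, s4, s5⟩ := T.stage2 H h3 hχ hbig
  have hN0 : (0 : ℝ) < NN p := by linarith
  have hNpos : (0 : ℝ) < (NN p : ℝ) ^ 2 / 2 := by positivity
  set N := NN p with hN
  have hb : (χ (q2 : ZMod p) ^ 2) ^ 3 = 1 := by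
    rw [← pow_mul, mul_comm, pow_mul, T.b3 h3, one_pow]
  have hmass := class_mass χ h3 hχ (χ (q2 : ZMod p) ^ 2) hb N f6
  rw [abs_le] at hmass
  have hm1 : (N : ℝ) ^ 2 / 2 * 0.29166 ≤ TT N (fun n => χ (n : ZMod p) = χ (q2 : ZMod p) ^ 2) := by
    have h4 : (N : ℝ) * √p / 3 ≤ N * N / 48 := by nlinarith
    nlinarith [hmass.1]
  set A := (Ico q2 N).filter (fun q : ℕ => q.Prime ∧ q ^ 2 < N) with hA
  set C := (Ico q2 N).filter (fun q : ℕ => q.Prime ∧ χ (q : ZMod p) = χ (q2 : ZMod p) ^ 2 ∧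
    q1 * q2 * q ≤ p) with hC
  set D := (Ico q2 N).filter (fun q : ℕ => q.Prime ∧ ¬ q1 * q2 * q ≤ p) with hD
  have hcov : TT N (fun n => χ (n : ZMod p) = χ (q2 : ZMod p) ^ 2) ≤
      TT N (q1 ∣ ·) + (∑ q ∈ A, TT N (q ∣ ·) + (∑ q ∈ C, TT N (q ∣ ·) + ∑ q ∈ D, TT N (q ∣ ·))) := by
    refine (TT_mono (Q := fun n => q1 ∣ n ∨ ((∃ q ∈ A, q ∣ n) ∨ ((∃ q ∈ C, q ∣ n) ∨
      (∃ q ∈ D, q ∣ n)))) ?_).trans ?_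
    · intro n h1 h2 h
      rcases T.cover h3 N n h1 h2 h with h | ⟨q, a1, a2, a3, a4⟩ | ⟨q, a1, a2, a3, a4, a5⟩
      · exact Or.inl h
      · right; left
        refine ⟨q, ?_, a4⟩
        rw [hA, mem_filter, mem_Ico]
        exact ⟨⟨a2, (Nat.le_of_dvd h1 a4).trans_lt h2⟩, a1, a3⟩
      · right; right
        by_cases hle : q1 * q2 * q ≤ p
        · left
          refine ⟨q, ?_, a5⟩
          rw [hC, mem_filter, mem_Ico]
          exact ⟨⟨a2, a3⟩, a1, a4, hle⟩
        · right
          refine ⟨q, ?_, a5⟩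
          rw [hD, mem_filter, mem_Ico]
          exact ⟨⟨a2, a3⟩, a1, hle⟩
    · refine (TT_or _ _ _).trans (add_le_add_right ?_ _)
      refine (TT_or _ _ _).trans (add_le_add (TT_bUnion _ _ _) ?_)
      exact (TT_or _ _ _).trans (add_le_add (TT_bUnion _ _ _) (TT_bUnion _ _ _))
  have h1 : TT N (q1 ∣ ·) ≤ (N : ℝ) ^ 2 / 2 * 0.00017 := by
    refine (TT_dvd_le N q1 T.pr1.one_lt.le).trans ?_
    rw [← div_div, div_eq_mul_inv]
    gcongr
    rw [inv_le_comm₀ (by linarith) (by norm_num)]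
    norm_num; linarith
  have h2 := ha A (by
    intro q hq
    rw [hA, mem_filter, mem_Ico] at hq
    exact ⟨hq.2.1, hq.1.1, hq.2.2⟩)
  have h4 : ∑ q ∈ D, TT N (q ∣ ·) ≤ SS N (p / q2 ^ 2 + 1) := by
    apply prime_sum_le_SS
    · have : 0 < p / q2 ^ 2 := by
        apply Nat.div_pos _ (Nat.pos_of_ne_zero (pow_ne_zero 2 T.pr2.ne_zero))
        have h6 : (q2 : ℝ) ^ 2 ≤ p := by
          have e1 : Real.log ((q2 : ℝ) ^ 2) ≤ Real.log p := by
            rw [Real.log_pow, ← f2, Real.log_mul (by linarith) (by linarith)]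
            have : Real.log N ≤ Real.log (16.0001 * √p) := Real.log_le_log hN0 (by linarith)
            rw [Real.log_mul (by norm_num) (by linarith)] at this
            have := log_num_f
            have := logN_ge hbig
            push_cast
            linarith
          exact (Real.log_le_log_iff (by positivity) (by nlinarith)).1 e1
        exact_mod_cast h6
      omega
    · intro q hq
      rw [hD, mem_filter, mem_Ico] at hq
      refine ⟨hq.2.1, ?_, hq.1.2⟩
      have h5 := hq.2.2
      push Not at h5
      apply Nat.succ_le_of_lt
      rw [Nat.div_lt_iff_lt_mul (Nat.pos_of_ne_zero (pow_ne_zero 2 T.pr2.ne_zero))]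
      refine h5.trans_le ?_
      have := T.lt
      calc q1 * q2 * q ≤ q2 * q2 * q := by gcongr
        _ = q * q2 ^ 2 := by ring
  have h5 : ∑ q ∈ C, TT N (q ∣ ·) ≤ (N : ℝ) ^ 2 / 2 * 0.00292 := by
    have hp5 : p < q2 ^ 5 := by
      have e1 : √(p : ℝ) < 2.4 * (q2 * q2) := by
        refine s1.trans_le ?_
        have : (q1 : ℝ) ≤ q2 := by exact_mod_cast T.lt.le
        gcongr
      have e2 : (p : ℝ) < (2.4 * (q2 * q2)) * (2.4 * (q2 * q2)) := by
        rw [← f2]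
        exact mul_lt_mul'' e1 e1 (by positivity) (by positivity)
      have e3 : (p : ℝ) < (q2 : ℝ) ^ 5 := by
        refine e2.trans_le ?_
        have : (2.4 * (q2 * q2)) * (2.4 * (q2 * q2)) = 5.76 * (q2 : ℝ) ^ 4 := by ring
        rw [this, show (q2 : ℝ) ^ 5 = q2 * q2 ^ 4 by ring]
        gcongr
        linarith
      exact_mod_cast e3
    have hcard := T.bad_card H h3 hp5 C (by
      intro π hπ
      rw [hC, mem_filter, mem_Ico] at hπ
      exact ⟨hπ.2.1, hπ.1.1, hπ.2.2.2, hπ.2.2.1⟩)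
    have hq2R : (0 : ℝ) < q2 := by linarith
    have hq1R : (0 : ℝ) < q1 := by linarith
    have hcR : (C.card : ℝ) ≤ 3 * (p / q2 / (q1 : ℝ) ^ 3 + 1) := by
      have e1 : (C.card : ℝ) ≤ 3 * (((p / q2 / q1 ^ 3 : ℕ) : ℝ) + 1) := by exact_mod_cast hcard
      have e2 : ((p / q2 / q1 ^ 3 : ℕ) : ℝ) ≤ p / q2 / (q1 : ℝ) ^ 3 := by
        refine Nat.cast_div_le.trans ?_
        push_cast
        gcongr
        exact Nat.cast_div_le
      linarith
    have hterm : ∀ q ∈ C, TT N (q ∣ ·) ≤ (N : ℝ) ^ 2 / 2 * (1 / q2) := by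
      intro q hq
      rw [hC, mem_filter, mem_Ico] at hq
      refine (TT_dvd_le N q hq.2.1.one_lt.le).trans ?_
      rw [← div_div, div_eq_mul_one_div]
      have : (q2 : ℝ) ≤ q := by exact_mod_cast hq.1.1
      gcongr
    refine (Finset.sum_le_card_nsmul _ _ _ hterm).trans ?_
    rw [nsmul_eq_mul]
    have e5 : (C.card : ℝ) * (1 / q2) ≤ 0.00292 := by
      have e6 : (C.card : ℝ) * (1 / q2) ≤ 3 * (p / q2 / (q1 : ℝ) ^ 3 + 1) * (1 / q2) := by gcongr
      refine e6.trans ?_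
      have e7 : (p : ℝ) ≤ 5.76 * (q1 * q2) ^ 2 := by
        rw [← f2]
        have := mul_self_le_mul_self (Real.sqrt_nonneg p) s1.le
        linarith
      have e8 : (p : ℝ) / q2 / (q1 : ℝ) ^ 3 * (1 / q2) ≤ 5.76 / q1 := by
        rw [div_div, div_mul_div_comm, div_le_div_iff₀ (by positivity) hq1R]
        nlinarith
      have e9 : (5.76 : ℝ) / q1 ≤ 5.76 / 6000 := by gcongr
      have e10 : (1 : ℝ) / q2 ≤ 1 / 76000 := by gcongr
      have : 3 * (p / q2 / (q1 : ℝ) ^ 3 + 1) * (1 / q2)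
        = 3 * (p / q2 / (q1 : ℝ) ^ 3 * (1 / q2)) + 3 * (1 / q2) := by ring
      rw [this]
      norm_num at e9 e10 ⊢
      norm_num at e8
      linarith
    calc (C.card : ℝ) * ((N : ℝ) ^ 2 / 2 * (1 / q2)) = (N : ℝ) ^ 2 / 2 * (C.card * (1 / q2)) := by ring
      _ ≤ _ := by gcongr
  linarith

lemma log_R (u : ℝ) (h0 : 0 ≤ u) (h1 : u ≤ 3.649) :
    Real.log (25.0355 / (20.5987 + u)) ≤ 0.198 - 0.0447 * u := by
  apply log_le_tay (by positivity) (by linarith)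
  rw [div_le_iff₀ (by linarith)]
  set c := 0.198 - 0.0447 * u with hc
  have hc0 : 0 ≤ c := by rw [hc]; linarith
  have e : (1 + c + c ^ 2 / 2) * (20.5987 + u) ≤
      (1 + c + c ^ 2 / 2 + c ^ 3 / 6 + c ^ 4 / 24) * (20.5987 + u) := by
    apply mul_le_mul_of_nonneg_right _ (by linarith)
    have : 0 ≤ c ^ 3 / 6 := by positivity
    have : 0 ≤ c ^ 4 / 24 := by positivity
    linarith
  refine le_trans ?_ e
  rw [hc]
  nlinarith [mul_nonneg h0 (sub_nonneg.2 h1), mul_nonneg (mul_nonneg h0 h0) (sub_nonneg.2 h1)]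

lemma aux_h9 (u v : ℝ) (h0 : 0 ≤ u) (h1 : u ≤ 3.649)
    (e3 : (0.0466 + 0.0466 * u) * ((26.144 - u) / 2) ≤ v) : u / 2 + 0.6083 ≤ v := by
  nlinarith [mul_nonneg h0 (sub_nonneg.2 h1)]

lemma aux_hRR (x u w : ℝ) (hx : 26.144 ≤ x) (h1 : u ≤ 3.649) (hw : x - 5.5453 + u ≤ w) :
    (x - 1.1085) * (20.5987 + u) ≤ 25.0355 * w := by
  nlinarith [mul_nonneg (sub_nonneg.2 hx) (sub_nonneg.2 h1)]

set_option maxHeartbeats 400000 in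
lemma no_Hno (h3 : χ ^ 3 = 1) (hχ : χ ≠ 1) (hbig : 2 * 10 ^ 20 ≤ p) : ¬ Hno χ := by
  intro H
  obtain ⟨q1, q2, T⟩ := exists_two hbig h3 hχ
  obtain ⟨f1, f2, f3, f4, f5, f6, f7⟩ := NN_facts hbig
  obtain ⟨s1, s2, s3, s4, s5⟩ := T.stage2 H h3 hχ hbig
  have hlN := logN_ge hbig
  have hN0 : (0 : ℝ) < NN p := by linarith
  have hNpos : (0 : ℝ) < (NN p : ℝ) ^ 2 / 2 := by positivity
  have hq2R : (0 : ℝ) < q2 := by linarith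
  have hp0 : (0 : ℝ) < p := by nlinarith
  set z := p / q2 ^ 2 + 1 with hz
  have hz1 : (p : ℝ) / (q2 : ℝ) ^ 2 ≤ z := by
    rw [div_le_iff₀ (by positivity)]
    have := Nat.lt_mul_div_succ p (b := q2 ^ 2) (Nat.pos_of_ne_zero (pow_ne_zero 2 T.pr2.ne_zero))
    have h2 : (p : ℝ) < (q2 : ℝ) ^ 2 * ((p / q2 ^ 2 : ℕ) + 1) := by exact_mod_cast this
    rw [hz]; push_cast; linarith
  have hz2 : (z : ℝ) ≤ (p : ℝ) / (q2 : ℝ) ^ 2 + 1 := by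
    rw [hz]; push_cast
    have := @Nat.cast_div_le ℝ _ _ _ p (q2 ^ 2)
    push_cast at this
    linarith
  have hlz : 2 * Real.log (NN p) - 5.5453 - 2 * Real.log q2 ≤ Real.log z := by
    have h1 : Real.log (p / (q2 : ℝ) ^ 2) ≤ Real.log z := Real.log_le_log (by positivity) hz1
    rw [Real.log_div hp0.ne' (by positivity), Real.log_pow, ← f2,
      Real.log_mul (by linarith) (by linarith)] at h1
    have h2 : Real.log (NN p) ≤ Real.log (16.0001 * √p) := Real.log_le_log hN0 (by linarith)
    rw [Real.log_mul (by norm_num) (by linarith)] at h2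
    have := log_num_f
    push_cast at h1
    linarith
  have hz0 : (0 : ℝ) < z := by rw [hz]; positivity
  have hz3 : 300000 ≤ z := by
    have : (300000 : ℝ) ≤ z := by
      rw [← Real.log_le_log_iff (by norm_num) hz0]
      have := log_3e5
      linarith
    exact_mod_cast this
  have hN8 : 100000000 ≤ NN p := by
    have : (100000000 : ℝ) ≤ NN p := by linarith
    exact_mod_cast this
  by_cases hcase : NN p ≤ q2 ^ 2
  · have htot := T.total H h3 hχ hbig 0 (by
      intro A hA
      have : A = ∅ := by
        rw [Finset.eq_empty_iff_forall_notMem]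
        intro q hq
        obtain ⟨-, a1, a2⟩ := hA q hq
        have := Nat.pow_le_pow_left a1 2
        omega
      simp [this])
    have hzδ : (z : ℝ) ≤ 0.004 * NN p := by
      have h1 : (NN p : ℝ) ≤ (q2 : ℝ) ^ 2 := by exact_mod_cast hcase
      have h2 : (p : ℝ) / (q2 : ℝ) ^ 2 ≤ p / NN p := by gcongr
      have h4 : (p : ℝ) / NN p ≤ NN p / 256 := by
        rw [div_le_iff₀ hN0]
        clear hN8 hz3
        nlinarith
      linarith
    have hS := SS_num (NN p) z 19.2 1.304 0.004 hN8 hz3 hzδ (by norm_num) (by norm_num)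
      (by linarith) (by linarith)
    have h7 : Real.log 1.304 ≤ 0.266 := log_le_tay (by norm_num) (by norm_num) (by norm_num)
    have h8 : (NN p : ℝ) ^ 2 / 2 * (Real.log 1.304 + (0.3199 + 1.108 * 0.004) / 19.2)
        ≤ (NN p : ℝ) ^ 2 / 2 * 0.283 := by
      gcongr
      norm_num at h7 ⊢
      linarith
    linarith
  · push Not at hcase
    have hq76 : 76000 ≤ q2 := by exact_mod_cast s3
    have hN11 : 100000000000 ≤ NN p := by
      have : (100000000000 : ℝ) ≤ NN p := by linarith
      exact_mod_cast this
    have htot := T.total H h3 hχ hbig _ (fun A hA => sum_A (NN p) hN11 q2 hq76 hcase A hA)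
    have hv : 0 < Real.log q2 := Real.log_pos (by linarith)
    set u := Real.log (NN p) - 2 * Real.log q2 with hu
    have hu1 : u ≤ 3.649 := by linarith
    have hu0 : 0 ≤ u := by
      have h1 : Real.log ((q2 : ℝ) ^ 2) ≤ Real.log (NN p) :=
        Real.log_le_log (by positivity) (by exact_mod_cast hcase.le)
      rw [Real.log_pow] at h1
      push_cast at h1
      linarith
    have hzδ : (z : ℝ) ≤ 0.1501 * NN p := by
      have e1 : √(p : ℝ) ≤ 2.4 * (q2 : ℝ) ^ 2 := by
        refine s1.le.trans ?_
        have : (q1 : ℝ) ≤ q2 := by exact_mod_cast T.lt.le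
        rw [pow_two]
        gcongr
      have h2 : (p : ℝ) / (q2 : ℝ) ^ 2 ≤ 2.4 * √p := by
        rw [div_le_iff₀ (by positivity)]
        clear hN8 hz3 hN11
        nlinarith
      linarith
    have hw : 20.5987 + u ≤ Real.log z := by linarith
    have hRR : Real.log (NN p) - 1.1085 ≤ 25.0355 / (20.5987 + u) * Real.log z := by
      rw [div_mul_eq_mul_div, le_div_iff₀ (by linarith)]
      have hlz2 : Real.log (NN p) - 5.5453 + u ≤ Real.log z := by linarith
      exact aux_hRR _ _ _ (by linarith) hu1 hlz2
    have hS := SS_num (NN p) z (20.5987 + u) (25.0355 / (20.5987 + u)) 0.1501 hN8 hz3 hzδ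
      (by norm_num) (by linarith) hw hRR
    have h7 := log_R u hu0 hu1
    have h8 : (0.3199 + 1.108 * 0.1501) / (20.5987 + u) ≤ 0.0237 := by
      rw [div_le_iff₀ (by linarith)]
      linarith
    have h9 : (Real.log (NN p) / 2 - Real.log q2 + 0.6083) / Real.log q2 ≤ 0.0466 + 0.0466 * u := by
      rw [div_le_iff₀ hv]
      have e1 : Real.log q2 ≥ (26.144 - u) / 2 := by linarith
      have e2 : Real.log (NN p) / 2 - Real.log q2 = u / 2 := by linarith
      rw [e2]
      have e3 : (0.0466 + 0.0466 * u) * ((26.144 - u) / 2) ≤ (0.0466 + 0.0466 * u) * Real.log q2 := by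
        gcongr
      exact aux_h9 _ _ hu0 hu1 e3
    have h10 : (NN p : ℝ) ^ 2 / 2 * (Real.log (25.0355 / (20.5987 + u)) +
        (0.3199 + 1.108 * 0.1501) / (20.5987 + u)) ≤
        (NN p : ℝ) ^ 2 / 2 * (0.198 - 0.0447 * u + 0.0237) := by
      exact mul_le_mul_of_nonneg_left (add_le_add h7 h8) hNpos.le
    have h11 := (htot.trans hS).trans h10
    have h12 := le_of_mul_le_mul_left h11 hNpos
    linarith

end
end CCF

set_option linter.unusedSectionVars false
namespace CCF

section
variable {R : Type*} [CommRing R] [IsDomain R] [CharZero R]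

/-- A domain with an automorphism of order dividing three whose fixed ring is `ℤ`. -/
structure Cub (σ : R ≃+* R) : Prop where
  three : ∀ x, σ (σ (σ x)) = x
  fix : ∀ x, σ x = x → ∃ n : ℤ, x = n

/-- The norm form. -/
def nm (σ : R ≃+* R) (x : R) : R := x * σ x * σ (σ x)

/-- A totally ramified principal prime. -/
structure Ram (p : ℕ) (π : R) : Prop where
  pp : p.Prime
  pr : Prime π
  cube : Associated (π ^ 3) (p : R)
  res : ∀ x : R, ∃ n : ℤ, π ∣ x - n

lemma nm_mul (σ : R ≃+* R) (x y : R) : nm σ (x * y) = nm σ x * nm σ y := by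
  simp only [nm, map_mul]; ring

lemma nm_pow (σ : R ≃+* R) (x : R) (k : ℕ) : nm σ (x ^ k) = nm σ x ^ k := by
  simp only [nm, map_pow]; ring

lemma nm_intCast (σ : R ≃+* R) (n : ℤ) : nm σ (n : R) = (n : R) ^ 3 := by
  simp only [nm, map_intCast]; ring

variable {σ : R ≃+* R}

lemma Cub.nm_sigma (h : Cub σ) (x : R) : nm σ (σ x) = nm σ x := by
  simp only [nm, h.three]; ring

lemma Cub.nm_int (h : Cub σ) (x : R) : ∃ n : ℤ, nm σ x = n := by
  apply h.fix
  simp only [nm, map_mul, h.three]; ring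

lemma nm_ne_zero {x : R} (hx : x ≠ 0) : nm σ x ≠ 0 := by
  simp [nm, hx]

lemma dvd_nm (x : R) : x ∣ nm σ x := ⟨σ x * σ (σ x), by simp only [nm]; ring⟩

lemma int_dvd_of_dvd (h : Cub σ) {a b : ℤ} (hab : (a : R) ∣ (b : R)) : a ∣ b := by
  by_cases ha : a = 0
  · subst ha
    simp only [Int.cast_zero, zero_dvd_iff] at hab
    have : b = 0 := by exact_mod_cast hab
    simp [this]
  obtain ⟨c, hc⟩ := hab
  have haR : (a : R) ≠ 0 := by exact_mod_cast ha
  obtain ⟨n, hn⟩ := h.fix c (by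
    apply mul_left_cancel₀ haR
    rw [← hc]
    have := congrArg σ hc
    rw [map_mul, map_intCast, map_intCast] at this
    exact this.symm)
  refine ⟨n, ?_⟩
  rw [hn] at hc
  exact_mod_cast hc

variable {p : ℕ} {π : R}

lemma Ram.dvd_int (h : Ram p π) {n : ℤ} (hn : π ∣ (n : R)) : (p : ℤ) ∣ n := by
  by_contra hc
  have hcop : IsCoprime (p : ℤ) n :=
    ((Nat.prime_iff_prime_int.1 h.pp).coprime_iff_not_dvd).2 hc
  obtain ⟨a, b, hab⟩ := hcop
  have hp : π ∣ (p : R) := (dvd_pow_self π (by norm_num)).trans h.cube.dvd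
  have : π ∣ 1 := by
    have e : (1 : R) = a * (p : R) + b * (n : R) := by exact_mod_cast hab.symm
    rw [e]
    exact dvd_add (hp.mul_left _) (hn.mul_left _)
  exact h.pr.not_isUnit (isUnit_of_dvd_one this)

lemma Ram.cube_dvd_int (h : Ram p π) {n : ℤ} (hn : (p : ℤ) ∣ n) : π ^ 3 ∣ (n : R) := by
  obtain ⟨m, rfl⟩ := hn
  push_cast
  exact h.cube.dvd.mul_right _

lemma Ram.int_val (h : Ram p π) {n : ℤ} (hn : n ≠ 0) :
    ∃ (k : ℕ) (m : R), (n : R) = π ^ (3 * k) * m ∧ ¬ π ∣ m := by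
  have hfin : FiniteMultiplicity (p : ℤ) n := by
    rw [Int.finiteMultiplicity_iff]
    exact ⟨by simpa using h.pp.one_lt.ne', hn⟩
  obtain ⟨m, hm, hm2⟩ := hfin.exists_eq_pow_mul_and_not_dvd
  obtain ⟨u, hu⟩ := h.cube
  refine ⟨multiplicity (p : ℤ) n, (u : R) ^ multiplicity (p : ℤ) n * m, ?_, ?_⟩
  · conv_lhs => rw [hm]
    push_cast
    rw [← hu]; ring
  · intro hd
    rcases h.pr.dvd_or_dvd hd with h1 | h1
    · exact h.pr.not_isUnit (isUnit_of_dvd_unit h1 (u.isUnit.pow _))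
    · exact hm2 (h.dvd_int h1)

lemma prime_pow_inj (h : Prime π) {i j : ℕ} {x y : R} (hx : ¬ π ∣ x) (hy : ¬ π ∣ y)
    (e : π ^ i * x = π ^ j * y) : i = j := by
  wlog hij : i ≤ j generalizing i j x y
  · exact (this hy hx e.symm (by omega)).symm
  by_contra hne
  obtain ⟨k, rfl⟩ := Nat.exists_eq_add_of_le hij
  apply hx
  rw [pow_add, mul_assoc] at e
  rw [mul_left_cancel₀ (pow_ne_zero _ h.ne_zero) e]
  exact (dvd_pow_self π (by omega)).mul_right _

lemma Ram.val_eq (h : Ram p π) (hc : Cub σ) {a b : ℕ} (ha : a < 3) (hb : b < 3) {x y : R}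
    (hx : ¬ π ∣ x) (hy : ¬ π ∣ y)
    (e : σ (π ^ a * x) * (π ^ b * y) = π ^ a * x * σ (π ^ b * y)) : a = b := by
  set X := π ^ a * x with hX
  set Y := π ^ b * y with hY
  have hx0 : x ≠ 0 := by rintro rfl; simp at hx
  have hy0 : y ≠ 0 := by rintro rfl; simp at hy
  have hX0 : X ≠ 0 := mul_ne_zero (pow_ne_zero _ h.pr.ne_zero) hx0
  have hY0 : Y ≠ 0 := mul_ne_zero (pow_ne_zero _ h.pr.ne_zero) hy0
  obtain ⟨n, hn⟩ := hc.fix (X * σ Y * σ (σ Y)) (by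
    simp only [map_mul, hc.three]
    linear_combination (σ (σ Y)) * e)
  obtain ⟨m, hm⟩ := hc.nm_int Y
  have hn0 : n ≠ 0 := by
    rintro rfl
    have : X * σ Y * σ (σ Y) ≠ 0 := by simp [hX0, hY0]
    exact this (by rw [hn]; simp)
  have hm0 : m ≠ 0 := by
    rintro rfl
    exact nm_ne_zero (σ := σ) hY0 (by rw [hm]; simp)
  have key : X * m = n * Y := by
    rw [← hm, ← hn, nm]; ring
  obtain ⟨k, m', e1, hm'⟩ := h.int_val hm0
  obtain ⟨l, n', e2, hn'⟩ := h.int_val hn0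
  have : π ^ (a + 3 * k) * (x * m') = π ^ (b + 3 * l) * (y * n') := by
    rw [e1, e2, hX, hY] at key
    rw [pow_add, pow_add]
    linear_combination key
  have := prime_pow_inj h.pr (by rw [h.pr.dvd_mul]; tauto) (by rw [h.pr.dvd_mul]; tauto) this
  omega

lemma Ram.sigma_assoc (h : Ram p π) : Associated (σ π) π := by
  have hs : Prime (σ π) := (MulEquiv.prime_iff σ.toMulEquiv).2 h.pr
  have h1 : Associated ((σ π) ^ 3) (p : R) := by
    have := h.cube.map σ
    simpa using this
  have h2 : Associated ((σ π) ^ 3) (π ^ 3) := h1.trans h.cube.symm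
  have h3 : π ∣ σ π := h.pr.dvd_of_dvd_pow ((dvd_pow_self π (by norm_num)).trans h2.symm.dvd)
  have h4 : σ π ∣ π := hs.dvd_of_dvd_pow ((dvd_pow_self (σ π) (by norm_num)).trans h2.dvd)
  exact associated_of_dvd_dvd h4 h3

lemma Ram.eps (h : Ram p π) (hc : Cub σ) : ∃ ε : Rˣ, σ π = ε * π ∧ nm σ (ε : R) = 1 := by
  obtain ⟨u, hu⟩ := (h.sigma_assoc (σ := σ)).symm
  refine ⟨u, by rw [← hu, mul_comm], ?_⟩
  have h1 := hc.nm_sigma π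
  rw [← hu, nm_mul] at h1
  exact mul_left_cancel₀ (nm_ne_zero (σ := σ) h.pr.ne_zero) (by rw [h1, mul_one])

lemma Cub.nm_unit_cube (hc : Cub σ) (w : R) (h : nm σ w ^ 3 = 1) : nm σ w = 1 := by
  obtain ⟨n, hn⟩ := hc.nm_int w
  rw [hn] at h ⊢
  have h1 : n ^ 3 = 1 := by exact_mod_cast h
  have : n = 1 := by nlinarith [sq_nonneg (n + 1), sq_nonneg n, sq_nonneg (n - 1)]
  simp [this]

lemma Ram.val2 {p1 p2 : ℕ} {π1 π2 : R} (h1 : Ram p1 π1) (h2 : Ram p2 π2) (hc : Cub σ)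
    (h12 : ¬ π1 ∣ π2) (h21 : ¬ π2 ∣ π1) (ε1 ε2 : R) (e1 : σ π1 = ε1 * π1) (e2 : σ π2 = ε2 * π2)
    {a b a' b' : ℕ} (ha : a < 3) (hb : b < 3) (ha' : a' < 3) (hb' : b' < 3) {η : R}
    (hη : IsUnit η) (e : ε1 ^ a * ε2 ^ b * σ η = ε1 ^ a' * ε2 ^ b' * η) : a = a' ∧ b = b' := by
  have n1 : ∀ k, ¬ π1 ∣ π2 ^ k := fun k hk => h12 (h1.pr.dvd_of_dvd_pow hk)
  have n2 : ∀ k, ¬ π2 ∣ π1 ^ k := fun k hk => h21 (h2.pr.dvd_of_dvd_pow hk)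
  have u1 : ¬ π1 ∣ η := fun hk => h1.pr.not_isUnit (isUnit_of_dvd_unit hk hη)
  have u2 : ¬ π2 ∣ η := fun hk => h2.pr.not_isUnit (isUnit_of_dvd_unit hk hη)
  constructor
  · refine h1.val_eq hc (x := π2 ^ b * η) (y := π2 ^ b') ha ha' (by rw [h1.pr.dvd_mul]; have := n1 b; tauto)
      (n1 b') ?_
    simp only [map_mul, map_pow, e1, e2, mul_pow]
    linear_combination (π1 ^ a * π2 ^ b * π1 ^ a' * π2 ^ b') * e
  · refine h2.val_eq hc (x := π1 ^ a * η) (y := π1 ^ a') hb hb' (by rw [h2.pr.dvd_mul]; have := n2 a; tauto)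
      (n2 a') ?_
    simp only [map_mul, map_pow, e1, e2, mul_pow]
    linear_combination (π1 ^ a * π2 ^ b * π1 ^ a' * π2 ^ b') * e

lemma unit_aux {G : Type*} [CommGroup G] {a b c a' b' c' w : G}
    (h : a * (b * c⁻¹) = a' * (b' * c'⁻¹) * w) : a * b * c' = a' * b' * c * w := by
  have h1 : a * b * c' = a * (b * c⁻¹) * (c * c') := by simp [mul_assoc]
  rw [h1, h, mul_comm c c']
  calc a' * (b' * c'⁻¹) * w * (c' * c) = (a' * b' * c * w) * (c' * c'⁻¹) := by
        simp only [mul_assoc, mul_left_comm, mul_comm]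
    _ = _ := by simp

/-- Two ramified primes are impossible. -/
lemma Ram.unique {p1 p2 : ℕ} {π1 π2 : R} (h1 : Ram p1 π1) (h2 : Ram p2 π2) (hc : Cub σ)
    {r : ℕ} (hr : r ≤ 2) (φ : Rˣ → (Fin r → ZMod 3))
    (hφ : ∀ x y, φ x = φ y → ∃ w : Rˣ, x = y * w ^ 3) : π1 ∣ π2 ∨ π2 ∣ π1 := by
  by_contra hcon
  push Not at hcon
  obtain ⟨h12, h21⟩ := hcon
  obtain ⟨ε1, e1, m1⟩ := h1.eps hc
  obtain ⟨ε2, e2, m2⟩ := h2.eps hc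
  let s : Rˣ →* Rˣ := Units.map (σ : R →* R)
  let C : Fin 3 × Fin 3 → Rˣ := fun x => ε1 ^ (x.1 : ℕ) * ε2 ^ (x.2 : ℕ)
  have hC1 : ∀ x, nm σ (C x : R) = 1 := by
    intro x
    simp [C, nm_mul, nm_pow, m1, m2]
  let F : (Fin 3 × Fin 3) × (Fin 3 × Fin 3) → Rˣ := fun x => C x.1 * (C x.2 / s (C x.2))
  obtain ⟨⟨x, y⟩, ⟨x', y'⟩, hne, hF⟩ := Fintype.exists_ne_map_eq_of_card_lt (fun t => φ (F t)) (by
    simp only [Fintype.card_fun, ZMod.card, Fintype.card_fin, Fintype.card_prod]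
    calc 3 ^ r ≤ 3 ^ 2 := Nat.pow_le_pow_right (by norm_num) hr
      _ < _ := by norm_num)
  obtain ⟨w, hw⟩ := hφ _ _ hF
  have hw2 : C x * C y * s (C y') = C x' * C y' * s (C y) * w ^ 3 := by
    simp only [F] at hw
    rw [div_eq_mul_inv, div_eq_mul_inv] at hw
    exact unit_aux hw
  have hw3 : (C x : R) * C y * σ (C y') = C x' * C y' * σ (C y) * (w : R) ^ 3 := by
    have := congrArg (Units.val) hw2
    simpa [s] using this
  have hnw : nm σ (w : R) = 1 := by
    apply hc.nm_unit_cube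
    have := congrArg (nm σ) hw3
    simp only [nm_mul, nm_pow, hc.nm_sigma, hC1, one_mul] at this
    exact this.symm
  have hnw' : (w : R) * σ w * σ (σ w) = 1 := hnw
  set W : R := (w : R) with hW
  set z : R := W ^ 2 * σ W with hz
  have hz1 : W ^ 3 * σ z = z := by
    simp only [hz, map_mul, map_pow]
    linear_combination (W ^ 2 * σ W) * hnw'
  have hzn : nm σ z = 1 := by
    simp only [hz, nm_mul, nm_pow, hc.nm_sigma, hnw]; ring
  have hCy : (C y : R) * σ (C y) * σ (σ (C y)) = 1 := hC1 y
  have hWu : IsUnit W := w.isUnit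
  have hu : ∀ t : R, IsUnit t → IsUnit (σ t) := fun t ht => ht.map σ
  set η : R := C y' * z * σ (C y) * σ (σ (C y)) with hη
  have hηu : IsUnit η := by
    refine IsUnit.mul (IsUnit.mul (IsUnit.mul (C y').isUnit ?_) (hu _ (C y).isUnit))
      (hu _ (hu _ (C y).isUnit))
    exact (hWu.pow 2).mul (hu _ hWu)
  have key1 : (C x : R) * σ η = C x' * η := by
    simp only [hη, map_mul, hc.three]
    linear_combination (σ z * σ (σ (C y))) * hw3 +
      (C x' * C y' * σ (C y) * σ (σ (C y))) * hz1
  obtain ⟨q1, q2⟩ := Ram.val2 h1 h2 hc h12 h21 ε1 ε2 e1 e2 x.1.2 x.2.2 x'.1.2 x'.2.2 hηu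
    (by simpa [C] using key1)
  have hx : x = x' := Prod.ext (Fin.ext q1) (Fin.ext q2)
  subst hx
  have hfix : σ η = η := mul_left_cancel₀ (C x).ne_zero key1
  have hη1 : η = 1 := by
    obtain ⟨n, hn⟩ := hc.fix _ hfix
    have h5 : nm σ η = 1 := by
      simp only [hη, nm_mul, hc.nm_sigma, hC1, hzn, one_mul]
    have h6 : n ^ 3 = 1 := by
      rw [hn, nm_intCast] at h5
      exact_mod_cast h5
    have : n = 1 := by nlinarith [sq_nonneg (n + 1), sq_nonneg n, sq_nonneg (n - 1)]
    rw [hn, this]; simp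
  have hCz : (C y : R) = C y' * z := by
    rw [hη] at hη1
    linear_combination (-(C y : R)) * hη1 + (C y' * z) * hCy
  obtain ⟨q3, q4⟩ := Ram.val2 h1 h2 hc h12 h21 ε1 ε2 e1 e2 y.1.2 y.2.2 y'.1.2 y'.2.2
    (hWu.mul (hu _ hWu)) (η := W * σ W) (by
      have : (C y : R) * σ (W * σ W) = C y' * (W * σ W) := by
        rw [hCz]
        simp only [hz, map_mul]
        linear_combination (C y' * W * σ W) * hnw'
      simpa [C] using this)
  apply hne
  have hy : y = y' := Prod.ext (Fin.ext q3) (Fin.ext q4)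
  rw [hy]

end
end CCF

set_option linter.unusedSectionVars false
namespace CCF

section
variable {R : Type*} [CommRing R] [IsDomain R] [CharZero R] {σ : R ≃+* R} {p : ℕ} {π : R}

lemma Cub.pir (hc : Cub σ) {N : R → ℤ} (hN : ∀ x, (N x : R) = nm σ x)
    (hE : ∀ a b : R, b ≠ 0 → ∃ c, |N (a - c * b)| < |N b|) : IsPrincipalIdealRing R := by
  constructor
  intro I
  by_cases hI : I = ⊥
  · subst hI; exact bot_isPrincipal
  obtain ⟨x, hx, hx0⟩ := Submodule.exists_mem_ne_zero_of_ne_bot hI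
  have hex : ∃ n : ℕ, ∃ y ∈ I, y ≠ 0 ∧ (N y).natAbs = n := ⟨_, x, hx, hx0, rfl⟩
  classical
  obtain ⟨y, hy, hy0, hyn⟩ := Nat.find_spec hex
  refine ⟨⟨y, ?_⟩⟩
  change I = Ideal.span {y}
  apply le_antisymm
  · intro a ha
    rw [Ideal.mem_span_singleton]
    obtain ⟨c, hlt⟩ := hE a y hy0
    by_cases h0 : a - c * y = 0
    · exact ⟨c, by linear_combination h0⟩
    exfalso
    refine Nat.find_min hex (m := (N (a - c * y)).natAbs) ?_
      ⟨_, I.sub_mem ha (I.mul_mem_left _ hy), h0, rfl⟩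
    rw [← hyn]
    rw [Int.abs_eq_natAbs, Int.abs_eq_natAbs] at hlt
    exact_mod_cast hlt
  · rw [Ideal.span_singleton_le_iff_mem]; exact hy

lemma Ram.sigma_sub (h : Ram p π) (x : R) : π ∣ σ x - x := by
  obtain ⟨n, c, hn⟩ := h.res x
  have h1 : π ∣ σ π := (h.sigma_assoc (σ := σ)).symm.dvd
  have h2 : σ x - x = σ π * σ c - π * c := by
    have := congrArg σ hn
    simp only [map_sub, map_mul, map_intCast] at this
    linear_combination this - hn
  rw [h2]
  exact dvd_sub (h1.mul_right _) (dvd_mul_right _ _)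

lemma Ram.nm_sub (h : Ram p π) {x : R} {n : ℤ} (hx : π ∣ x - n) : π ∣ nm σ x - (n : R) ^ 3 := by
  obtain ⟨a, ha⟩ := hx
  obtain ⟨b, hb⟩ := h.sigma_sub (σ := σ) x
  obtain ⟨c, hc⟩ := h.sigma_sub (σ := σ) (σ x)
  have e1 : x = n + π * a := by linear_combination ha
  have e2 : σ x = n + π * (a + b) := by linear_combination hb + ha
  have e3 : σ (σ x) = n + π * (a + b + c) := by linear_combination hc + hb + ha
  rw [nm, e3, e2, e1]
  exact ⟨(n : R) ^ 2 * (a + (a + b) + (a + b + c)) + n * π * (a * (a + b) + a * (a + b + c) +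
    (a + b) * (a + b + c)) + π ^ 2 * (a * (a + b) * (a + b + c)), by ring⟩

lemma Ram.not_dvd_of_ne (h : Ram p π) {q : ℕ} (hq : q.Prime) (hpq : p ≠ q) : ¬ π ∣ (q : R) := by
  intro hd
  have := h.dvd_int (n := q) (by simpa using hd)
  rw [Int.natCast_dvd_natCast] at this
  exact hpq ((Nat.prime_dvd_prime_iff_eq h.pp hq).1 this)

lemma Ram.not_pow_succ (h : Ram p π) (k : ℕ) {x : R} (hx : ¬ π ∣ x) :
    ¬ π ^ (k + 1) ∣ π ^ k * x := by
  rw [pow_succ]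
  intro hd
  exact hx ((mul_dvd_mul_iff_left (pow_ne_zero _ h.pr.ne_zero)).1 hd)

lemma Ram.tr (h : Ram p π) (hc : Cub σ) :
    ∃ t s : ℤ, (t : R) = π + σ π + σ (σ π) ∧ (s : R) = π * σ π + σ π * σ (σ π) + σ (σ π) * π ∧
      π ^ 3 ∣ (t : R) ∧ π ^ 3 ∣ (s : R) := by
  obtain ⟨t, ht⟩ := hc.fix (π + σ π + σ (σ π)) (by simp only [map_add, hc.three]; ring)
  obtain ⟨s, hs⟩ := hc.fix (π * σ π + σ π * σ (σ π) + σ (σ π) * π) (by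
    simp only [map_add, map_mul, hc.three]; ring)
  have h1 : π ∣ σ π := (h.sigma_assoc (σ := σ)).symm.dvd
  have h2 : π ∣ σ (σ π) := h1.trans (by simpa using map_dvd σ h1)
  refine ⟨t, s, ht.symm, hs.symm, ?_, ?_⟩
  · apply h.cube_dvd_int
    apply h.dvd_int
    rw [← ht]
    exact dvd_add (dvd_add dvd_rfl h1) h2
  · apply h.cube_dvd_int
    apply h.dvd_int
    rw [← hs]
    exact dvd_add (dvd_add (dvd_mul_right _ _) (h1.mul_right _)) (dvd_mul_left _ _)

lemma Ram.six (h : Ram p π) {n : ℤ} (hn : π ^ 4 ∣ (n : R)) : π ^ 6 ∣ (n : R) := by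
  by_cases h0 : n = 0
  · simp [h0]
  obtain ⟨k, m, e, hm⟩ := h.int_val h0
  have : 2 ≤ k := by
    by_contra hk
    have : k ≤ 1 := by omega
    rw [e] at hn
    have h2 : π ^ (3 * k + 1) ∣ π ^ (3 * k) * m := (pow_dvd_pow π (by omega)).trans hn
    exact h.not_pow_succ _ hm h2
  rw [e]
  exact (pow_dvd_pow π (by omega)).mul_right _

lemma Ram.diff_bound (h : Ram p π) {k : ℕ} {t s : ℤ} (ht : π ^ 3 ∣ (t : R)) (hs : π ^ 3 ∣ (s : R))
    (hk : π ^ k ∣ 3 * π ^ 2 - 2 * t * π + s) : k ≤ 2 ∨ (p = 3 ∧ k ≤ 5) := by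
  by_cases hp : p = 3
  · right
    refine ⟨hp, ?_⟩
    subst hp
    by_contra hk5
    have h6 : π ^ 6 ∣ 3 * π ^ 2 - 2 * t * π + s := (pow_dvd_pow π (by omega)).trans hk
    obtain ⟨u, hu⟩ := h.cube
    have hu' : (3 : R) = π ^ 3 * u := by rw [hu]; norm_num
    obtain ⟨t', ht'⟩ := ht
    have hs4 : π ^ 4 ∣ (s : R) := by
      have h4 : π ^ 4 ∣ 3 * π ^ 2 - 2 * t * π + s := (pow_dvd_pow π (by norm_num)).trans h6
      rw [ht', hu'] at h4
      have : (s : R) = (π ^ 3 * u * π ^ 2 - 2 * (π ^ 3 * t') * π + s) - π ^ 4 * (u * π - 2 * t') := by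
        ring
      rw [this]
      exact dvd_sub h4 (dvd_mul_right _ _)
    have hs6 := h.six hs4
    have ht4 : π ^ 4 ∣ ((2 * t : ℤ) : R) := by
      have h5 : π ^ 5 ∣ 3 * π ^ 2 - 2 * t * π + s := (pow_dvd_pow π (by norm_num)).trans h6
      have hs5 : π ^ 5 ∣ (s : R) := (pow_dvd_pow π (by norm_num)).trans hs6
      have : π * π ^ 4 ∣ π * ((2 * t : ℤ) : R) := by
        have e : π * ((2 * t : ℤ) : R) = π * π ^ 4 * u - (3 * π ^ 2 - 2 * t * π + s) + s := by
          push_cast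
          linear_combination (π ^ 2) * hu'
        rw [e]
        refine dvd_add (dvd_sub (dvd_mul_right _ _) ?_) ?_
        · convert h5 using 1; ring
        · convert hs5 using 1; ring
      exact (mul_dvd_mul_iff_left h.pr.ne_zero).1 this
    have ht6 := h.six ht4
    have : π ^ (5 + 1) ∣ π ^ 5 * u := by
      have e : π ^ 5 * u = (3 * π ^ 2 - 2 * t * π + s) + ((2 * t : ℤ) : R) * π - s := by
        push_cast
        linear_combination (- π ^ 2) * hu'
      rw [e]
      exact dvd_sub (dvd_add h6 (ht6.mul_right _)) hs6
    refine h.not_pow_succ 5 (fun hd => ?_) this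
    exact h.pr.not_isUnit (isUnit_of_dvd_unit hd u.isUnit)
  · left
    by_contra hk2
    have h3 : π ^ 3 ∣ 3 * π ^ 2 - 2 * t * π + s := (pow_dvd_pow π (by omega)).trans hk
    have h33 := h.not_dvd_of_ne Nat.prime_three hp
    push_cast at h33
    apply h.not_pow_succ 2 h33
    have : π ^ 2 * 3 = (3 * π ^ 2 - 2 * t * π + s) + t * (2 * π) - s := by ring
    rw [this]
    exact dvd_sub (dvd_add h3 (ht.mul_right _)) hs

lemma Ram.mod3 (h : Ram p π) (hc : Cub σ) (hp : p ≠ 3) : 3 ∣ p - 1 := by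
  obtain ⟨ε, e1, n1⟩ := h.eps hc
  obtain ⟨u, hu⟩ := h.res (ε : R)
  obtain ⟨t, s, ht, -, ht3, -⟩ := h.tr hc
  have hs : π ∣ σ (ε : R) - u := by
    have := h.sigma_sub (σ := σ) (ε : R)
    have := dvd_add this hu
    convert this using 1; ring
  have e2 : σ (σ π) = σ (ε : R) * ε * π := by rw [e1, map_mul, e1]; ring
  have h1 : π ∣ 1 + ε + σ (ε : R) * ε := by
    have h2 : π * π ∣ π * (1 + ε + σ (ε : R) * ε) := by
      have : π * (1 + ε + σ (ε : R) * ε) = t := by rw [ht, e2, e1]; ring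
      rw [this, ← pow_two]
      exact (pow_dvd_pow π (by norm_num)).trans ht3
    exact (mul_dvd_mul_iff_left h.pr.ne_zero).1 h2
  have h2 : (p : ℤ) ∣ 1 + u + u ^ 2 := by
    apply h.dvd_int
    obtain ⟨a, ha⟩ := hu
    obtain ⟨b, hb⟩ := hs
    have : ((1 + u + u ^ 2 : ℤ) : R) = (1 + ε + σ (ε : R) * ε) - π * (a + b * ε + u * a) := by
      push_cast
      linear_combination (-1 - (u : R)) * ha - (ε : R) * hb
    rw [this]
    exact dvd_sub h1 (dvd_mul_right _ _)
  have := Fact.mk h.pp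
  have h3 : (1 + u + u ^ 2 : ZMod p) = 0 := by
    have := (ZMod.intCast_zmod_eq_zero_iff_dvd _ p).2 h2
    exact_mod_cast this
  have h4 : (u : ZMod p) ^ 3 = 1 := by linear_combination ((u : ZMod p) - 1) * h3
  have h5 : (u : ZMod p) ≠ 1 := by
    intro hu1
    rw [hu1] at h3
    have h6 : ((3 : ℕ) : ZMod p) = 0 := by push_cast; linear_combination h3
    rw [ZMod.natCast_eq_zero_iff] at h6
    exact hp ((Nat.prime_dvd_prime_iff_eq h.pp Nat.prime_three).1 h6)
  have h7 : orderOf (u : ZMod p) = 3 := orderOf_eq_prime h4 h5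
  rw [← h7]
  apply ZMod.orderOf_dvd_card_sub_one
  intro h0
  rw [h0] at h4
  norm_num at h4

end
end CCF

set_option linter.unusedSectionVars false
namespace CCF

section
variable {R : Type*} [CommRing R] [IsDomain R] [CharZero R] {σ : R ≃+* R} {p : ℕ} {π : R}

lemma Ram.norm_cube (h : Ram p π) {N : R → ℤ} (hN : ∀ x, (N x : R) = nm σ x) (x : R) :
    ∃ a : ZMod p, a ^ 3 = (N x : ZMod p) := by
  obtain ⟨n, hn⟩ := h.res x
  have h1 := h.nm_sub (σ := σ) hn
  rw [← hN] at h1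
  have h2 : (p : ℤ) ∣ N x - n ^ 3 := h.dvd_int (by push_cast; exact h1)
  refine ⟨n, ?_⟩
  have h3 := (ZMod.intCast_zmod_eq_zero_iff_dvd _ p).2 h2
  push_cast at h3
  linear_combination -h3

lemma Ram.inert (h : Ram p π) (hc : Cub σ) [IsPrincipalIdealRing R] {N : R → ℤ}
    (hN : ∀ x, (N x : R) = nm σ x) {q : ℕ} (hq : q.Prime)
    (hqc : ∀ a : ZMod p, a ^ 3 ≠ (q : ZMod p)) : Prime (q : R) := by
  have := Fact.mk h.pp
  have hq0 : (q : R) ≠ 0 := by exact_mod_cast hq.ne_zero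
  have hqu : ¬ IsUnit (q : R) := by
    intro hu
    have h1 : ((q : ℤ) : R) ∣ ((1 : ℤ) : R) := by
      push_cast; exact isUnit_iff_dvd_one.1 hu
    have h2 := int_dvd_of_dvd hc h1
    have : q ∣ 1 := by exact_mod_cast h2
    exact hq.one_lt.ne' (Nat.dvd_one.1 this)
  obtain ⟨ρ, hρ, τ, hτ⟩ := WfDvdMonoid.exists_irreducible_factor hqu hq0
  have hρp : Prime ρ := irreducible_iff_prime.1 hρ
  have hmul : N ρ * N τ = (q : ℤ) ^ 3 := by
    have : ((N ρ * N τ : ℤ) : R) = (((q : ℤ) ^ 3 : ℤ) : R) := by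
      push_cast
      rw [hN, hN, ← nm_mul, ← hτ]
      simp only [nm, map_natCast]; ring
    exact_mod_cast this
  have hunit : ∀ x, (N x).natAbs = 1 → IsUnit x := by
    intro x hx
    apply isUnit_of_dvd_unit (dvd_nm (σ := σ) x)
    rw [← hN]
    rcases Int.natAbs_eq (N x) with h1 | h1 <;> rw [h1, hx] <;> simp
  have hdvd : (N ρ).natAbs ∣ q ^ 3 := by
    have : N ρ ∣ (q : ℤ) ^ 3 := ⟨_, hmul.symm⟩
    have := Int.natAbs_dvd_natAbs.2 this
    simpa [Int.natAbs_pow] using this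
  obtain ⟨i, hi, hiq⟩ := (Nat.dvd_prime_pow hq).1 hdvd
  have hcube : ∃ b : ZMod p, b ^ 3 = (q : ZMod p) ^ i := by
    obtain ⟨a, ha⟩ := h.norm_cube hN ρ
    rcases Int.natAbs_eq (N ρ) with h1 | h1
    · refine ⟨a, ?_⟩
      rw [ha, h1, hiq]; push_cast; rfl
    · refine ⟨-a, ?_⟩
      rw [Odd.neg_pow (by decide), ha, h1, hiq]; push_cast; ring
  obtain ⟨b, hb⟩ := hcube
  have hi' : i = 0 ∨ i = 1 ∨ i = 2 ∨ i = 3 := by omega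
  rcases hi' with rfl | rfl | rfl | rfl
  · exact absurd (hunit ρ (by simpa using hiq)) hρ.not_isUnit
  · exact absurd (by simpa using hb) (hqc b)
  · exfalso
    have hq1 : (q : ZMod p) ≠ 0 := fun h0 => hqc 0 (by rw [h0]; ring)
    have hb0 : b ≠ 0 := by
      rintro rfl
      have : (q : ZMod p) ^ 2 = 0 := by rw [← hb]; ring
      exact hq1 (pow_eq_zero_iff (by norm_num) |>.1 this)
    apply hqc (q / b)
    rw [div_pow, hb]
    field_simp
  · have hτu : IsUnit τ := by
      apply hunit
      have h1 := congrArg Int.natAbs hmul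
      rw [Int.natAbs_mul, hiq, Int.natAbs_pow, Int.natAbs_natCast] at h1
      exact Nat.eq_of_mul_eq_mul_left (pow_pos hq.pos 3) (by rw [h1, mul_one])
    have : Associated ρ (q : R) := by
      obtain ⟨u, rfl⟩ := hτu
      exact ⟨u, hτ.symm⟩
    exact this.prime hρp

lemma val_norm (hc : Cub σ) [IsPrincipalIdealRing R] {N : R → ℤ} (hN : ∀ x, (N x : R) = nm σ x)
    {q : ℕ} (hq : q.Prime) (hqR : Prime (q : R)) {β : R} (hβ : β ≠ 0) :
    3 ∣ padicValNat q (N β).natAbs := by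
  have := Fact.mk hq
  obtain ⟨γ, hγ, hγ2⟩ := (FiniteMultiplicity.of_prime_left hqR hβ).exists_eq_pow_mul_and_not_dvd
  set k := multiplicity (q : R) β
  have h1 : N β = (q : ℤ) ^ (3 * k) * N γ := by
    have : (N β : R) = (((q : ℤ) ^ (3 * k) * N γ : ℤ) : R) := by
      push_cast
      rw [hN, hN, hγ, nm_mul, nm_pow]
      have : nm σ (q : R) = (q : R) ^ 3 := by simp only [nm, map_natCast]; ring
      rw [this, pow_mul]
    exact_mod_cast this
  have h2 : ¬ q ∣ (N γ).natAbs := by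
    intro hd
    have h3 : (q : ℤ) ∣ N γ := Int.natCast_dvd.2 hd
    have h4 : (q : R) ∣ nm σ γ := by
      rw [← hN]
      obtain ⟨c, hc⟩ := h3
      exact ⟨c, by rw [hc]; push_cast; rfl⟩
    have hs : ∀ x, (q : R) ∣ σ x → (q : R) ∣ x := by
      intro x ⟨c, hc⟩
      refine ⟨σ.symm c, ?_⟩
      have := congrArg σ.symm hc
      simpa using this
    rw [nm, hqR.dvd_mul, hqR.dvd_mul] at h4
    rcases h4 with (h4 | h4) | h4
    · exact hγ2 h4
    · exact hγ2 (hs _ h4)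
    · exact hγ2 (hs _ (hs _ h4))
  have hγ0 : (N γ).natAbs ≠ 0 := fun h0 => h2 (by rw [h0]; exact dvd_zero _)
  rw [h1, Int.natAbs_mul, Int.natAbs_pow, Int.natAbs_natCast,
    padicValNat.mul (pow_ne_zero _ hq.ne_zero) hγ0, padicValNat.prime_pow,
    padicValNat.eq_zero_of_not_dvd h2]
  simp

lemma Ram.norm_pi (h : Ram p π) (hc : Cub σ) {N : R → ℤ} (hN : ∀ x, (N x : R) = nm σ x) :
    |N π| = p := by
  have h1 : Associated (nm σ π) (p : R) := by
    refine Associated.trans ?_ h.cube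
    have hs := h.sigma_assoc (σ := σ)
    have hs2 : Associated (σ (σ π)) π := (by simpa using hs.map σ : Associated (σ (σ π)) (σ π)).trans hs
    rw [nm, show π ^ 3 = π * π * π by ring]
    exact ((Associated.refl π).mul_mul hs).mul_mul hs2
  rw [← hN] at h1
  have h2 : N π ∣ (p : ℤ) := int_dvd_of_dvd hc (by simpa using h1.dvd)
  have h3 : (p : ℤ) ∣ N π := int_dvd_of_dvd hc (by simpa using h1.symm.dvd)
  have := Int.natAbs_eq_of_dvd_dvd h2 h3
  rw [Int.abs_eq_natAbs, this]; simp

lemma Ram.hno (h : Ram p π) (hc : Cub σ) [hp : Fact p.Prime] {N : R → ℤ}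
    (hN : ∀ x, (N x : R) = nm σ x)
    (hE : ∀ a b : R, b ≠ 0 → ∃ c, |N (a - c * b)| < |N b|)
    (χ : MulChar (ZMod p) ℂ) (hχ : ∀ x : ZMod p, x ≠ 0 → (χ x = 1 ↔ ∃ a, a ^ 3 = x)) : Hno χ := by
  have := hc.pir hN hE
  intro x hx0 hxp hx1
  have hx00 : (x : ZMod p) ≠ 0 := by
    rw [Ne, ZMod.natCast_eq_zero_iff]
    exact Nat.not_dvd_of_pos_of_lt hx0 hxp
  obtain ⟨a, ha⟩ := (hχ _ hx00).1 hx1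
  obtain ⟨c, hlt⟩ := hE (a.val : R) π h.pr.ne_zero
  rw [h.norm_pi hc hN] at hlt
  set β : R := (a.val : R) - c * π with hβ
  have h1 : π ∣ nm σ β - ((a.val : ℤ) : R) ^ 3 := h.nm_sub (by
    rw [hβ]; push_cast
    exact ⟨-c, by ring⟩)
  rw [← hN] at h1
  have h2 : (p : ℤ) ∣ N β - (a.val : ℤ) ^ 3 := h.dvd_int (by push_cast; push_cast at h1; exact h1)
  have h3 : (p : ℤ) ∣ N β - x := by
    rw [← ZMod.intCast_zmod_eq_zero_iff_dvd] at h2 ⊢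
    push_cast at h2 ⊢
    rw [ZMod.natCast_val, ZMod.cast_id', id, ha] at h2
    exact h2
  have hinert : ∀ q : ℕ, q.Prime → q < p → χ (q : ZMod p) ≠ 1 → Prime (q : R) := by
    intro q hq hqp hq1
    have hq00 : (q : ZMod p) ≠ 0 := by
      rw [Ne, ZMod.natCast_eq_zero_iff]
      exact Nat.not_dvd_of_pos_of_lt hq.pos hqp
    apply h.inert hc hN hq
    intro b hb
    exact hq1 ((hχ _ hq00).2 ⟨b, hb⟩)
  have hcases : N β = x ∨ N β = x - p := by
    obtain ⟨k, hk⟩ := h3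
    rw [abs_lt] at hlt
    have hp0 : (0 : ℤ) < p := by exact_mod_cast hp.out.pos
    have k1 : k < 1 := by
      by_contra hk1
      have : (p : ℤ) * 1 ≤ p * k := mul_le_mul_of_nonneg_left (by omega) hp0.le
      omega
    have k2 : -2 < k := by
      by_contra hk1
      have : (p : ℤ) * k ≤ p * (-2) := mul_le_mul_of_nonneg_left (by omega) hp0.le
      omega
    have : k = 0 ∨ k = -1 := by omega
    rcases this with rfl | rfl
    · left; linarith
    · right; linarith
  have hβ0 : β ≠ 0 := by
    intro h0
    have hz : N β = 0 := by
      have : (N β : R) = 0 := by rw [hN, h0]; simp [nm]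
      exact_mod_cast this
    rcases hcases with h4 | h4 <;> omega
  rcases hcases with h4 | h4
  · left
    intro q hq hqp hq1
    have := val_norm hc hN hq (hinert q hq hqp hq1) hβ0
    rwa [h4, Int.natAbs_natCast] at this
  · right
    intro q hq hqp hq1
    have := val_norm hc hN hq (hinert q hq hqp hq1) hβ0
    have e : (N β).natAbs = p - x := by omega
    rwa [e] at this

lemma exists_chi {p : ℕ} [hp : Fact p.Prime] (h3 : 3 ∣ p - 1) :
    ∃ χ : MulChar (ZMod p) ℂ, χ ^ 3 = 1 ∧ χ ≠ 1 ∧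
      ∀ x : ZMod p, x ≠ 0 → (χ x = 1 ↔ ∃ a, a ^ 3 = x) := by
  obtain ⟨χ, hχ⟩ := MulChar.exists_mulChar_orderOf (ZMod p) (n := 3) (R := ℂ)
    (by rw [ZMod.card]; exact h3) (Complex.isPrimitiveRoot_exp 3 (by norm_num))
  have hc : χ ^ 3 = 1 := by rw [← hχ, pow_orderOf_eq_one]
  have hn : χ ≠ 1 := by
    rintro rfl
    simp at hχ
  refine ⟨χ, hc, hn, ?_⟩
  obtain ⟨g, hg⟩ := IsCyclic.exists_generator (α := (ZMod p)ˣ)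
  have hg3 : χ (g : ZMod p) ^ 3 = 1 := by
    rw [← MulChar.pow_apply_coe, hc, MulChar.one_apply_coe]
  have hg1 : χ (g : ZMod p) ≠ 1 := by
    intro h1
    apply hn
    ext u
    obtain ⟨k, rfl⟩ := Subgroup.mem_zpowers_iff.1 (hg u)
    rw [MulChar.one_apply_coe, ← MulChar.coe_equivToUnitHom, map_zpow]
    have : MulChar.equivToUnitHom χ g = 1 := by
      ext; rw [MulChar.coe_equivToUnitHom]; simpa using h1
    rw [this]; simp
  have hord : orderOf (χ (g : ZMod p)) = 3 := orderOf_eq_prime hg3 hg1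
  intro x hx
  constructor
  · intro h1
    obtain ⟨u, rfl⟩ := (isUnit_iff_ne_zero.2 hx)
    obtain ⟨k, rfl⟩ := (mem_powers_iff_mem_zpowers.2 (hg u))
    simp only [Units.val_pow_eq_pow_val] at h1 ⊢
    rw [map_pow] at h1
    have := orderOf_dvd_of_pow_eq_one h1
    rw [hord] at this
    obtain ⟨j, rfl⟩ := this
    exact ⟨(g : ZMod p) ^ j, by rw [← pow_mul, mul_comm]⟩
  · rintro ⟨a, rfl⟩
    have ha : a ≠ 0 := by rintro rfl; simp at hx
    obtain ⟨u, rfl⟩ := (isUnit_iff_ne_zero.2 ha)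
    rw [map_pow, ← MulChar.pow_apply_coe, hc, MulChar.one_apply_coe]

end
end CCF

set_option linter.unusedSectionVars false
namespace CCF
open NumberField

section
variable (K : Type*) [Field K] [NumberField K]

lemma exists_setup [IsGalois ℚ K] (hdeg : Module.finrank ℚ K = 3) :
    ∃ σ : 𝓞 K ≃+* 𝓞 K, Cub σ ∧
      ∀ x : 𝓞 K, ((Algebra.norm ℤ x : ℤ) : 𝓞 K) = nm σ x := by
  classical
  have hcard : Fintype.card (Gal(K/ℚ)) = 3 := by
    rw [← Nat.card_eq_fintype_card, IsGalois.card_aut_eq_finrank, hdeg]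
  obtain ⟨τ, hτ⟩ := exists_prime_orderOf_dvd_card 3 (by rw [hcard] : 3 ∣ Fintype.card (Gal(K/ℚ)))
  have hτ3 : τ ^ 3 = 1 := by rw [← hτ, pow_orderOf_eq_one]
  have hne1 : τ ≠ 1 := by rintro rfl; simp at hτ
  have hne2 : τ ^ 2 ≠ 1 := by
    intro h
    have := orderOf_dvd_of_pow_eq_one h
    rw [hτ] at this; norm_num at this
  have hne3 : τ ≠ τ ^ 2 := by
    intro h
    apply hne1
    have : τ * 1 = τ * τ := by rw [mul_one, ← pow_two]; exact h
    exact (mul_left_cancel this).symm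
  have huniv : (Finset.univ : Finset (Gal(K/ℚ))) = {1, τ, τ ^ 2} := by
    symm
    apply Finset.eq_univ_of_card
    rw [hcard]
    rw [Finset.card_insert_of_notMem, Finset.card_pair hne3]
    simp [hne1.symm, hne2.symm]
  have h3 : ∀ x : K, τ (τ (τ x)) = x := by
    intro x
    have := congrArg (fun g : Gal(K/ℚ) => g x) hτ3
    simpa [pow_succ] using this
  refine ⟨RingOfIntegers.mapRingEquiv (τ : K ≃+* K), ⟨?_, ?_⟩, ?_⟩
  · intro x
    apply RingOfIntegers.ext
    simp [RingOfIntegers.mapRingEquiv_apply, h3]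
  · intro x hx
    have hx' : τ (x : K) = x := by
      have := congrArg (fun y : 𝓞 K => (y : K)) hx
      simpa [RingOfIntegers.mapRingEquiv_apply] using this
    have h4 : (x : K) ∈ Set.range (algebraMap ℚ K) := by
      rw [IsGalois.mem_range_algebraMap_iff_fixed]
      intro g
      have hg : g ∈ ({1, τ, τ ^ 2} : Finset (Gal(K/ℚ))) := huniv ▸ Finset.mem_univ g
      simp only [Finset.mem_insert, Finset.mem_singleton] at hg
      rcases hg with rfl | rfl | rfl
      · rfl
      · exact hx'
      · simp [pow_two, hx']
    obtain ⟨r, hr⟩ := h4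
    have h5 : IsIntegral ℤ r := by
      have : IsIntegral ℤ (x : K) := x.isIntegral_coe
      rw [← hr] at this
      exact (isIntegral_algebraMap_iff (algebraMap ℚ K).injective).1 this
    obtain ⟨n, hn⟩ := IsIntegrallyClosed.isIntegral_iff.1 h5
    refine ⟨n, ?_⟩
    apply RingOfIntegers.ext
    rw [← hr, ← hn]
    simp
  · intro x
    apply RingOfIntegers.ext
    have h4 := Algebra.norm_eq_prod_automorphisms ℚ (x : K)
    rw [huniv, Finset.prod_insert (by simp [hne1.symm, hne2.symm]), Finset.prod_pair hne3] at h4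
    have h5 : (Algebra.norm ℤ x : ℚ) = Algebra.norm ℚ (x : K) := Algebra.coe_norm_int x
    have h6 : (((Algebra.norm ℤ x : ℤ) : 𝓞 K) : K) = algebraMap ℚ K (Algebra.norm ℚ (x : K)) := by
      rw [← h5]; simp
    rw [h6, h4]
    simp [nm, RingOfIntegers.mapRingEquiv_apply, pow_two, mul_assoc]

lemma exists_phi (hdeg : Module.finrank ℚ K = 3) :
    ∃ (r : ℕ) (_ : r ≤ 2) (φ : (𝓞 K)ˣ → (Fin r → ZMod 3)),
      ∀ x y, φ x = φ y → ∃ w : (𝓞 K)ˣ, x = y * w ^ 3 := by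
  classical
  refine ⟨Units.rank K, ?_, fun x i => ((Units.exist_unique_eq_mul_prod K x).choose.2 i : ℤ), ?_⟩
  · have h1 := InfinitePlace.card_add_two_mul_card_eq_rank K
    have h2 := InfinitePlace.card_eq_nrRealPlaces_add_nrComplexPlaces K
    rw [Units.rank]
    omega
  · intro x y hxy
    dsimp only at hxy
    have hx := (Units.exist_unique_eq_mul_prod K x).choose_spec.1
    have hy := (Units.exist_unique_eq_mul_prod K y).choose_spec.1
    generalize (Units.exist_unique_eq_mul_prod K x).choose = ex at hx hxy
    generalize (Units.exist_unique_eq_mul_prod K y).choose = ey at hy hxy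
    have htor : ∀ t : Units.torsion K, (t : (𝓞 K)ˣ) ^ 3 = t ∧ (t : (𝓞 K)ˣ) ^ 2 = 1 := by
      intro t
      rcases Units.torsion_eq_one_or_neg_one_of_odd_finrank (K := K) (by rw [hdeg]; decide) t with h | h
      · rw [h]; simp
      · rw [h]; constructor
        · rw [Odd.neg_pow (by decide)]; simp
        · simp
    have hdiv : ∀ i, ∃ k : ℤ, ex.2 i = ey.2 i + 3 * k := by
      intro i
      have := congrFun hxy i
      rw [ZMod.intCast_eq_intCast_iff_dvd_sub] at this
      obtain ⟨k, hk⟩ := this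
      exact ⟨-k, by push_cast at hk; linarith⟩
    choose k hk using hdiv
    refine ⟨ex.1 * ey.1 * ∏ i, (Units.fundSystem K i) ^ (k i), ?_⟩
    rw [mul_pow, mul_pow, (htor _).1, ← Finset.prod_pow]
    conv_lhs => rw [hx]
    conv_rhs => rw [hy]
    have e : ∏ i, Units.fundSystem K i ^ ex.2 i = (∏ i, Units.fundSystem K i ^ ey.2 i) *
        ∏ i, (Units.fundSystem K i ^ k i) ^ 3 := by
      rw [← Finset.prod_mul_distrib]
      apply Finset.prod_congr rfl
      intro i _
      rw [hk i, zpow_add, mul_comm 3 (k i), zpow_mul]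
      rfl
    rw [e]
    have e2 : ((ey.1 : (𝓞 K)ˣ)) * (ey.1 : (𝓞 K)ˣ) ^ 3 = 1 := by
      rw [(htor _).1, ← pow_two, (htor _).2]
    set A := ∏ i, Units.fundSystem K i ^ ey.2 i
    set B := ∏ i, (Units.fundSystem K i ^ k i) ^ 3
    calc (ex.1 : (𝓞 K)ˣ) * (A * B) = (ex.1 : (𝓞 K)ˣ) * (A * B) * ((ey.1 : (𝓞 K)ˣ) * (ey.1 : (𝓞 K)ˣ) ^ 3) := by
          rw [e2, mul_one]
      _ = _ := by simp only [mul_assoc, mul_left_comm, mul_comm]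

end
end CCF

set_option linter.unusedSectionVars false
namespace CCF
open NumberField

section
variable {K : Type*} [Field K] [NumberField K]

lemma ram_of_dvd [IsPrincipalIdealRing (𝓞 K)] {σ : 𝓞 K ≃+* 𝓞 K} (hc : Cub σ)
    (hN : ∀ x : 𝓞 K, ((Algebra.norm ℤ x : ℤ) : 𝓞 K) = nm σ x) {π : 𝓞 K} (hπ : Prime π)
    (hd : Ideal.span {π} ∣ differentIdeal ℤ (𝓞 K)) : ∃ p, Ram p π := by
  set N : 𝓞 K → ℤ := fun x => Algebra.norm ℤ x with hNdef
  have hunit : ∀ x, (N x).natAbs = 1 → IsUnit x := by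
    intro x hx
    apply isUnit_of_dvd_unit (dvd_nm (σ := σ) x)
    rw [← hN]
    change IsUnit ((N x : ℤ) : 𝓞 K)
    rcases Int.natAbs_eq (N x) with h1 | h1 <;> rw [h1, hx] <;> simp
  -- a rational prime below
  have hex : ∃ p : ℕ, p.Prime ∧ π ∣ (p : 𝓞 K) := by
    have h0 : N π ≠ 0 := by
      intro h0
      apply nm_ne_zero (σ := σ) hπ.ne_zero
      rw [← hN]; change ((N π : ℤ) : 𝓞 K) = 0; rw [h0]; simp
    have h1 : π ∣ ((N π).natAbs : 𝓞 K) := by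
      have h2 : π ∣ ((N π : ℤ) : 𝓞 K) := by
        change π ∣ ((Algebra.norm ℤ π : ℤ) : 𝓞 K)
        rw [hN]; exact dvd_nm π
      rcases Int.natAbs_eq (N π) with h | h <;> rw [h] at h2
      · simpa using h2
      · simpa using h2
    have h3 : (((N π).natAbs.primeFactorsList).map (fun q : ℕ => (q : 𝓞 K))).prod = ((N π).natAbs : 𝓞 K) := by
      conv_rhs => rw [← Nat.prod_primeFactorsList (n := (N π).natAbs) (by simpa using h0)]
      rw [Nat.cast_list_prod]
    rw [← h3, hπ.dvd_prod_iff] at h1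
    obtain ⟨a, ha, had⟩ := h1
    obtain ⟨q, hq, rfl⟩ := List.mem_map.1 ha
    exact ⟨q, Nat.prime_of_mem_primeFactorsList hq, had⟩
  obtain ⟨p, hp, τ, hτ⟩ := hex
  have hpF := Fact.mk hp
  have hp0 : (p : 𝓞 K) ≠ 0 := by exact_mod_cast hp.ne_zero
  have hmaxP : (Ideal.span {π}).IsMaximal := by
    apply Ideal.IsPrime.isMaximal ((Ideal.span_singleton_prime hπ.ne_zero).2 hπ)
    simpa using hπ.ne_zero
  -- π² divides p
  have hτd : π ∣ τ := by
    by_contra hnd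
    have hmaxp : (Ideal.span {(p : ℤ)}).IsMaximal := by
      apply Ideal.IsPrime.isMaximal
        ((Ideal.span_singleton_prime (by exact_mod_cast hp.ne_zero)).2 (Nat.prime_iff_prime_int.1 hp))
      simpa using hp.ne_zero
    have hfin : Finite (ℤ ⧸ Ideal.span {(p : ℤ)}) :=
      Finite.of_equiv _ (Int.quotientSpanNatEquivZMod p).symm.toEquiv
    refine not_dvd_differentIdeal_of_isCoprime ℤ (p := Ideal.span {(p : ℤ)})
      (Ideal.span {π}) (Ideal.span {τ}) ?_ ?_ hd
    · rw [Ideal.isCoprime_span_singleton_iff]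
      exact (hπ.irreducible.coprime_iff_not_dvd).2 hnd
    · rw [Ideal.span_singleton_mul_span_singleton, ← hτ, Ideal.map_span]
      simp
  obtain ⟨τ', rfl⟩ := hτd
  have hmul : N π * N π * N τ' = (p : ℤ) ^ 3 := by
    have : ((N π * N π * N τ' : ℤ) : 𝓞 K) = (((p : ℤ) ^ 3 : ℤ) : 𝓞 K) := by
      push_cast
      change ((Algebra.norm ℤ π : ℤ) : 𝓞 K) * ((Algebra.norm ℤ π : ℤ) : 𝓞 K) *
        ((Algebra.norm ℤ τ' : ℤ) : 𝓞 K) = _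
      rw [hN, hN, ← nm_mul, ← nm_mul, mul_assoc, ← hτ]
      simp only [nm, map_natCast]; ring
    exact_mod_cast this
  have hNp : (N π).natAbs = p := by
    have h1 := congrArg Int.natAbs hmul
    rw [Int.natAbs_mul, Int.natAbs_mul, Int.natAbs_pow, Int.natAbs_natCast] at h1
    obtain ⟨i, hi, hip⟩ := (Nat.dvd_prime_pow hp).1
      (⟨(N π).natAbs * (N τ').natAbs, by rw [← h1]; ring⟩ : (N π).natAbs ∣ p ^ 3)
    have hi2 : 2 * i ≤ 3 := by
      have h2 : p ^ (2 * i) ∣ p ^ 3 := ⟨(N τ').natAbs, by rw [← h1, hip]; ring⟩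
      exact (Nat.pow_dvd_pow_iff_le_right hp.one_lt).1 h2
    have hi0 : i ≠ 0 := by
      rintro rfl
      exact hπ.not_isUnit (hunit π (by simpa using hip))
    have : i = 1 := by omega
    rw [hip, this, pow_one]
  have hassN : Associated (nm σ π) (p : 𝓞 K) := by
    rw [← hN]
    change Associated ((N π : ℤ) : 𝓞 K) (p : 𝓞 K)
    rcases Int.natAbs_eq (N π) with h | h <;> rw [h, hNp]
    · simp
    · simp
  have hσ : Associated π (σ π) := by
    have hps : Prime (σ π) := (MulEquiv.prime_iff σ.toMulEquiv).2 hπ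
    have hpss : Prime (σ (σ π)) := (MulEquiv.prime_iff σ.toMulEquiv).2 hps
    have h1 : π * π ∣ π * (σ π * σ (σ π)) := by
      have : π * π ∣ (p : 𝓞 K) := ⟨τ', by rw [hτ]; ring⟩
      have h2 := this.trans hassN.symm.dvd
      rwa [nm, mul_assoc] at h2
    rcases hπ.dvd_or_dvd ((mul_dvd_mul_iff_left hπ.ne_zero).1 h1) with h2 | h2
    · exact hπ.associated_of_dvd hps h2
    · have h3 := (hπ.associated_of_dvd hpss h2).map σ
      rw [hc.three] at h3
      exact h3.symm
  have hcube : Associated (π ^ 3) (p : 𝓞 K) := by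
    refine Associated.trans ?_ hassN
    have hσ2 : Associated π (σ (σ π)) := hσ.trans (hσ.map σ)
    rw [nm, show π ^ 3 = π * π * π by ring]
    exact ((Associated.refl π).mul_mul hσ).mul_mul hσ2
  refine ⟨p, hp, hπ, hcube, ?_⟩
  intro x
  have hcard : Nat.card (𝓞 K ⧸ Ideal.span {π}) = p := by
    have h1 := Ideal.absNorm_span_singleton π
    rw [← hNp, ← h1]
    rfl
  have hnt : Nontrivial (𝓞 K ⧸ Ideal.span {π}) := Ideal.Quotient.nontrivial_iff.2 hmaxP.ne_top
  have hgen : Ideal.Quotient.mk (Ideal.span {π}) x ∈ AddSubgroup.zmultiples (1 : 𝓞 K ⧸ Ideal.span {π}) :=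
    mem_zmultiples_of_prime_card hcard one_ne_zero
  obtain ⟨n, hn⟩ := AddSubgroup.mem_zmultiples_iff.1 hgen
  refine ⟨n, ?_⟩
  rw [← Ideal.mem_span_singleton, ← Ideal.Quotient.eq, ← hn]
  simp

end
end CCF

set_option linter.unusedSectionVars false
namespace CCF
open NumberField Polynomial

section
variable {K : Type*} [Field K] [NumberField K]

lemma deriv_mem (hdeg : Module.finrank ℚ K = 3) {σ : 𝓞 K ≃+* 𝓞 K} (hc : Cub σ)
    {p : ℕ} {π : 𝓞 K} (h : Ram p π) {t s : ℤ}
    (ht : (t : 𝓞 K) = π + σ π + σ (σ π))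
    (hs : (s : 𝓞 K) = π * σ π + σ π * σ (σ π) + σ (σ π) * π) :
    3 * π ^ 2 - 2 * t * π + s ∈ differentIdeal ℤ (𝓞 K) := by
  obtain ⟨n, hn⟩ := hc.nm_int π
  have hintg : IsIntegral ℤ π := Algebra.IsIntegral.isIntegral π
  have hmap : minpoly ℚ (algebraMap (𝓞 K) K π) = (minpoly ℤ π).map (algebraMap ℤ ℚ) :=
    minpoly.isIntegrallyClosed_eq_field_fractions ℚ K hintg
  have hdegm : (minpoly ℤ π).natDegree = (minpoly ℚ (algebraMap (𝓞 K) K π)).natDegree := by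
    rw [hmap, natDegree_map_eq_of_injective (algebraMap ℤ ℚ).injective_int]
  have hdvd : (minpoly ℚ (algebraMap (𝓞 K) K π)).natDegree ∣ 3 := by
    rw [← hdeg]
    exact minpoly.degree_dvd (IsIntegral.of_finite ℚ _)
  have hne1 : (minpoly ℚ (algebraMap (𝓞 K) K π)).natDegree ≠ 1 := by
    intro h1
    rw [minpoly.natDegree_eq_one_iff] at h1
    obtain ⟨r, hr⟩ := h1
    have h5 : IsIntegral ℤ r := by
      have : IsIntegral ℤ (algebraMap (𝓞 K) K π) := π.isIntegral_coe
      rw [← hr] at this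
      exact (isIntegral_algebraMap_iff (algebraMap ℚ K).injective).1 this
    obtain ⟨m, hm⟩ := IsIntegrallyClosed.isIntegral_iff.1 h5
    have hπm : π = (m : 𝓞 K) := by
      apply RingOfIntegers.ext
      change algebraMap (𝓞 K) K π = _
      rw [← hr, ← hm]
      simp
    have hp : (p : ℤ) ∣ m := h.dvd_int (by rw [← hπm])
    have h3 := h.cube_dvd_int hp
    rw [← hπm] at h3
    refine h.not_pow_succ 1 (x := 1) (fun hd => h.pr.not_isUnit (isUnit_of_dvd_one hd)) ?_
    rw [pow_one, mul_one]
    exact (pow_dvd_pow π (by norm_num)).trans h3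
  have h3 : (minpoly ℚ (algebraMap (𝓞 K) K π)).natDegree = 3 := by
    rcases (Nat.dvd_prime Nat.prime_three).1 hdvd with h | h
    · exact absurd h hne1
    · exact h
  have hF : minpoly ℤ π = X ^ 3 + (C (-t) * X ^ 2 + C s * X + C (-n)) := by
    have hFm : (X ^ 3 + (C (-t) * X ^ 2 + C s * X + C (-n)) : ℤ[X]).Monic := by
      apply monic_X_pow_add
      compute_degree!
    have hFd : (X ^ 3 + (C (-t) * X ^ 2 + C s * X + C (-n)) : ℤ[X]).natDegree = 3 := by
      compute_degree!
    symm
    refine eq_of_monic_of_dvd_of_natDegree_le (minpoly.monic hintg) hFm ?_ ?_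
    · apply minpoly.isIntegrallyClosed_dvd hintg
      simp only [map_add, map_mul, map_pow, aeval_X, aeval_C, map_neg, eq_intCast, map_intCast]
      rw [ht, hs, ← hn, nm]; ring
    · rw [hFd, hdegm, h3]
  have hadj : Algebra.adjoin ℚ {algebraMap (𝓞 K) K π} = ⊤ := by
    have h1 := (Field.primitive_element_iff_minpoly_natDegree_eq ℚ (algebraMap (𝓞 K) K π)).2
      (by rw [h3, hdeg])
    rw [← IntermediateField.adjoin_simple_toSubalgebra_of_isAlgebraic
      (Algebra.IsAlgebraic.isAlgebraic _), h1]
    rfl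
  have := aeval_derivative_mem_differentIdeal ℤ ℚ K π hadj
  rw [hF] at this
  have e2 : (aeval π) (2:ℤ[X]) = 2 := map_ofNat _ 2
  have e3 : (aeval π) (3:ℤ[X]) = 3 := map_ofNat _ 3
  convert this using 1
  simp [e2, e3]
  ring

theorem main [IsGalois ℚ K] (hdeg : Module.finrank ℚ K = 3)
    (hdisc : 4 * 10 ^ 40 ≤ NumberField.discr K) : ¬ IsNormEuclidean K := by
  intro hE
  obtain ⟨σ, hc, hN⟩ := exists_setup K hdeg
  have hEu : ∀ a b : 𝓞 K, b ≠ 0 → ∃ c : 𝓞 K, |Algebra.norm ℤ (a - c * b)| < |Algebra.norm ℤ b| := by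
    intro a b hb
    have hbK : (b : K) ≠ 0 := by exact_mod_cast hb
    obtain ⟨c, hlt⟩ := hE ((a : K) / b)
    refine ⟨c, ?_⟩
    have h1 : ((a - c * b : 𝓞 K) : K) = ((a : K) / b - c) * b := by
      push_cast
      field_simp
    have h2 : (Algebra.norm ℤ (a - c * b) : ℚ) = Algebra.norm ℚ ((a : K) / b - c) * Algebra.norm ℤ b := by
      rw [Algebra.coe_norm_int, Algebra.coe_norm_int, h1, map_mul]
    have h3 : (0 : ℚ) < |(Algebra.norm ℤ b : ℚ)| := by
      rw [abs_pos, Algebra.coe_norm_int]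
      exact Algebra.norm_ne_zero_iff.2 hbK
    have h4 : |(Algebra.norm ℤ (a - c * b) : ℚ)| < |(Algebra.norm ℤ b : ℚ)| := by
      rw [h2, abs_mul]
      exact mul_lt_of_lt_one_left h3 hlt
    exact_mod_cast h4
  have hpir := hc.pir hN hEu
  obtain ⟨r, hr, φ, hφ⟩ := exists_phi K hdeg
  obtain ⟨d, hd⟩ := (IsPrincipalIdealRing.principal (differentIdeal ℤ (𝓞 K))).principal
  replace hd : differentIdeal ℤ (𝓞 K) = Ideal.span {d} := hd
  have hnorm : (Algebra.norm ℤ d).natAbs = (discr K).natAbs := by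
    rw [← absNorm_differentIdeal K (𝓞 K), hd, Ideal.absNorm_span_singleton]
  have hbig : 4 * 10 ^ 40 ≤ (Algebra.norm ℤ d).natAbs := by
    rw [hnorm]; omega
  have hd0 : d ≠ 0 := by
    rintro rfl
    simp at hbig
  have hdu : ¬ IsUnit d := by
    intro hu
    have := Int.isUnit_iff_natAbs_eq.1 (hu.map (Algebra.norm ℤ))
    omega
  have hram : ∀ ρ : 𝓞 K, Irreducible ρ → ρ ∣ d → ∃ p, Ram p ρ := by
    intro ρ hρ hρd
    apply ram_of_dvd hc hN (irreducible_iff_prime.1 hρ)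
    rw [hd, Ideal.dvd_span_singleton, Ideal.mem_span_singleton]
    exact hρd
  obtain ⟨π, hπ, hπd⟩ := WfDvdMonoid.exists_irreducible_factor hdu hd0
  obtain ⟨p, h⟩ := hram π hπ hπd
  obtain ⟨k, c, hkc, hdk⟩ := WfDvdMonoid.max_power_factor hd0 hπ
  have hcu : IsUnit c := by
    by_contra hcu
    have hc0 : c ≠ 0 := by rintro rfl; simp at hkc
    obtain ⟨ρ, hρ, hρc⟩ := WfDvdMonoid.exists_irreducible_factor hcu hc0
    obtain ⟨p', h'⟩ := hram ρ hρ (by rw [hdk]; exact hρc.mul_left _)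
    rcases Ram.unique h h' hc hr φ hφ with hh | hh
    · exact hkc (hh.trans hρc)
    · exact hkc ((h'.pr.associated_of_dvd h.pr hh).symm.dvd.trans hρc)
  have hNd : (Algebra.norm ℤ d).natAbs = p ^ k := by
    have h1 := h.norm_pi hc hN
    rw [Int.abs_eq_natAbs] at h1
    have h1' : (Algebra.norm ℤ π).natAbs = p := by exact_mod_cast h1
    rw [hdk, map_mul, map_pow, Int.natAbs_mul, Int.natAbs_pow, h1',
      Int.isUnit_iff_natAbs_eq.1 (hcu.map (Algebra.norm ℤ)), mul_one]
  obtain ⟨t, s, ht, hs, ht3, hs3⟩ := h.tr hc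
  have hmem := deriv_mem hdeg hc h ht hs
  rw [hd, Ideal.mem_span_singleton] at hmem
  have hk := h.diff_bound ht3 hs3 ((Dvd.intro _ hdk.symm).trans hmem)
  rw [hNd] at hbig
  have hpF := Fact.mk h.pp
  rcases hk with hk | ⟨rfl, hk⟩
  · have h2 : 4 * 10 ^ 40 ≤ p ^ 2 := hbig.trans (Nat.pow_le_pow_right h.pp.pos hk)
    have hp : 2 * 10 ^ 20 ≤ p := by
      by_contra hlt
      push Not at hlt
      have := Nat.pow_lt_pow_left hlt (n := 2) (by norm_num)
      norm_num at this h2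
      omega
    obtain ⟨χ, c1, c2, c3⟩ := exists_chi (h.mod3 hc (by rintro rfl; norm_num at hp))
    exact no_Hno c1 c2 hp (h.hno hc hN hEu χ c3)
  · have := hbig.trans (Nat.pow_le_pow_right (by norm_num) hk)
    norm_num at this

end
end CCF

/-- A cyclic cubic field whose discriminant is at least `(2 × 10²⁰)² = 4 × 10⁴⁰` is not
norm-Euclidean. -/
theorem not_norm_euclidean_of_large_discr (K : Type*) [Field K] [NumberField K]
    [IsGalois ℚ K] (hdeg : Module.finrank ℚ K = 3)
    (hdisc : 4 * 10 ^ 40 ≤ NumberField.discr K) :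
    ¬ IsNormEuclidean K := CCF.main hdeg hdisc
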